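/- arXiv:1512.06121 — 3 statements merged into one kernel-verified Lean document; each statement's English description precedes it below -/
import Mathlib

section
/- Fix a real number m > 0 and an integer n ≥ 2. For every real β < 2 and every α > 0 there exists a smooth compactly supported function φ : (0,∞) × ℝⁿ → ℂ with δ(φ,M) > 0 such that C_{m,n}² ‖φ‖_{Ḣ¹}² − ‖φ‖_{2*}² < α · δ(φ,M)^β · ‖φ‖_{Ḣ¹}^{2−β}. In other words, the Bianchi–Egnell stability estimate fails if δ(φ,M)² is replaced by δ(φ,M)^β ‖φ‖_{Ḣ¹}^{2−β} with β < 2. -/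
open MeasureTheory

noncomputable section

/-- Generalized surface area of the unit `(m−1)`-sphere, `ω_m = 2π^{m/2}/Γ(m/2)`. -/
def omegaConst (m : ℝ) : ℝ := 2 * Real.pi ^ (m / 2) / Real.Gamma (m / 2)

/-- The measure `Λ` on `(0,∞) × ℝⁿ` given by `dΛ = ω_m ρ^{m−1} dρ dx`. -/
def cylMeasure (m : ℝ) (n : ℕ) : Measure (ℝ × EuclideanSpace ℝ (Fin n)) :=
  (((volume : Measure ℝ).restrict (Set.Ioi 0)).withDensity
      (fun ρ => ENNReal.ofReal (omegaConst m * ρ ^ (m - 1)))).prod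
    (volume : Measure (EuclideanSpace ℝ (Fin n)))

/-- The critical exponent `2* = 2(m+n)/(m+n−2)`. -/
def twoStar (m : ℝ) (n : ℕ) : ℝ := 2 * (m + n) / (m + n - 2)

/-- The exponent `γ = (m+n−2)/2`. -/
def gammaExp (m : ℝ) (n : ℕ) : ℝ := (m + n - 2) / 2

/-- The `L^p(Λ)` norm of a complex-valued cylindrically symmetric function. -/
def cylLpNorm (m : ℝ) (n : ℕ) (p : ℝ) (φ : ℝ × EuclideanSpace ℝ (Fin n) → ℂ) : ℝ :=
  (∫ z, ‖φ z‖ ^ p ∂(cylMeasure m n)) ^ (1 / p)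

/-- Pointwise squared gradient `|∂_ρ φ|² + |∇_x φ|²`. -/
def cylGradSq (n : ℕ) (φ : ℝ × EuclideanSpace ℝ (Fin n) → ℂ)
    (z : ℝ × EuclideanSpace ℝ (Fin n)) : ℝ :=
  ‖fderiv ℝ φ z (1, 0)‖ ^ 2 +
    ∑ i : Fin n, ‖fderiv ℝ φ z (0, EuclideanSpace.single i 1)‖ ^ 2

/-- The homogeneous Sobolev norm `‖φ‖_{Ḣ¹} = (∫ (|∂_ρ φ|² + |∇_x φ|²) dΛ)^{1/2}`. -/
def cylH1Norm (m : ℝ) (n : ℕ) (φ : ℝ × EuclideanSpace ℝ (Fin n) → ℂ) : ℝ :=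
  Real.sqrt (∫ z, cylGradSq n φ z ∂(cylMeasure m n))

/-- The extremal `F_{t,x₀}(ρ,x) = k₀ t^γ (1 + t²ρ² + t²|x−x₀|²)^{−γ}`. -/
def cylBubble (m : ℝ) (n : ℕ) (k₀ t : ℝ) (x₀ : EuclideanSpace ℝ (Fin n)) :
    ℝ × EuclideanSpace ℝ (Fin n) → ℂ :=
  fun z =>
    ((k₀ * t ^ gammaExp m n *
        (1 + t ^ 2 * z.1 ^ 2 + t ^ 2 * ‖z.2 - x₀‖ ^ 2) ^ (-(gammaExp m n)) : ℝ) : ℂ)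

/-- The distance `δ(φ, M) = inf_{z∈ℂ, t>0, x₀∈ℝⁿ} ‖φ − z F_{t,x₀}‖_{Ḣ¹}` from `φ` to
the manifold of extremals. -/
def cylDeltaM (m : ℝ) (n : ℕ) (k₀ : ℝ) (φ : ℝ × EuclideanSpace ℝ (Fin n) → ℂ) : ℝ :=
  ⨅ p : ℂ × {t : ℝ // 0 < t} × EuclideanSpace ℝ (Fin n),
    cylH1Norm m n (fun w => φ w - p.1 • cylBubble m n k₀ p.2.1.1 p.2.2 w)


abbrev EE (n : ℕ) := ℝ × EuclideanSpace ℝ (Fin n)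

def GG (n : ℕ) (f : EE n → ℝ) (z : EE n) : ℝ :=
  (fderiv ℝ f z (1, 0)) ^ 2 + ∑ i : Fin n, (fderiv ℝ f z (0, EuclideanSpace.single i 1)) ^ 2

lemma GG_nonneg (n : ℕ) (f : EE n → ℝ) (z : EE n) : 0 ≤ GG n f z := by
  unfold GG; positivity

lemma gradSq_split (n : ℕ) (f g : EE n → ℝ) (z : EE n) (hf : DifferentiableAt ℝ f z)
    (hg : DifferentiableAt ℝ g z) :
    cylGradSq n (fun w => (f w : ℂ) + (g w : ℂ) * Complex.I) z = GG n f z + GG n g z := by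
  have hF : HasFDerivAt (fun w => (f w : ℂ) + (g w : ℂ) * Complex.I)
      (Complex.ofRealCLM.comp (fderiv ℝ f z) +
        Complex.I • (Complex.ofRealCLM.comp (fderiv ℝ g z))) z := by
    have h1 := Complex.ofRealCLM.hasFDerivAt.comp z hf.hasFDerivAt
    have h2 := Complex.ofRealCLM.hasFDerivAt.comp z hg.hasFDerivAt
    have h3 := h1.add (h2.const_smul Complex.I)
    refine h3.congr_of_eventuallyEq (Filter.Eventually.of_forall fun w => ?_)
    simp [mul_comm]
  have key : ∀ v, ‖fderiv ℝ (fun w => (f w : ℂ) + (g w : ℂ) * Complex.I) z v‖ ^ 2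
      = (fderiv ℝ f z v) ^ 2 + (fderiv ℝ g z v) ^ 2 := by
    intro v
    rw [hF.fderiv, Complex.sq_norm, Complex.normSq_apply]
    simp
    ring
  unfold cylGradSq GG
  simp only [key, Finset.sum_add_distrib]
  ring

lemma GG_cont (n : ℕ) (f : EE n → ℝ) (hf : ContDiff ℝ 1 f) : Continuous (GG n f) := by
  have h := hf.continuous_fderiv one_ne_zero
  unfold GG
  fun_prop

lemma GG_sub_le (n : ℕ) (f g : EE n → ℝ) (a : ℝ) (z : EE n) (hf : DifferentiableAt ℝ f z)
    (hg : DifferentiableAt ℝ g z) :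
    GG n (fun w => f w - a * g w) z ≤ 2 * GG n f z + 2 * a ^ 2 * GG n g z := by
  have h : fderiv ℝ (fun w => f w - a * g w) z = fderiv ℝ f z - a • fderiv ℝ g z :=
    (hf.hasFDerivAt.sub (hg.hasFDerivAt.const_mul a)).fderiv
  unfold GG
  rw [h]
  have key : ∀ v, ((fderiv ℝ f z - a • fderiv ℝ g z) v) ^ 2 ≤
      2 * (fderiv ℝ f z v) ^ 2 + 2 * a ^ 2 * (fderiv ℝ g z v) ^ 2 := by
    intro v
    simp
    nlinarith [sq_nonneg (fderiv ℝ f z v + a * fderiv ℝ g z v)]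
  calc _ ≤ (2 * (fderiv ℝ f z (1,0)) ^ 2 + 2 * a ^ 2 * (fderiv ℝ g z (1,0)) ^ 2) +
        ∑ i : Fin n, (2 * (fderiv ℝ f z (0, EuclideanSpace.single i 1)) ^ 2
          + 2 * a ^ 2 * (fderiv ℝ g z (0, EuclideanSpace.single i 1)) ^ 2) := by
        gcongr <;> apply key
    _ = _ := by
        rw [Finset.sum_add_distrib, ← Finset.mul_sum, ← Finset.mul_sum]; ring

/-- product estimate -/
lemma GG_mul_le (n : ℕ) (f g : EE n → ℝ) (L : ℝ) (z : EE n) (hf : DifferentiableAt ℝ f z)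
    (hg : DifferentiableAt ℝ g z) (h1 : |f z| ≤ 1)
    (hL : ‖fderiv ℝ f z‖ ≤ L) :
    GG n (fun w => f w * g w) z ≤ 2 * GG n g z + 2 * (n + 1) * (L ^ 2 * g z ^ 2) := by
  have h : fderiv ℝ (fun w => f w * g w) z = f z • fderiv ℝ g z + g z • fderiv ℝ f z :=
    (hf.hasFDerivAt.mul hg.hasFDerivAt).fderiv
  unfold GG
  rw [h]
  have key : ∀ v, ‖v‖ ≤ 1 → ((f z • fderiv ℝ g z + g z • fderiv ℝ f z) v) ^ 2 ≤
      2 * (fderiv ℝ g z v) ^ 2 + 2 * (L ^ 2 * g z ^ 2) := by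
    intro v hv
    simp
    have h2 : |fderiv ℝ f z v| ≤ L := by
      have := (fderiv ℝ f z).le_opNorm v
      rw [Real.norm_eq_abs] at this
      nlinarith [norm_nonneg (fderiv ℝ f z), norm_nonneg v]
    have h3 : (fderiv ℝ f z v) ^ 2 ≤ L ^ 2 := by
      rw [← sq_abs]; gcongr
    have h4 : f z ^ 2 ≤ 1 := by rw [← sq_abs]; nlinarith [abs_nonneg (f z)]
    nlinarith [sq_nonneg (f z * fderiv ℝ g z v - g z * fderiv ℝ f z v),
      mul_le_mul_of_nonneg_right h3 (sq_nonneg (g z)),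
      mul_le_mul_of_nonneg_right h4 (sq_nonneg (fderiv ℝ g z v))]
  calc _ ≤ (2 * (fderiv ℝ g z (1,0)) ^ 2 + 2 * (L ^ 2 * g z ^ 2)) +
        ∑ i : Fin n, (2 * (fderiv ℝ g z (0, EuclideanSpace.single i 1)) ^ 2
          + 2 * (L ^ 2 * g z ^ 2)) := by
        gcongr <;> apply key <;> simp [Prod.norm_def]
    _ = _ := by
        rw [Finset.sum_add_distrib, ← Finset.mul_sum]; simp; ring

/-- real bubble -/
def RB (m : ℝ) (n : ℕ) (k₀ t : ℝ) (x₀ : EuclideanSpace ℝ (Fin n)) : EE n → ℝ :=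
  fun z => k₀ * t ^ gammaExp m n *
        (1 + t ^ 2 * z.1 ^ 2 + t ^ 2 * ‖z.2 - x₀‖ ^ 2) ^ (-(gammaExp m n))

lemma RB_contDiff (m : ℝ) (n : ℕ) (k₀ t : ℝ) (x₀ : EuclideanSpace ℝ (Fin n)) :
    ContDiff ℝ (⊤ : ℕ∞) (RB m n k₀ t x₀) := by
  unfold RB
  apply ContDiff.mul contDiff_const
  apply ContDiff.rpow_const_of_ne
  · have : ContDiff ℝ (⊤ : ℕ∞) (fun z : EE n => ‖z.2 - x₀‖ ^ 2) :=
      ContDiff.norm_sq ℝ (contDiff_snd.sub contDiff_const)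
    fun_prop
  · intro z; positivity

lemma RB_fderiv (m : ℝ) (n : ℕ) (k₀ t : ℝ) (x₀ : EuclideanSpace ℝ (Fin n)) (z v : EE n) :
    fderiv ℝ (RB m n k₀ t x₀) z v = -(2 * gammaExp m n * t ^ 2 * (k₀ * t ^ gammaExp m n) *
      (1 + t ^ 2 * z.1 ^ 2 + t ^ 2 * ‖z.2 - x₀‖ ^ 2) ^ (-(gammaExp m n) - 1)) *
      (z.1 * v.1 + inner ℝ (z.2 - x₀) v.2) := by
  have h1 : HasFDerivAt (fun z : EE n => ‖z.2 - x₀‖ ^ 2)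
      (2 • (innerSL ℝ (z.2 - x₀)).comp (ContinuousLinearMap.snd ℝ ℝ _)) z := by
    exact (hasFDerivAt_snd.sub_const x₀).norm_sq
  have h2 : HasFDerivAt (fun z : EE n => z.1 ^ 2)
      ((2 * z.1) • (ContinuousLinearMap.fst ℝ ℝ (EuclideanSpace ℝ (Fin n)))) z := by
    have := (hasFDerivAt_fst (𝕜 := ℝ) (p := z)).pow 2
    simpa using this
  have h3 := ((h2.const_mul (t^2)).const_add 1).add (h1.const_mul (t^2))
  have h4 := h3.rpow_const (p := -(gammaExp m n)) (Or.inl (by simp; positivity))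
  have h5 := h4.const_mul (k₀ * t ^ gammaExp m n)
  have h6 : fderiv ℝ (RB m n k₀ t x₀) z = _ := h5.fderiv
  rw [h6]
  simp [inner_sub_left]
  ring

lemma RB_GG (m : ℝ) (n : ℕ) (k₀ t : ℝ) (x₀ : EuclideanSpace ℝ (Fin n)) (z : EE n) :
    GG n (RB m n k₀ t x₀) z = (2 * gammaExp m n * t ^ 2 * (k₀ * t ^ gammaExp m n) *
      (1 + t ^ 2 * z.1 ^ 2 + t ^ 2 * ‖z.2 - x₀‖ ^ 2) ^ (-(gammaExp m n) - 1)) ^ 2 *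
      (z.1 ^ 2 + ‖z.2 - x₀‖ ^ 2) := by
  unfold GG
  simp only [RB_fderiv]
  rw [EuclideanSpace.real_norm_sq_eq]
  simp only [EuclideanSpace.inner_single_right]
  simp only [mul_pow, mul_add, Finset.mul_sum]
  simp [mul_pow]

lemma omega_pos (m : ℝ) (hm : 0 < m) : 0 < omegaConst m := by
  unfold omegaConst
  have := Real.Gamma_pos_of_pos (half_pos hm)
  have := Real.pi_pos
  positivity

def radM (m : ℝ) : Measure ℝ := ((volume : Measure ℝ).restrict (Set.Ioi 0)).withDensity
      (fun ρ => ENNReal.ofReal (omegaConst m * ρ ^ (m - 1)))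

lemma radM_lf (m : ℝ) (hm : 0 < m) : IsLocallyFiniteMeasure (radM m) := by
  constructor
  intro x
  refine ⟨Set.Iio (|x| + 1), Iio_mem_nhds (by linarith [le_abs_self x]), ?_⟩
  unfold radM
  rw [withDensity_apply _ measurableSet_Iio, Measure.restrict_restrict measurableSet_Iio]
  have h := (intervalIntegral.intervalIntegrable_rpow' (a := 0) (b := |x| + 1) (r := m - 1)
    (by linarith)).const_mul (omegaConst m)
  rw [intervalIntegrable_iff, Set.uIoc_of_le (by positivity)] at h
  have h2 := h.mono_set (s := Set.Iio (|x| + 1) ∩ Set.Ioi 0) (fun y hy => ⟨hy.2, le_of_lt hy.1⟩)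
  exact h2.lintegral_lt_top

lemma cyl_eq (m : ℝ) (n : ℕ) : cylMeasure m n = (radM m).prod volume := rfl

lemma radM_sf (m : ℝ) : SFinite (radM m) := by
  unfold radM; infer_instance

lemma cyl_lf (m : ℝ) (n : ℕ) (hm : 0 < m) : IsLocallyFiniteMeasure (cylMeasure m n) := by
  rw [cyl_eq]
  have := radM_lf m hm
  infer_instance

lemma cyl_ae (m : ℝ) (n : ℕ) : ∀ᵐ z ∂(cylMeasure m n), 0 < z.1 := by
  have h : ∀ᵐ r ∂(radM m), 0 < r := by
    have h1 : radM m ≪ (volume : Measure ℝ).restrict (Set.Ioi 0) :=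
      withDensity_absolutelyContinuous _ _
    exact h1.ae_le (ae_restrict_mem measurableSet_Ioi)
  rw [cyl_eq]
  have := radM_sf m
  exact (Measure.quasiMeasurePreserving_fst).ae h

lemma cyl_pos (m : ℝ) (n : ℕ) (hm : 0 < m) (U : Set (EE n)) (hU : IsOpen U) (hne : U.Nonempty)
    (hpos : ∀ z ∈ U, 0 < z.1) : 0 < cylMeasure m n U := by
  have h1 : (volume : Measure ℝ).restrict (Set.Ioi 0) ≪ radM m := by
    apply withDensity_absolutelyContinuous'
    · apply Measurable.aemeasurable
      fun_prop
    · filter_upwards [ae_restrict_mem measurableSet_Ioi] with r hr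
      have := omega_pos m hm
      have : (0:ℝ) < r ^ (m - 1) := Real.rpow_pos_of_pos hr _
      simp only [ne_eq, ENNReal.ofReal_eq_zero, not_le]
      positivity
  have := radM_sf m
  have h2 := h1.prod (Measure.AbsolutelyContinuous.refl (volume : Measure (EuclideanSpace ℝ (Fin n))))
  rw [← cyl_eq] at h2
  rw [pos_iff_ne_zero]
  intro h0
  have h3 := h2 h0
  have h4 : ((volume : Measure ℝ).restrict (Set.Ioi 0)).prod (volume : Measure (EuclideanSpace ℝ (Fin n)))
      = (volume : Measure (EE n)).restrict (Set.Ioi 0 ×ˢ Set.univ) := by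
    rw [Measure.volume_eq_prod, ← Measure.prod_restrict, Measure.restrict_univ]
  rw [h4, Measure.restrict_apply hU.measurableSet, Set.inter_eq_left.2] at h3
  · exact (hU.measure_pos volume hne).ne' h3
  · intro z hz; exact ⟨hpos z hz, trivial⟩

lemma gamma_pos (m : ℝ) (n : ℕ) (hm : 0 < m) (hn : 2 ≤ n) : 0 < gammaExp m n := by
  unfold gammaExp
  have : (2:ℝ) ≤ n := by exact_mod_cast hn
  linarith

lemma GG_cs (n : ℕ) (f : EE n → ℝ) (hf : HasCompactSupport f) : HasCompactSupport (GG n f) := by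
  have h := hf.fderiv ℝ
  apply h.mono
  intro z hz
  rw [Function.mem_support] at hz ⊢
  intro h0
  apply hz
  simp [GG, h0]

lemma GG_int_cs (m : ℝ) (n : ℕ) (hm : 0 < m) (f : EE n → ℝ) (hf : ContDiff ℝ 1 f)
    (hc : HasCompactSupport f) : Integrable (GG n f) (cylMeasure m n) := by
  have := cyl_lf m n hm
  exact (GG_cont n f hf).integrable_of_hasCompactSupport (GG_cs n f hc)

lemma RB_int (m : ℝ) (n : ℕ) (hm : 0 < m) (hn : 2 ≤ n) (k₀ : ℝ) (hk₀ : 0 < k₀)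
    (h1 : Integrable (GG n (RB m n k₀ 1 0)) (cylMeasure m n)) (t : ℝ) (ht : 0 < t)
    (x₀ : EuclideanSpace ℝ (Fin n)) :
    Integrable (GG n (RB m n k₀ t x₀)) (cylMeasure m n) := by
  have := cyl_lf m n hm
  have hγ := gamma_pos m n hm hn
  set γ := gammaExp m n with hγd
  have hcont : Continuous (GG n (RB m n k₀ t x₀)) :=
    GG_cont n _ ((RB_contDiff m n k₀ t x₀).of_le (by exact_mod_cast le_top))
  set S : Set (EE n) := Metric.closedBall 0 1 with hS
  have hSc : IsCompact S := isCompact_closedBall _ _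
  have hi1 : IntegrableOn (GG n (RB m n k₀ t x₀)) S (cylMeasure m n) :=
    hcont.continuousOn.integrableOn_compact hSc
  have hi2 : IntegrableOn (GG n (RB m n k₀ t x₀)) Sᶜ (cylMeasure m n) := by
    set a : ℝ := ‖x₀‖ with ha
    have ha0 : 0 ≤ a := norm_nonneg _
    set K' : ℝ := (1 + 2 * a ^ 2) + 2 / t ^ 2 with hK'
    have hK'0 : 0 < K' := by positivity
    set K : ℝ := (2 + 2 * a ^ 2) * (t ^ 2 * t ^ γ * K' ^ (γ + 1)) ^ 2 with hK
    refine Integrable.mono' (g := fun z => K * GG n (RB m n k₀ 1 0) z)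
      (h1.const_mul K).integrableOn hcont.aestronglyMeasurable ?_
    filter_upwards [ae_restrict_mem hSc.measurableSet.compl] with z hz
    rw [Real.norm_of_nonneg (GG_nonneg _ _ _), RB_GG, RB_GG]
    simp only [one_pow, one_mul, mul_one, Real.one_rpow, sub_zero, ← hγd]
    set s2 := z.1 ^ 2 + ‖z.2 - x₀‖ ^ 2 with hs2
    set r2 := z.1 ^ 2 + ‖z.2‖ ^ 2 with hr2
    have hs20 : 0 ≤ s2 := by positivity
    have hr20 : 0 ≤ r2 := by positivity
    have e1 : 1 + t ^ 2 * z.1 ^ 2 + t ^ 2 * ‖z.2 - x₀‖ ^ 2 = 1 + t ^ 2 * s2 := by rw [hs2]; ring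
    have e2 : 1 + z.1 ^ 2 + ‖z.2‖ ^ 2 = 1 + r2 := by rw [hr2]; ring
    rw [e1, e2]
    have hr1 : 1 ≤ r2 := by
      have : ¬ ‖z‖ ≤ 1 := by simpa [hS] using hz
      rw [Prod.norm_def, max_le_iff, not_and_or, not_le, not_le, Real.norm_eq_abs] at this
      rcases this with h | h
      · have : 1 ≤ z.1 ^ 2 := by rw [← sq_abs]; nlinarith
        nlinarith [sq_nonneg ‖z.2‖]
      · nlinarith [sq_nonneg z.1]
    have n1 : ‖z.2 - x₀‖ ≤ ‖z.2‖ + a := norm_sub_le _ _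
    have n2 : ‖z.2‖ ≤ ‖z.2 - x₀‖ + a := by
      have := norm_add_le (z.2 - x₀) x₀
      simpa using this
    have hsr : s2 ≤ (2 + 2 * a ^ 2) * r2 := by
      have : ‖z.2 - x₀‖ ^ 2 ≤ 2 * ‖z.2‖ ^ 2 + 2 * a ^ 2 := by
        nlinarith [norm_nonneg (z.2 - x₀), sq_nonneg (‖z.2‖ - a)]
      have : s2 ≤ 2 * r2 + 2 * a ^ 2 := by
        rw [hs2, hr2]; nlinarith [sq_nonneg z.1]
      nlinarith [sq_nonneg a]
    have hrs : 1 + r2 ≤ K' * (1 + t ^ 2 * s2) := by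
      have : ‖z.2‖ ^ 2 ≤ 2 * ‖z.2 - x₀‖ ^ 2 + 2 * a ^ 2 := by
        nlinarith [norm_nonneg z.2, sq_nonneg (‖z.2 - x₀‖ - a)]
      have h5 : r2 ≤ 2 * s2 + 2 * a ^ 2 := by
        rw [hs2, hr2]; nlinarith [sq_nonneg z.1]
      have h6 : K' * (1 + t ^ 2 * s2) =
          (1 + 2 * a ^ 2) + 2 * s2 + ((1 + 2 * a^2) * (t ^ 2 * s2) + 2 / t ^ 2) := by
        rw [hK']; field_simp; ring
      have : 0 ≤ ((1 + 2 * a^2) * (t ^ 2 * s2) + 2 / t ^ 2) := by positivity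
      rw [h6]; linarith
    have hpow : (1 + t ^ 2 * s2) ^ (-γ - 1) ≤ K' ^ (γ + 1) * (1 + r2) ^ (-γ - 1) := by
      have h7 := Real.rpow_le_rpow_of_nonpos (z := -γ - 1) (by positivity) hrs (by linarith)
      rw [Real.mul_rpow hK'0.le (by positivity)] at h7
      have h8 : K' ^ (γ + 1) * K' ^ (-γ - 1) = 1 := by
        rw [← Real.rpow_add hK'0]; simp
      calc (1 + t ^ 2 * s2) ^ (-γ - 1) = K' ^ (γ + 1) * (K' ^ (-γ - 1) * (1 + t ^ 2 * s2) ^ (-γ - 1)) := by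
            rw [← mul_assoc, h8, one_mul]
        _ ≤ _ := by gcongr
    calc (2 * γ * t ^ 2 * (k₀ * t ^ γ) * (1 + t ^ 2 * s2) ^ (-γ - 1)) ^ 2 * s2
        ≤ (2 * γ * t ^ 2 * (k₀ * t ^ γ) * (K' ^ (γ + 1) * (1 + r2) ^ (-γ - 1))) ^ 2 *
            ((2 + 2 * a ^ 2) * r2) := by gcongr
      _ = _ := by rw [hK]; ring
  have := hi1.union hi2
  rwa [Set.union_compl_self, integrableOn_univ] at this

lemma exists_cut (n : ℕ) : ∃ (χ : ℕ → EE n → ℝ) (K : ℝ), 0 ≤ K ∧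
    (∀ k, ContDiff ℝ (⊤ : ℕ∞) (χ k)) ∧ (∀ k, HasCompactSupport (χ k)) ∧
    (∀ k z, 0 ≤ χ k z) ∧ (∀ k z, χ k z ≤ 1) ∧
    (∀ z, ∀ᶠ k in Filter.atTop, χ k =ᶠ[nhds z] fun _ => 1) ∧
    (∀ k z, ‖z‖ < 1 → fderiv ℝ (χ k) z = 0) ∧
    (∀ k z, ‖fderiv ℝ (χ k) z‖ * ‖z‖ ≤ K) := by
  let b : ContDiffBump (0 : EE n) := ⟨1, 2, one_pos, one_lt_two⟩
  have hb : ContDiff ℝ (⊤ : ℕ∞) (b : EE n → ℝ) := b.contDiff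
  have hbd := hb.continuous_fderiv (by simp)
  obtain ⟨K, hK⟩ := (hbd.norm.mul continuous_norm).bounded_above_of_compact_support
    ((b.hasCompactSupport.fderiv ℝ).norm.mul_right)
  have hχ : ∀ k : ℕ, ∀ z, ‖z‖ < (k:ℝ) + 1 →
      (fun z : EE n => b (((k:ℝ) + 1)⁻¹ • z)) =ᶠ[nhds z] fun _ => 1 := by
    intro k z hz
    have : Metric.ball (0 : EE n) ((k:ℝ)+1) ∈ nhds z := Metric.isOpen_ball.mem_nhds (by simpa using hz)
    filter_upwards [this] with w hw
    apply b.one_of_mem_closedBall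
    have hk : (0:ℝ) < (k:ℝ) + 1 := by positivity
    rw [mem_closedBall_zero_iff, norm_smul, norm_inv, Real.norm_of_nonneg hk.le]
    rw [mem_ball_zero_iff] at hw
    show _ ≤ (1:ℝ)
    rw [inv_mul_le_iff₀ hk]; linarith
  refine ⟨fun k z => b (((k:ℝ) + 1)⁻¹ • z), |K|, abs_nonneg _, ?_, ?_, ?_, ?_, ?_, ?_, ?_⟩
  · intro k
    exact hb.comp (contDiff_const_smul _)
  · intro k
    exact b.hasCompactSupport.comp_smul (by positivity)
  · intro k z; exact b.nonneg
  · intro k z; exact b.le_one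
  · intro z
    obtain ⟨N, hN⟩ := exists_nat_gt ‖z‖
    filter_upwards [Filter.eventually_ge_atTop N] with k hk
    apply hχ
    have : (N:ℝ) ≤ k := by exact_mod_cast hk
    linarith
  · intro k z hz
    rw [(hχ k z (by linarith [Nat.cast_nonneg (α := ℝ) k])).fderiv_eq]
    simp
  · intro k z
    have hk : (0:ℝ) < (k:ℝ) + 1 := by positivity
    have h1 : fderiv ℝ (fun z : EE n => b (((k:ℝ) + 1)⁻¹ • z)) z =
        ((k:ℝ) + 1)⁻¹ • fderiv ℝ b (((k:ℝ) + 1)⁻¹ • z) := by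
      exact fderiv_comp_smul _
    rw [h1, norm_smul]
    have := hK (((k:ℝ) + 1)⁻¹ • z)
    simp only [Pi.mul_apply] at this
    rw [norm_mul, norm_norm, norm_norm, norm_smul] at this
    calc _ = ‖fderiv ℝ (b : EE n → ℝ) (((k:ℝ) + 1)⁻¹ • z)‖ * (‖((k:ℝ) + 1)⁻¹‖ * ‖z‖) := by ring
      _ ≤ K := this
      _ ≤ _ := le_abs_self K

lemma RB_sq_le (m : ℝ) (n : ℕ) (hm : 0 < m) (hn : 2 ≤ n) (k₀ : ℝ) (z : EE n)
    (hz : 1 ≤ ‖z‖) :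
    gammaExp m n ^ 2 * RB m n k₀ 1 0 z ^ 2 ≤ 2 * ‖z‖ ^ 2 * GG n (RB m n k₀ 1 0) z := by
  have hγ := gamma_pos m n hm hn
  rw [RB_GG]
  unfold RB
  set γ := gammaExp m n with hγd
  simp only [one_pow, one_mul, mul_one, Real.one_rpow, sub_zero]
  have ha : z.1 ^ 2 ≤ ‖z‖ ^ 2 := by
    rw [← sq_abs]; have := norm_fst_le z; rw [Real.norm_eq_abs] at this; gcongr
  have hb : ‖z.2‖ ^ 2 ≤ ‖z‖ ^ 2 := by
    have := norm_snd_le z; gcongr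
  have hr1 : ‖z‖ ^ 2 ≤ z.1 ^ 2 + ‖z.2‖ ^ 2 := by
    rw [Prod.norm_def, Real.norm_eq_abs]
    rcases max_choice |z.1| ‖z.2‖ with h | h <;> rw [h]
    · rw [sq_abs]; nlinarith [sq_nonneg ‖z.2‖]
    · nlinarith [sq_nonneg z.1]
  have hr1' : 1 ≤ ‖z‖ ^ 2 := by nlinarith
  have e : (1 + z.1 ^ 2 + ‖z.2‖ ^ 2) ^ (-γ - 1) = (1 + z.1 ^ 2 + ‖z.2‖ ^ 2) ^ (-γ) / (1 + z.1 ^ 2 + ‖z.2‖ ^ 2) := by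
    rw [Real.rpow_sub (by positivity), Real.rpow_one]
  rw [e]
  set r2 := z.1 ^ 2 + ‖z.2‖ ^ 2 with hr2
  have e2 : 1 + z.1 ^ 2 + ‖z.2‖ ^ 2 = 1 + r2 := by rw [hr2]; ring
  rw [e2]
  set P := (1 + r2) ^ (-γ)
  have h0 : 0 ≤ r2 := by positivity
  have key : (1 + r2) ^ 2 ≤ 8 * (‖z‖ ^ 2 * r2) := by
    have : r2 ≤ 2 * ‖z‖ ^ 2 := by linarith
    nlinarith
  have : 2 * ‖z‖ ^ 2 * ((2 * γ * k₀ * (P / (1 + r2))) ^ 2 * r2) =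
     (γ ^ 2 * (k₀ * P) ^ 2) * (8 * (‖z‖ ^ 2 * r2) / (1 + r2) ^ 2) := by
    field_simp; ring
  rw [this]
  refine le_mul_of_one_le_right (by positivity) ?_
  rw [le_div_iff₀ (by positivity)]; linarith

lemma h1_eq (m : ℝ) (n : ℕ) (f g : EE n → ℝ) (hf : ContDiff ℝ 1 f) (hg : ContDiff ℝ 1 g) :
    cylH1Norm m n (fun w => (f w : ℂ) + (g w : ℂ) * Complex.I) =
      Real.sqrt (∫ z, (GG n f z + GG n g z) ∂(cylMeasure m n)) := by
  unfold cylH1Norm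
  congr 2
  funext z
  exact gradSq_split n f g z (hf.differentiable one_ne_zero z) (hg.differentiable one_ne_zero z)

lemma GG_zero (n : ℕ) : GG n (fun _ => 0) = 0 := by
  funext z; simp [GG]

lemma bubble_eq (m : ℝ) (n : ℕ) (k₀ t : ℝ) (x₀ : EuclideanSpace ℝ (Fin n)) (z : EE n) :
    cylBubble m n k₀ t x₀ z = (RB m n k₀ t x₀ z : ℂ) := rfl

lemma RB1_int (m : ℝ) (n : ℕ) (k₀ : ℝ)
    (hnorm : cylH1Norm m n (cylBubble m n k₀ 1 0) = 1) :
    Integrable (GG n (RB m n k₀ 1 0)) (cylMeasure m n) ∧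
      ∫ z, GG n (RB m n k₀ 1 0) z ∂(cylMeasure m n) = 1 := by
  have h := h1_eq m n (RB m n k₀ 1 0) (fun _ => 0)
    ((RB_contDiff m n k₀ 1 0).of_le (by exact_mod_cast le_top)) contDiff_const
  have e : (fun w => (RB m n k₀ 1 0 w : ℂ) + ((0:ℝ) : ℂ) * Complex.I) = cylBubble m n k₀ 1 0 := by
    funext w; rw [bubble_eq]; simp
  rw [e, hnorm, GG_zero] at h
  simp only [Pi.zero_apply, add_zero] at h
  have h2 : ∫ z, GG n (RB m n k₀ 1 0) z ∂(cylMeasure m n) = 1 := by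
    exact (Real.sqrt_eq_one.1 h.symm)
  refine ⟨?_, h2⟩
  by_contra hc
  rw [integral_undef hc] at h2
  exact zero_ne_one h2

lemma trunc_lim (m : ℝ) (n : ℕ) (hm : 0 < m) (hn : 2 ≤ n) (k₀ : ℝ)
    (hnorm : cylH1Norm m n (cylBubble m n k₀ 1 0) = 1) :
    ∃ χ : ℕ → EE n → ℝ, (∀ k, ContDiff ℝ (⊤ : ℕ∞) (χ k)) ∧ (∀ k, HasCompactSupport (χ k)) ∧
      Filter.Tendsto (fun k => ∫ z, GG n (fun w => χ k w * RB m n k₀ 1 0 w) z ∂(cylMeasure m n))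
        Filter.atTop (nhds 1) ∧
      ∀ p : ℝ, 0 < p → Integrable (fun z => ‖cylBubble m n k₀ 1 0 z‖ ^ p) (cylMeasure m n) →
        Filter.Tendsto (fun k => ∫ z, |χ k z * RB m n k₀ 1 0 z| ^ p ∂(cylMeasure m n))
          Filter.atTop (nhds (∫ z, ‖cylBubble m n k₀ 1 0 z‖ ^ p ∂(cylMeasure m n))) := by
  obtain ⟨χ, K, hK0, hs, hc, hχ0, hχ1, hev, hz1, hz2⟩ := exists_cut n
  obtain ⟨hi, hi1⟩ := RB1_int m n k₀ hnorm
  have hγ := gamma_pos m n hm hn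
  have hRB := RB_contDiff m n k₀ 1 0
  refine ⟨χ, hs, hc, ?_, ?_⟩
  · suffices H : Filter.Tendsto
        (fun k => ∫ z, GG n (fun w => χ k w * RB m n k₀ 1 0 w) z ∂(cylMeasure m n))
        Filter.atTop (nhds (∫ z, GG n (RB m n k₀ 1 0) z ∂(cylMeasure m n))) by rwa [hi1] at H
    refine tendsto_integral_of_dominated_convergence
      (fun z => (2 + 2 * (n + 1) * (K ^ 2 * (2 / gammaExp m n ^ 2))) * GG n (RB m n k₀ 1 0) z)
      ?_ (hi.const_mul _) ?_ ?_
    · intro k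
      exact (GG_cont n _ (((hs k).mul hRB).of_le (by exact_mod_cast le_top))).aestronglyMeasurable
    · intro k
      refine Filter.Eventually.of_forall fun z => ?_
      rw [Real.norm_of_nonneg (GG_nonneg _ _ _)]
      have hG := GG_nonneg n (RB m n k₀ 1 0) z
      refine (GG_mul_le n (χ k) _ ‖fderiv ℝ (χ k) z‖ z ((hs k).differentiable (by simp) z)
        (hRB.differentiable (by simp) z) (abs_le.2 ⟨by linarith [hχ0 k z], hχ1 k z⟩) le_rfl).trans ?_
      rw [add_mul]
      have : ‖fderiv ℝ (χ k) z‖ ^ 2 * RB m n k₀ 1 0 z ^ 2 ≤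
          (K ^ 2 * (2 / gammaExp m n ^ 2)) * GG n (RB m n k₀ 1 0) z := by
        by_cases h : ‖z‖ < 1
        · rw [hz1 k z h]; simp; positivity
        · push Not at h
          have h1 := RB_sq_le m n hm hn k₀ z h
          have h2 : (‖fderiv ℝ (χ k) z‖ * ‖z‖) ^ 2 ≤ K ^ 2 := by
            have := hz2 k z; gcongr
          have h3 : RB m n k₀ 1 0 z ^ 2 ≤
              2 * ‖z‖ ^ 2 * GG n (RB m n k₀ 1 0) z / gammaExp m n ^ 2 := by
            rw [le_div_iff₀ (by positivity)]; linarith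
          calc _ ≤ ‖fderiv ℝ (χ k) z‖ ^ 2 * (2 * ‖z‖ ^ 2 * GG n (RB m n k₀ 1 0) z / gammaExp m n ^ 2) := by
                gcongr
            _ = (‖fderiv ℝ (χ k) z‖ * ‖z‖) ^ 2 * (2 / gammaExp m n ^ 2) * GG n (RB m n k₀ 1 0) z := by
                ring
            _ ≤ _ := by gcongr
      have h4 := mul_le_mul_of_nonneg_left this (by positivity : (0:ℝ) ≤ 2 * (n + 1))
      linarith
    · refine Filter.Eventually.of_forall fun z => ?_
      refine tendsto_const_nhds.congr' ?_
      filter_upwards [hev z] with k hk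
      have : (fun w => χ k w * RB m n k₀ 1 0 w) =ᶠ[nhds z] RB m n k₀ 1 0 := by
        filter_upwards [hk] with w hw
        rw [hw, one_mul]
      unfold GG
      rw [this.fderiv_eq]
  · intro p hp hip
    refine tendsto_integral_of_dominated_convergence _ ?_ hip ?_ ?_
    · intro k
      have h1 := (hs k).continuous
      have h2 := hRB.continuous
      exact ((h1.mul h2).abs.rpow_const (fun _ => Or.inr hp.le)).aestronglyMeasurable
    · intro k
      refine Filter.Eventually.of_forall fun z => ?_
      rw [Real.norm_of_nonneg (by positivity), bubble_eq, Complex.norm_real, Real.norm_eq_abs, abs_mul,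
        abs_of_nonneg (hχ0 k z)]
      refine Real.rpow_le_rpow (by have := hχ0 k z; positivity) ?_ hp.le
      exact mul_le_of_le_one_left (abs_nonneg _) (hχ1 k z)
    · refine Filter.Eventually.of_forall fun z => ?_
      refine tendsto_const_nhds.congr' ?_
      filter_upwards [hev z] with k hk
      rw [hk.self_of_nhds, one_mul, bubble_eq, Complex.norm_real, Real.norm_eq_abs]

lemma exists_psi (m : ℝ) (n : ℕ) (hm : 0 < m) : ∃ ψ : EE n → ℝ, ContDiff ℝ (⊤ : ℕ∞) ψ ∧
    HasCompactSupport ψ ∧ ∃ c : ℝ, 0 < c ∧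
    c ^ 2 ≤ ∫ z, (max (fderiv ℝ ψ z (1, 0)) 0) ^ 2 ∂(cylMeasure m n) ∧
    c ^ 2 ≤ ∫ z, (max (-fderiv ℝ ψ z (1, 0)) 0) ^ 2 ∂(cylMeasure m n) := by
  let b : ContDiffBump ((3, 0) : EE n) := ⟨1, 2, one_pos, one_lt_two⟩
  have hb : ContDiff ℝ (⊤ : ℕ∞) (b : EE n → ℝ) := b.contDiff
  have hbd := hb.continuous_fderiv (by simp)
  have hcont : Continuous fun z => fderiv ℝ (b : EE n → ℝ) z (1, 0) := by fun_prop
  have hcs : HasCompactSupport fun z => fderiv ℝ (b : EE n → ℝ) z (1, 0) :=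
    b.hasCompactSupport.fderiv_apply ℝ _
  have hline : ∀ r : ℝ, HasDerivAt (fun r : ℝ => b ((r, 0) : EE n))
      (fderiv ℝ (b : EE n → ℝ) (r, 0) (1, 0)) r := by
    intro r
    have h1 : HasDerivAt (fun r : ℝ => ((r, 0) : EE n)) (1, 0) r :=
      (hasDerivAt_id r).prodMk (hasDerivAt_const r 0)
    exact HasFDerivAt.comp_hasDerivAt (l := (b : EE n → ℝ)) (f := fun r : ℝ => ((r, 0) : EE n)) r
      (hb.differentiable (by simp) (r, 0)).hasFDerivAt h1
  have b3 : b ((3, 0) : EE n) = 1 := b.one_of_mem_closedBall (by simp [b])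
  have b1 : b ((1, 0) : EE n) = 0 := b.zero_of_le_dist (by
    simp [b, Prod.dist_eq, Real.dist_eq]; norm_num)
  have b5 : b ((5, 0) : EE n) = 0 := b.zero_of_le_dist (by
    simp [b, Prod.dist_eq, Real.dist_eq]; norm_num)
  have pos : ∀ g : EE n → ℝ, Continuous g → HasCompactSupport g → (∃ z : EE n, 0 < z.1 ∧ 0 < g z) →
      0 < ∫ z, (max (g z) 0) ^ 2 ∂(cylMeasure m n) := by
    intro g hg hgc ⟨z, hz, hgz⟩
    have := cyl_lf m n hm
    have hi : Integrable (fun z => (max (g z) 0) ^ 2) (cylMeasure m n) := by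
      apply Continuous.integrable_of_hasCompactSupport
      · fun_prop
      · apply hgc.mono
        intro w hw
        rw [Function.mem_support] at hw ⊢
        intro h; apply hw; simp [h]
    rw [integral_pos_iff_support_of_nonneg (fun z => by positivity) hi]
    refine lt_of_lt_of_le (cyl_pos m n hm ({z | 0 < z.1} ∩ {z | 0 < g z}) ?_ ⟨z, hz, hgz⟩
      (fun z hz => hz.1)) (measure_mono ?_)
    · exact (isOpen_lt continuous_const continuous_fst).inter (isOpen_lt continuous_const hg)
    · intro w hw
      have : 0 < g w := hw.2
      rw [Function.mem_support, max_eq_left this.le]; positivity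
  have p1 := pos _ hcont hcs (by
    obtain ⟨c, hc, h⟩ := exists_hasDerivAt_eq_slope (fun r : ℝ => b ((r, 0) : EE n)) _
      (by norm_num : (1:ℝ) < 3) (fun r _ => (hline r).continuousAt.continuousWithinAt) (fun r _ => hline r)
    rw [b1, b3] at h
    refine ⟨(c, 0), by simp; linarith [hc.1], by rw [h]; norm_num⟩)
  have p2 := pos _ hcont.neg hcs.neg (by
    obtain ⟨c, hc, h⟩ := exists_hasDerivAt_eq_slope (fun r : ℝ => b ((r, 0) : EE n)) _
      (by norm_num : (3:ℝ) < 5) (fun r _ => (hline r).continuousAt.continuousWithinAt) (fun r _ => hline r)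
    rw [b3, b5] at h
    refine ⟨(c, 0), by simp; linarith [hc.1], by simp only [Pi.neg_apply]; rw [h]; norm_num⟩)
  refine ⟨b, hb, b.hasCompactSupport, Real.sqrt (min _ _), Real.sqrt_pos.2 (lt_min p1 p2), ?_, ?_⟩
  · rw [Real.sq_sqrt (lt_min p1 p2).le]; exact min_le_left _ _
  · rw [Real.sq_sqrt (lt_min p1 p2).le]; exact min_le_right _ _

lemma top1 : (1 : WithTop ℕ∞) ≤ ((⊤ : ℕ∞) : WithTop ℕ∞) := by exact_mod_cast le_top

lemma h1_lower (m : ℝ) (n : ℕ) (hm : 0 < m) (hn : 2 ≤ n) (k₀ : ℝ) (hk₀ : 0 < k₀)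
    (hnorm : cylH1Norm m n (cylBubble m n k₀ 1 0) = 1)
    (u ψ : EE n → ℝ) (hu : ContDiff ℝ (⊤ : ℕ∞) u) (huc : HasCompactSupport u)
    (hψ : ContDiff ℝ (⊤ : ℕ∞) ψ) (hψc : HasCompactSupport ψ) (c : ℝ) (hc : 0 < c)
    (hc1 : c ^ 2 ≤ ∫ z, (max (fderiv ℝ ψ z (1, 0)) 0) ^ 2 ∂(cylMeasure m n))
    (hc2 : c ^ 2 ≤ ∫ z, (max (-fderiv ℝ ψ z (1, 0)) 0) ^ 2 ∂(cylMeasure m n))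
    (ε : ℝ) (hε : 0 < ε) (ζ : ℂ) (t : ℝ) (ht : 0 < t) (x₀ : EuclideanSpace ℝ (Fin n)) :
    ε * c ≤ cylH1Norm m n (fun w => ((u w : ℂ) + ((ε * ψ w : ℝ) : ℂ) * Complex.I) -
      ζ • cylBubble m n k₀ t x₀ w) := by
  have hγ := gamma_pos m n hm hn
  set B := RB m n k₀ t x₀ with hB
  have hBs : ContDiff ℝ (⊤ : ℕ∞) B := RB_contDiff m n k₀ t x₀
  have hεψ : ContDiff ℝ (⊤ : ℕ∞) (fun w => ε * ψ w) := contDiff_const.mul hψ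
  have e : (fun w => ((u w : ℂ) + ((ε * ψ w : ℝ) : ℂ) * Complex.I) - ζ • cylBubble m n k₀ t x₀ w)
      = fun w => ((u w - ζ.re * B w : ℝ) : ℂ) + ((ε * ψ w - ζ.im * B w : ℝ) : ℂ) * Complex.I := by
    funext w
    rw [bubble_eq, ← hB]
    apply Complex.ext <;> simp
  have s1 : ContDiff ℝ (⊤ : ℕ∞) (fun w => u w - ζ.re * B w) := hu.sub (contDiff_const.mul hBs)
  have s2 : ContDiff ℝ (⊤ : ℕ∞) (fun w => ε * ψ w - ζ.im * B w) := hεψ.sub (contDiff_const.mul hBs)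
  rw [e, h1_eq m n _ _ (s1.of_le top1) (s2.of_le top1)]
  have iB : Integrable (GG n B) (cylMeasure m n) :=
    RB_int m n hm hn k₀ hk₀ (RB1_int m n k₀ hnorm).1 t ht x₀
  have gen : ∀ (f : EE n → ℝ) (a : ℝ), ContDiff ℝ (⊤ : ℕ∞) f → HasCompactSupport f →
      Integrable (GG n (fun w => f w - a * B w)) (cylMeasure m n) := by
    intro f a hf hfc
    refine Integrable.mono' (((GG_int_cs m n hm f (hf.of_le top1) hfc).const_mul 2).add
      (iB.const_mul (2 * a ^ 2)))
      (GG_cont n _ ((hf.sub (contDiff_const.mul hBs)).of_le top1)).aestronglyMeasurable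
      (Filter.Eventually.of_forall fun z => ?_)
    rw [Real.norm_of_nonneg (GG_nonneg _ _ _)]
    exact GG_sub_le n f B a z (hf.differentiable (by simp) z) (hBs.differentiable (by simp) z)
  have i1 := gen u ζ.re hu huc
  have i2 := gen (fun w => ε * ψ w) ζ.im hεψ hψc.mul_left
  apply Real.le_sqrt_of_sq_le
  have hd : ∀ z : EE n, 0 < z.1 → fderiv ℝ B z (1, 0) ≤ 0 := by
    intro z hz
    rw [hB, RB_fderiv]
    simp only [inner_zero_right, mul_one, add_zero]
    have : 0 < (1 + t ^ 2 * z.1 ^ 2 + t ^ 2 * ‖z.2 - x₀‖ ^ 2) ^ (-(gammaExp m n) - 1) := by positivity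
    have : 0 < t ^ gammaExp m n := by positivity
    rw [neg_mul, neg_nonpos]
    positivity
  have hfd : ∀ z, fderiv ℝ (fun w => ε * ψ w - ζ.im * B w) z (1, 0) =
      ε * fderiv ℝ ψ z (1, 0) - ζ.im * fderiv ℝ B z (1, 0) := by
    intro z
    have h := ((hψ.differentiable (by simp) z).hasFDerivAt.const_mul ε).sub
      ((hBs.differentiable (by simp) z).hasFDerivAt.const_mul ζ.im)
    have h' : fderiv ℝ (fun w => ε * ψ w - ζ.im * B w) z = _ := h.fderiv
    rw [h']
    simp
  have hG : ∀ z, (ε * fderiv ℝ ψ z (1, 0) - ζ.im * fderiv ℝ B z (1, 0)) ^ 2 ≤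
      GG n (fun w => u w - ζ.re * B w) z + GG n (fun w => ε * ψ w - ζ.im * B w) z := by
    intro z
    rw [← hfd]
    have h1 := GG_nonneg n (fun w => u w - ζ.re * B w) z
    have h2 : 0 ≤ ∑ i : Fin n, (fderiv ℝ (fun w => ε * ψ w - ζ.im * B w) z
      (0, EuclideanSpace.single i 1)) ^ 2 := by positivity
    have h3 : GG n (fun w => ε * ψ w - ζ.im * B w) z =
      (fderiv ℝ (fun w => ε * ψ w - ζ.im * B w) z (1, 0)) ^ 2 +
      ∑ i : Fin n, (fderiv ℝ (fun w => ε * ψ w - ζ.im * B w) z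
      (0, EuclideanSpace.single i 1)) ^ 2 := rfl
    linarith
  rw [mul_pow]
  rcases le_total 0 ζ.im with hb | hb
  · calc ε ^ 2 * c ^ 2 ≤ ε ^ 2 * ∫ z, (max (fderiv ℝ ψ z (1, 0)) 0) ^ 2 ∂(cylMeasure m n) := by gcongr
      _ = ∫ z, ε ^ 2 * (max (fderiv ℝ ψ z (1, 0)) 0) ^ 2 ∂(cylMeasure m n) := by
        rw [integral_const_mul]
      _ ≤ _ := by
        refine integral_mono_of_nonneg (Filter.Eventually.of_forall fun z => by positivity)
          (i1.add i2) ?_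
        filter_upwards [cyl_ae m n] with z hz
        refine le_trans ?_ (hG z)
        have h1 : 0 ≤ - (ζ.im * fderiv ℝ B z (1, 0)) := by nlinarith [hd z hz]
        rcases le_total (fderiv ℝ ψ z (1, 0)) 0 with h | h
        · rw [max_eq_right h]; nlinarith [sq_nonneg (ε * fderiv ℝ ψ z (1, 0) - ζ.im * fderiv ℝ B z (1, 0))]
        · rw [max_eq_left h, ← mul_pow]
          have : 0 ≤ ε * fderiv ℝ ψ z (1, 0) := by positivity
          gcongr; linarith
  · calc ε ^ 2 * c ^ 2 ≤ ε ^ 2 * ∫ z, (max (-fderiv ℝ ψ z (1, 0)) 0) ^ 2 ∂(cylMeasure m n) := by gcongr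
      _ = ∫ z, ε ^ 2 * (max (-fderiv ℝ ψ z (1, 0)) 0) ^ 2 ∂(cylMeasure m n) := by
        rw [integral_const_mul]
      _ ≤ _ := by
        refine integral_mono_of_nonneg (Filter.Eventually.of_forall fun z => by positivity)
          (i1.add i2) ?_
        filter_upwards [cyl_ae m n] with z hz
        refine le_trans ?_ (hG z)
        have h1 : 0 ≤ (ζ.im * fderiv ℝ B z (1, 0)) := by nlinarith [hd z hz]
        rcases le_total (-fderiv ℝ ψ z (1, 0)) 0 with h | h
        · rw [max_eq_right h]; nlinarith [sq_nonneg (ε * fderiv ℝ ψ z (1, 0) - ζ.im * fderiv ℝ B z (1, 0))]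
        · rw [max_eq_left h, ← mul_pow, ← neg_sq (ε * fderiv ℝ ψ z (1, 0) - ζ.im * fderiv ℝ B z (1, 0))]
          have : 0 ≤ ε * -fderiv ℝ ψ z (1, 0) := by positivity
          gcongr; linarith

/-- **Sharpness of the exponent 2 in the Bianchi–Egnell extension.**
For every `β < 2` and every `α > 0` there is a smooth compactly supported
`φ : (0,∞) × ℝⁿ → ℂ` with `δ(φ,M) > 0` and
`C_{m,n}² ‖φ‖_{Ḣ¹}² − ‖φ‖_{2*}² < α δ(φ,M)^β ‖φ‖_{Ḣ¹}^{2−β}`. -/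
theorem bianchi_egnell_extension_sharpness (m : ℝ) (n : ℕ) (hm : 0 < m) (hn : 2 ≤ n)
    (k₀ : ℝ) (hk₀ : 0 < k₀)
    (hnorm : cylH1Norm m n (cylBubble m n k₀ 1 0) = 1)
    (β : ℝ) (hβ : β < 2) (α : ℝ) (hα : 0 < α) :
    ∃ φ : ℝ × EuclideanSpace ℝ (Fin n) → ℂ,
      ContDiff ℝ (⊤ : ℕ∞) φ ∧ HasCompactSupport φ ∧ 0 < cylDeltaM m n k₀ φ ∧
        cylLpNorm m n (twoStar m n) (cylBubble m n k₀ 1 0) ^ 2 * cylH1Norm m n φ ^ 2 -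
            cylLpNorm m n (twoStar m n) φ ^ 2 <
          α * cylDeltaM m n k₀ φ ^ β * cylH1Norm m n φ ^ (2 - β) := by
  have hγ := gamma_pos m n hm hn
  have hp : 0 < twoStar m n := by
    have h2 : (2:ℝ) ≤ n := by exact_mod_cast hn
    unfold twoStar
    apply div_pos <;> linarith
  obtain ⟨χ, hχs, hχc, hlim, hLp⟩ := trunc_lim m n hm hn k₀ hnorm
  obtain ⟨ψ, hψ, hψc, c, hc, hc1, hc2⟩ := exists_psi m n hm
  set p := twoStar m n with hpd
  set C := cylLpNorm m n p (cylBubble m n k₀ 1 0) with hC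
  set s := ∫ z, GG n ψ z ∂(cylMeasure m n) with hs
  have hs0 : 0 ≤ s := integral_nonneg fun z => GG_nonneg _ _ _
  set β' := max β 1 with hβ'
  have hβ2 : β' < 2 := max_lt hβ (by norm_num)
  have hβ1 : 1 ≤ β' := le_max_right _ _
  -- choose ε
  obtain ⟨ε, hε, hεs⟩ : ∃ ε : ℝ, 0 < ε ∧ C ^ 2 * s * ε ^ 2 < α * (ε * c) ^ β' / 2 := by
    have h1 : Filter.Tendsto (fun ε : ℝ => C ^ 2 * s * ε ^ (2 - β')) (nhdsWithin 0 (Set.Ioi 0))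
        (nhds 0) := by
      have : Filter.Tendsto (fun ε : ℝ => C ^ 2 * s * ε ^ (2 - β')) (nhds 0)
          (nhds (C ^ 2 * s * 0 ^ (2 - β'))) :=
        ((Real.continuousAt_rpow_const 0 (2 - β') (Or.inr (by linarith))).tendsto).const_mul _
      rw [Real.zero_rpow (by linarith), mul_zero] at this
      exact this.mono_left nhdsWithin_le_nhds
    have hcp : 0 < α * c ^ β' / 2 := by positivity
    obtain ⟨ε, h2, h3⟩ := ((h1.eventually (gt_mem_nhds hcp)).and self_mem_nhdsWithin).exists
    have h3 : 0 < ε := h3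
    refine ⟨ε, h3, ?_⟩
    have h4 : ε ^ 2 = ε ^ (2 - β') * ε ^ β' := by
      rw [← Real.rpow_add h3]; simp
    rw [h4, Real.mul_rpow h3.le hc.le]
    have h5 : 0 < ε ^ β' := by positivity
    nlinarith
  -- the test functions
  let u : ℕ → EE n → ℝ := fun k w => χ k w * RB m n k₀ 1 0 w
  have hu : ∀ k, ContDiff ℝ (⊤ : ℕ∞) (u k) := fun k => (hχs k).mul (RB_contDiff m n k₀ 1 0)
  have huc : ∀ k, HasCompactSupport (u k) := fun k => (hχc k).mul_right
  let φ : ℕ → EE n → ℂ := fun k w => (u k w : ℂ) + ((ε * ψ w : ℝ) : ℂ) * Complex.I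
  have hεψ : ContDiff ℝ (⊤ : ℕ∞) (fun w => ε * ψ w) := contDiff_const.mul hψ
  have hφs : ∀ k, ContDiff ℝ (⊤ : ℕ∞) (φ k) := fun k =>
    (Complex.ofRealCLM.contDiff.comp (hu k)).add
      ((Complex.ofRealCLM.contDiff.comp hεψ).mul contDiff_const)
  have hφc : ∀ k, HasCompactSupport (φ k) := by
    intro k
    refine HasCompactSupport.add ?_ (HasCompactSupport.mul_right ?_)
    · exact (huc k).comp_left (g := fun x : ℝ => (x : ℂ)) (by simp)
    · exact (hψc.mul_left (f := fun _ => ε)).comp_left (g := fun x : ℝ => (x : ℂ)) (by simp)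
  have hGε : ∀ z, GG n (fun w => ε * ψ w) z = ε ^ 2 * GG n ψ z := by
    intro z
    have h' : fderiv ℝ (fun w => ε * ψ w) z = ε • fderiv ℝ ψ z :=
      ((hψ.differentiable (by simp) z).hasFDerivAt.const_mul ε).fderiv
    unfold GG
    rw [h', mul_add, Finset.mul_sum]
    simp [mul_pow]
  set h : ℕ → ℝ := fun k => ∫ z, GG n (u k) z ∂(cylMeasure m n) with hh
  have hh0 : ∀ k, 0 ≤ h k := fun k => integral_nonneg fun z => GG_nonneg _ _ _
  have hN : ∀ k, cylH1Norm m n (φ k) ^ 2 = h k + ε ^ 2 * s := by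
    intro k
    have : cylH1Norm m n (φ k) = _ := h1_eq m n (u k) (fun w => ε * ψ w) ((hu k).of_le top1)
      (hεψ.of_le top1)
    rw [this, Real.sq_sqrt (integral_nonneg fun z => add_nonneg (GG_nonneg _ _ _) (GG_nonneg _ _ _))]
    simp only [hGε]
    rw [integral_add (GG_int_cs m n hm _ ((hu k).of_le top1) (huc k))
      ((GG_int_cs m n hm _ (hψ.of_le top1) hψc).const_mul _), integral_const_mul]
  have hN0 : ∀ k, 0 ≤ cylH1Norm m n (φ k) := fun k => Real.sqrt_nonneg _
  have hne : Nonempty (ℂ × {t : ℝ // 0 < t} × EuclideanSpace ℝ (Fin n)) := ⟨0, ⟨1, one_pos⟩, 0⟩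
  have hδ1 : ∀ k, ε * c ≤ cylDeltaM m n k₀ (φ k) := by
    intro k
    refine le_ciInf fun q => ?_
    exact h1_lower m n hm hn k₀ hk₀ hnorm (u k) ψ (hu k) (huc k) hψ hψc c hc hc1 hc2 ε hε q.1
      q.2.1.1 q.2.1.2 q.2.2
  have hδ2 : ∀ k, cylDeltaM m n k₀ (φ k) ≤ cylH1Norm m n (φ k) := by
    intro k
    have := ciInf_le (f := fun q : ℂ × {t : ℝ // 0 < t} × EuclideanSpace ℝ (Fin n) =>
      cylH1Norm m n (fun w => φ k w - q.1 • cylBubble m n k₀ q.2.1.1 q.2.2 w))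
      ⟨0, by rintro _ ⟨q, rfl⟩; exact Real.sqrt_nonneg _⟩ (0, ⟨1, one_pos⟩, 0)
    refine this.trans (le_of_eq ?_)
    congr 1
    funext w
    simp
  have hε' : 0 < ε * c := by positivity
  -- lower bound for the L^p norm
  have hLk : ∀ k, (∫ z, |u k z| ^ p ∂(cylMeasure m n)) ^ (1 / p) ≤ cylLpNorm m n p (φ k) := by
    intro k
    have := cyl_lf m n hm
    unfold cylLpNorm
    refine Real.rpow_le_rpow (integral_nonneg fun z => by positivity) ?_ (by positivity)
    refine integral_mono_of_nonneg (Filter.Eventually.of_forall fun z => by positivity) ?_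
      (Filter.Eventually.of_forall fun z => ?_)
    · apply Continuous.integrable_of_hasCompactSupport
      · exact (hφs k).continuous.norm.rpow_const (fun _ => Or.inr hp.le)
      · exact (hφc k).comp_left (g := fun x : ℂ => ‖x‖ ^ p) (by simp [Real.zero_rpow hp.ne'])
    · refine Real.rpow_le_rpow (abs_nonneg _) ?_ hp.le
      have := Complex.abs_re_le_norm (φ k z)
      simpa [φ] using this
  have hCev : ∀ η > 0, ∀ᶠ k in Filter.atTop, C ^ 2 - η < cylLpNorm m n p (φ k) ^ 2 := by
    intro η hη
    by_cases hint : Integrable (fun z => ‖cylBubble m n k₀ 1 0 z‖ ^ p) (cylMeasure m n)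
    · have h1 := ((hLp p hp hint).rpow_const (p := 1 / p) (Or.inr (by positivity))).pow 2
      filter_upwards [h1.eventually (lt_mem_nhds (sub_lt_self _ hη))] with k hk
      refine lt_of_lt_of_le hk ?_
      have := hLk k
      gcongr
    · have hC0 : C = 0 := by
        rw [hC]; unfold cylLpNorm
        rw [integral_undef hint, Real.zero_rpow (by positivity)]
      refine Filter.Eventually.of_forall fun k => ?_
      rw [hC0]
      nlinarith [sq_nonneg (cylLpNorm m n p (φ k))]
  set D := α * (ε * c) ^ β' / 2 - C ^ 2 * s * ε ^ 2 with hD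
  have hD0 : 0 < D := by rw [hD]; linarith
  have hlim2 : ∀ᶠ k in Filter.atTop, C ^ 2 * h k < C ^ 2 + D / 2 := by
    have h1 := hlim.const_mul (C ^ 2)
    rw [mul_one] at h1
    exact h1.eventually (gt_mem_nhds (by linarith))
  have hlim3 : ∀ᶠ k in Filter.atTop, 1 / 4 < h k := hlim.eventually (lt_mem_nhds (by norm_num))
  obtain ⟨k, hk1, hk2, hk3⟩ := ((hCev (D / 2) (by linarith)).and (hlim2.and hlim3)).exists
  refine ⟨φ k, hφs k, hφc k, hε'.trans_le (hδ1 k), ?_⟩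
  set δ := cylDeltaM m n k₀ (φ k) with hδ
  set N := cylH1Norm m n (φ k) with hNd
  have hδ0 : 0 < δ := hε'.trans_le (hδ1 k)
  have hNpos : 0 < N := hδ0.trans_le (hδ2 k)
  have hNhalf : 1 / 2 ≤ N := by
    have := hN k
    nlinarith [mul_nonneg (sq_nonneg ε) hs0]
  have r1 : (ε * c) ^ β' * (1 / 2) ≤ δ ^ β' * N ^ (2 - β') := by
    have a1 : (ε * c) ^ β' ≤ δ ^ β' := Real.rpow_le_rpow hε'.le (hδ1 k) (by linarith)
    have a2 : (1 / 2 : ℝ) ≤ N ^ (2 - β') := by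
      calc (1 / 2 : ℝ) = (1 / 2 : ℝ) ^ (1 : ℝ) := by simp
        _ ≤ (1 / 2 : ℝ) ^ (2 - β') :=
          Real.rpow_le_rpow_of_exponent_ge (by norm_num) (by norm_num) (by linarith)
        _ ≤ _ := Real.rpow_le_rpow (by norm_num) hNhalf (by linarith)
    exact mul_le_mul a1 a2 (by norm_num) (by positivity)
  have r2 : δ ^ β' * N ^ (2 - β') ≤ δ ^ β * N ^ (2 - β) := by
    have b1 : ∀ b : ℝ, δ ^ b * N ^ (2 - b) = N ^ (2:ℝ) * (δ / N) ^ b := by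
      intro b
      rw [Real.rpow_sub hNpos, Real.div_rpow hδ0.le hNpos.le]
      field_simp
    rw [b1, b1]
    gcongr 1
    exact Real.rpow_le_rpow_of_exponent_ge (by positivity) ((div_le_one hNpos).2 (hδ2 k))
      (le_max_left _ _)
  rw [hN k]
  have r3 : α * ((ε * c) ^ β' * (1 / 2)) ≤ α * (δ ^ β * N ^ (2 - β)) :=
    mul_le_mul_of_nonneg_left (r1.trans r2) hα.le
  rw [mul_assoc]
  rw [hD] at hk1 hk2
  nlinarith
end
end

section
/- Let (X,μ) be a measure space and 2 < p < ∞. Let f : X → ℝ and ψ = ξ + iη : X → ℂ (with ξ, η real-valued) be measurable with ∫|f|^p dμ = ∫|ψ|^p dμ = 1. Then for every ε ∈ [−1,1]: | ‖f + εψ‖_p² − 1 − 2ε ∫ f|f|^{p−2} ξ dμ − ε² Q | ≤ κ_p |ε|^{β_p}, where Q = −(p−2)(∫ f|f|^{p−2} ξ dμ)² + (p−1)∫ |f|^{p−2} ξ² dμ + ∫ |f|^{p−2} η² dμ. -/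
open MeasureTheory

noncomputable section

/-- Exponent `β_p` in the remainder bound of the second-order Taylor expansion. -/
def betaP (p : ℝ) : ℝ := if 4 ≤ p then 3 else 1 + p / 2

/-- Constant `κ_p` in the remainder bound of the second-order Taylor expansion. -/
def kappaP (p : ℝ) : ℝ :=
  if 4 ≤ p then (4 / 3) * (5 * p ^ 2 - 12 * p + 7)
  else (16 * (p - 1) / (p * (p + 2))) * (4 * (p - 2) + (3 * p / (p - 2)) ^ (p / 2 - 1))


theorem nn_of_deriv (h h' : ℝ → ℝ) (hd : ∀ t ∈ Set.Icc (0:ℝ) 1, HasDerivAt h (h' t) t)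
    (h0 : h 0 = 0) (hn : ∀ t ∈ Set.Icc (0:ℝ) 1, 0 ≤ h' t) :
    ∀ t ∈ Set.Icc (0:ℝ) 1, 0 ≤ h t := by
  have hm : MonotoneOn h (Set.Icc (0:ℝ) 1) := by
    apply monotoneOn_of_deriv_nonneg (convex_Icc 0 1)
    · exact fun t ht => (hd t ht).continuousAt.continuousWithinAt
    · intro t ht
      exact (hd t (interior_subset ht)).differentiableAt.differentiableWithinAt
    · intro t ht
      rw [(hd t (interior_subset ht)).deriv]
      exact hn t (interior_subset ht)
  intro t ht
  rw [← h0]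
  exact hm (by simp) ht ht.1

theorem taylor2_le (f f1 f2 : ℝ → ℝ) (M : ℝ)
    (d0 : ∀ t ∈ Set.Icc (0:ℝ) 1, HasDerivAt f (f1 t) t)
    (d1 : ∀ t ∈ Set.Icc (0:ℝ) 1, HasDerivAt f1 (f2 t) t)
    (hM : ∀ t ∈ Set.Icc (0:ℝ) 1, f2 t ≤ M) :
    ∀ t ∈ Set.Icc (0:ℝ) 1, f t - f 0 - f1 0 * t ≤ M / 2 * t ^ 2 := by
  have a1 : ∀ t ∈ Set.Icc (0:ℝ) 1, 0 ≤ M * t - (f1 t - f1 0) := by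
    apply nn_of_deriv _ (fun t => M * 1 - (f2 t))
    · intro t ht
      exact ((hasDerivAt_id t).const_mul M).sub ((d1 t ht).sub_const _)
    · simp
    · intro t ht; linarith [hM t ht]
  have a2 : ∀ t ∈ Set.Icc (0:ℝ) 1, 0 ≤ M / 2 * t ^ 2 - (f t - f 0 - f1 0 * t) := by
    apply nn_of_deriv _ (fun t => M / 2 * (2 * t) - (f1 t - f1 0 * 1))
    · intro t ht
      refine HasDerivAt.congr_deriv (((hasDerivAt_pow 2 t).const_mul (M/2)).fun_sub
        (((d0 t ht).sub_const (f 0)).fun_sub ((hasDerivAt_id' t).const_mul (f1 0)))) ?_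
      simp
    · simp
    · intro t ht; linarith [a1 t ht]
  intro t ht; linarith [a2 t ht]

theorem taylor3_le (f f1 f2 f3 : ℝ → ℝ) (M : ℝ)
    (d0 : ∀ t ∈ Set.Icc (0:ℝ) 1, HasDerivAt f (f1 t) t)
    (d1 : ∀ t ∈ Set.Icc (0:ℝ) 1, HasDerivAt f1 (f2 t) t)
    (d2 : ∀ t ∈ Set.Icc (0:ℝ) 1, HasDerivAt f2 (f3 t) t)
    (hM : ∀ t ∈ Set.Icc (0:ℝ) 1, f3 t ≤ M) :
    f 1 - f 0 - f1 0 - f2 0 / 2 ≤ M / 6 := by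
  have a1 := taylor2_le f1 f2 f3 M d1 d2 hM
  have a2 : ∀ t ∈ Set.Icc (0:ℝ) 1,
      0 ≤ M / 6 * t ^ 3 - (f t - f 0 - f1 0 * t - f2 0 / 2 * t ^ 2) := by
    apply nn_of_deriv _ (fun t => M / 6 * (3 * t ^ 2) - (f1 t - f1 0 * 1 - f2 0 / 2 * (2 * t)))
    · intro t ht
      refine HasDerivAt.congr_deriv (((hasDerivAt_pow 3 t).const_mul (M/6)).fun_sub
        ((((d0 t ht).sub_const (f 0)).fun_sub ((hasDerivAt_id' t).const_mul (f1 0))).fun_sub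
          ((hasDerivAt_pow 2 t).const_mul (f2 0 / 2)))) ?_
      simp
    · simp
    · intro t ht; linarith [a1 t ht]
  have := a2 1 (by simp)
  norm_num at this
  linarith

theorem taylor3_abs (f f1 f2 f3 : ℝ → ℝ) (M : ℝ)
    (d0 : ∀ t ∈ Set.Icc (0:ℝ) 1, HasDerivAt f (f1 t) t)
    (d1 : ∀ t ∈ Set.Icc (0:ℝ) 1, HasDerivAt f1 (f2 t) t)
    (d2 : ∀ t ∈ Set.Icc (0:ℝ) 1, HasDerivAt f2 (f3 t) t)
    (hM : ∀ t ∈ Set.Icc (0:ℝ) 1, |f3 t| ≤ M) :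
    |f 1 - f 0 - f1 0 - f2 0 / 2| ≤ M / 6 := by
  rw [abs_le]
  constructor
  · have := taylor3_le (fun t => -f t) (fun t => -f1 t) (fun t => -f2 t) (fun t => -f3 t) M
      (fun t ht => (d0 t ht).fun_neg) (fun t ht => (d1 t ht).fun_neg) (fun t ht => (d2 t ht).fun_neg)
      (fun t ht => by linarith [(abs_le.mp (hM t ht)).1])
    linarith
  · exact taylor3_le f f1 f2 f3 M d0 d1 d2 (fun t ht => (abs_le.mp (hM t ht)).2)

section quad
variable (p α b c : ℝ)

theorem dq (q t : ℝ) (hs : 0 < α + 2 * b * t + c * t ^ 2) :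
    HasDerivAt (fun t => (α + 2 * b * t + c * t ^ 2) ^ q)
      (2 * q * (b + c * t) * (α + 2 * b * t + c * t ^ 2) ^ (q - 1)) t := by
  have h1 : HasDerivAt (fun t : ℝ => α + 2 * b * t + c * t ^ 2) (2 * (b + c * t)) t := by
    refine HasDerivAt.congr_deriv ((((hasDerivAt_id' t).const_mul (2 * b)).const_add α).fun_add
      ((hasDerivAt_pow 2 t).const_mul c)) ?_
    simp; ring
  refine HasDerivAt.congr_deriv (h1.rpow_const (p := q) (Or.inl hs.ne')) ?_
  ring

theorem dβ (t : ℝ) : HasDerivAt (fun t => b + c * t) c t := by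
  simpa using ((hasDerivAt_id t).const_mul c).const_add b

theorem d0q (t : ℝ) (hs : 0 < α + 2 * b * t + c * t ^ 2) :
    HasDerivAt (fun t => (α + 2 * b * t + c * t ^ 2) ^ (p/2))
      (p * (b + c * t) * (α + 2 * b * t + c * t ^ 2) ^ (p/2 - 1)) t := by
  refine HasDerivAt.congr_deriv (dq α b c (p/2) t hs) ?_
  ring

theorem d1q (t : ℝ) (hs : 0 < α + 2 * b * t + c * t ^ 2) :
    HasDerivAt (fun t => p * (b + c * t) * (α + 2 * b * t + c * t ^ 2) ^ (p/2 - 1))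
      (p * c * (α + 2 * b * t + c * t ^ 2) ^ (p/2 - 1)
        + p * (p - 2) * (b + c * t) ^ 2 * (α + 2 * b * t + c * t ^ 2) ^ (p/2 - 2)) t := by
  refine HasDerivAt.congr_deriv (((dβ b c t).const_mul p).fun_mul (dq α b c (p/2 - 1) t hs)) ?_
  rw [show p / 2 - 1 - 1 = p / 2 - 2 by ring]
  ring

theorem d2q (t : ℝ) (hs : 0 < α + 2 * b * t + c * t ^ 2) :
    HasDerivAt (fun t => p * c * (α + 2 * b * t + c * t ^ 2) ^ (p/2 - 1)
        + p * (p - 2) * (b + c * t) ^ 2 * (α + 2 * b * t + c * t ^ 2) ^ (p/2 - 2))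
      (p * (p - 2) * (3 * c * (b + c * t) * (α + 2 * b * t + c * t ^ 2) ^ (p/2 - 2)
        + (p - 4) * (b + c * t) ^ 3 * (α + 2 * b * t + c * t ^ 2) ^ (p/2 - 3))) t := by
  refine HasDerivAt.congr_deriv (((dq α b c (p/2 - 1) t hs).const_mul (p * c)).fun_add
    ((((dβ b c t).fun_pow 2).const_mul (p * (p-2))).fun_mul (dq α b c (p/2 - 2) t hs))) ?_
  rw [show p / 2 - 1 - 1 = p / 2 - 2 by ring, show p / 2 - 2 - 1 = p / 2 - 3 by ring]
  push_cast
  ring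

end quad

theorem cubicY (p k Y : ℝ) (hp : 2 ≤ p) (hk : 2 ≤ k) (hkp : p - 1 ≤ k) (h0 : 0 ≤ Y) (h1 : Y ≤ 1) :
    |3 * Y + (p - 4) * Y ^ 3| ≤ k := by
  have e3 : 0 ≤ Y ^ 3 := by positivity
  have e4 : Y ^ 3 ≤ Y := by nlinarith [mul_nonneg h0 h0]
  rw [abs_le]
  constructor
  · nlinarith
  · have h2 : (p - 4) * Y ^ 3 ≤ (k - 3) * Y ^ 3 := by
      apply mul_le_mul_of_nonneg_right _ e3; linarith
    have h3 : 0 ≤ (k - 2) * (1 - Y ^ 3) := mul_nonneg (by linarith) (by linarith)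
    have h4 : 0 ≤ (1 - Y) * (2 - Y - Y ^ 2) := mul_nonneg (by linarith) (by nlinarith)
    nlinarith

/-- third derivative bound -/
theorem d3_bound (p k s β c : ℝ) (hp : 2 ≤ p) (hk : 2 ≤ k) (hkp : p - 1 ≤ k) (hs : 0 < s)
    (hc : 0 ≤ c) (hβ : β ^ 2 ≤ c * s) :
    |3 * c * β * s ^ (p/2 - 2) + (p - 4) * β ^ 3 * s ^ (p/2 - 3)|
      ≤ k * c ^ ((3:ℝ)/2) * s ^ ((p - 3)/2) := by
  rcases hc.eq_or_lt with rfl | hc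
  · have : β = 0 := by nlinarith [sq_nonneg β]
    subst this
    simp [Real.zero_rpow (show ((3:ℝ)/2) ≠ 0 by norm_num)]
  set r := Real.sqrt c with hr
  set σ := Real.sqrt s with hσ
  have hr0 : 0 < r := Real.sqrt_pos.mpr hc
  have hσ0 : 0 < σ := Real.sqrt_pos.mpr hs
  have hrc : r ^ 2 = c := Real.sq_sqrt hc.le
  have hσs : σ ^ 2 = s := Real.sq_sqrt hs.le
  have e1 : c ^ ((3:ℝ)/2) = r ^ 3 := by
    rw [← hrc, ← Real.rpow_natCast r 2, ← Real.rpow_mul hr0.le, ← Real.rpow_natCast r 3]; norm_num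
  have e2 : ∀ q : ℝ, s ^ q = σ ^ (2 * q) := by
    intro q
    rw [← hσs, ← Real.rpow_natCast σ 2, ← Real.rpow_mul hσ0.le]; norm_num
  have f1 : s ^ (p/2 - 2) = σ ^ (p - 3) / σ := by
    rw [e2, ← Real.rpow_sub_one hσ0.ne']; congr 1; ring
  have f2 : s ^ (p/2 - 3) = σ ^ (p - 3) / σ ^ 3 := by
    rw [e2, ← Real.rpow_natCast σ 3, ← Real.rpow_sub hσ0]; congr 1; push_cast; ring
  have f3 : s ^ ((p - 3)/2) = σ ^ (p - 3) := by
    rw [e2]; congr 1; ring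
  set Y := |β| / (r * σ) with hY
  have hY0 : 0 ≤ Y := by positivity
  have hβ' : |β| ≤ r * σ := by
    apply abs_le_of_sq_le_sq _ (by positivity : (0:ℝ) ≤ r * σ)
    rw [mul_pow, hrc, hσs]; exact hβ
  have hY1 : Y ≤ 1 := by rw [hY, div_le_one (by positivity)]; exact hβ'
  have hb : |β| = Y * (r * σ) := by rw [hY]; field_simp
  have key := cubicY p k Y hp hk hkp hY0 hY1
  have hP : 0 < σ ^ (p - 3) := Real.rpow_pos_of_pos hσ0 _
  rw [f1, f2, f3, e1, ← hrc]
  have : |3 * r ^ 2 * β * (σ ^ (p - 3) / σ) + (p - 4) * β ^ 3 * (σ ^ (p - 3) / σ ^ 3)|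
     = |3 * Y + (p - 4) * Y ^ 3| * (r ^ 3 * σ ^ (p - 3)) := by
    rw [← abs_of_pos (show 0 < r ^ 3 * σ ^ (p - 3) by positivity), ← abs_mul]
    rcases abs_cases β with ⟨h, _⟩ | ⟨h, _⟩
    · rw [h] at hb
      rw [hb]; congr 1; field_simp
    · have hb' : β = - (Y * (r * σ)) := by linarith
      rw [hb', ← abs_neg]; congr 1; field_simp; ring
  rw [this]
  calc _ ≤ k * (r ^ 3 * σ ^ (p - 3)) := by gcongr
    _ = _ := by ring

theorem TL3 (p k α b c M : ℝ) (hp : 2 < p) (hk : 2 ≤ k) (hkp : p - 1 ≤ k) (hc : 0 ≤ c)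
    (hb : b ^ 2 ≤ α * c) (hs : ∀ t ∈ Set.Icc (0:ℝ) 1, 0 < α + 2 * b * t + c * t ^ 2)
    (hM : ∀ t ∈ Set.Icc (0:ℝ) 1, (α + 2 * b * t + c * t ^ 2) ^ ((p-3)/2) ≤ M) :
    |(α + 2 * b + c) ^ (p/2) - α ^ (p/2) - p * b * α ^ (p/2 - 1)
      - (p * c * α ^ (p/2 - 1) + p * (p - 2) * b ^ 2 * α ^ (p/2 - 2)) / 2|
      ≤ (p * (p - 2) * (k * c ^ ((3:ℝ)/2) * M)) / 6 := by
  have := taylor3_abs _ _ _ _ (p * (p - 2) * (k * c ^ ((3:ℝ)/2) * M))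
    (fun t ht => d0q p α b c t (hs t ht)) (fun t ht => d1q p α b c t (hs t ht))
    (fun t ht => d2q p α b c t (hs t ht)) (by
      intro t ht
      rw [abs_mul, abs_of_nonneg (show 0 ≤ p * (p - 2) by nlinarith)]
      have h1 := d3_bound p k _ (b + c * t) c hp.le hk hkp (hs t ht) hc (by nlinarith)
      have h2 := hM t ht
      have h3 : 0 ≤ c ^ ((3:ℝ)/2) := Real.rpow_nonneg hc _
      have h4 : 0 ≤ p * (p - 2) := by nlinarith
      refine mul_le_mul_of_nonneg_left (h1.trans ?_) h4
      gcongr)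
  simpa using this

theorem TL2 (p α b c : ℝ) (hp : 2 < p) (hα : 0 ≤ α) (hc : 0 ≤ c)
    (hb : b ^ 2 ≤ α * c) (hs : ∀ t ∈ Set.Icc (0:ℝ) 1, 0 < α + 2 * b * t + c * t ^ 2) :
    (α + 2 * b + c) ^ (p/2) - α ^ (p/2) - p * b * α ^ (p/2 - 1)
      ≤ p * (p - 1) / 2 * c * (√α + √c) ^ (p - 2) := by
  have := taylor2_le _ _ _ (p * (p - 1) * (c * (√α + √c) ^ (p - 2)))
    (fun t ht => d0q p α b c t (hs t ht)) (fun t ht => d1q p α b c t (hs t ht)) (by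
      intro t ht
      have hst := hs t ht
      set s := α + 2 * b * t + c * t ^ 2 with hsdef
      have h1 : (b + c * t) ^ 2 ≤ c * s := by rw [hsdef]; nlinarith
      have h2 : s ^ (p/2 - 1) = s ^ (p/2 - 2) * s := by
        rw [← Real.rpow_add_one hst.ne']; congr 1; ring
      have h3 : s ≤ (√α + √c) ^ 2 := by
        have e1 := Real.sq_sqrt hα
        have e2 := Real.sq_sqrt hc
        have e3 : |b| ≤ √α * √c := by
          rw [← Real.sqrt_mul hα]; exact Real.abs_le_sqrt hb
        have e4 : b * t ≤ |b| := by
          calc b * t ≤ |b| * t := by gcongr; exacts [ht.1, le_abs_self b]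
            _ ≤ |b| * 1 := by gcongr; exact ht.2
            _ = _ := by ring
        have e5 : c * t ^ 2 ≤ c := by
          have : t ^ 2 ≤ 1 := pow_le_one₀ ht.1 ht.2
          nlinarith
        rw [hsdef]; nlinarith
      have h4 : s ^ (p/2 - 1) ≤ (√α + √c) ^ (p - 2) := by
        calc s ^ (p/2 - 1) ≤ ((√α + √c) ^ 2) ^ (p/2 - 1) :=
              Real.rpow_le_rpow hst.le h3 (by linarith)
          _ = _ := by
            rw [← Real.rpow_natCast _ 2, ← Real.rpow_mul (by positivity)]; congr 1; push_cast; ring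
      have h5 : 0 ≤ s ^ (p/2 - 2) := Real.rpow_nonneg hst.le _
      have h6 : p * (p - 2) * (b + c * t) ^ 2 * s ^ (p/2 - 2) ≤ p * (p - 2) * (c * s) * s ^ (p/2 - 2) := by
        apply mul_le_mul_of_nonneg_right _ h5
        apply mul_le_mul_of_nonneg_left h1; nlinarith
      have h7 : p * (p - 2) * (c * s) * s ^ (p/2 - 2) = p * (p - 2) * c * s ^ (p/2 - 1) := by
        rw [h2]; ring
      have h8 : p * (p - 1) * c * s ^ (p/2 - 1) ≤ p * (p - 1) * c * (√α + √c) ^ (p - 2) := by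
        apply mul_le_mul_of_nonneg_left h4
        apply mul_nonneg _ hc; nlinarith
      nlinarith) 1 (by simp)
  simp only [mul_one, one_pow, mul_zero, add_zero, ne_eq, OfNat.ofNat_ne_zero, not_false_eq_true, zero_pow] at this
  linarith


theorem sq_rpow_half (u q : ℝ) : (u ^ 2) ^ q = |u| ^ (2 * q) := by
  rw [← sq_abs, ← Real.rpow_natCast _ 2, ← Real.rpow_mul (abs_nonneg u)]; norm_num

theorem P2 (p a x y : ℝ) (hp : 2 < p) :
    ((a + x) ^ 2 + y ^ 2) ^ (p/2) - |a| ^ p - p * (a * |a| ^ (p - 2) * x)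
      ≤ p * (p - 1) / 2 * (x ^ 2 + y ^ 2) * (|a| + √(x ^ 2 + y ^ 2)) ^ (p - 2) := by
  have key : ∀ δ ∈ Set.Ioi (0:ℝ), ((a ^ 2 + δ) + 2 * (a * x) + (x ^ 2 + y ^ 2)) ^ (p/2)
      - (a ^ 2 + δ) ^ (p/2) - p * (a * x) * (a ^ 2 + δ) ^ (p/2 - 1)
      ≤ p * (p - 1) / 2 * (x ^ 2 + y ^ 2) * (√(a ^ 2 + δ) + √(x ^ 2 + y ^ 2)) ^ (p - 2) := by
    intro δ hδ
    have hδ' : (0:ℝ) < δ := hδ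
    apply TL2 p _ _ _ hp (by positivity) (by positivity)
    · nlinarith [mul_nonneg hδ'.le (sq_nonneg x), mul_nonneg hδ'.le (sq_nonneg y), sq_nonneg (a * y)]
    · intro t _
      nlinarith [sq_nonneg (a + t * x), sq_nonneg (t * y)]
  have c1 : Continuous fun δ : ℝ => ((a ^ 2 + δ) + 2 * (a * x) + (x ^ 2 + y ^ 2)) ^ (p/2)
      - (a ^ 2 + δ) ^ (p/2) - p * (a * x) * (a ^ 2 + δ) ^ (p/2 - 1) := by
    refine Continuous.sub (Continuous.sub ?_ ?_) (Continuous.mul continuous_const ?_)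
    · exact Continuous.rpow_const (by fun_prop) (fun _ => Or.inr (by linarith))
    · exact Continuous.rpow_const (by fun_prop) (fun _ => Or.inr (by linarith))
    · exact Continuous.rpow_const (by fun_prop) (fun _ => Or.inr (by linarith))
  have c2 : Continuous fun δ : ℝ =>
      p * (p - 1) / 2 * (x ^ 2 + y ^ 2) * (√(a ^ 2 + δ) + √(x ^ 2 + y ^ 2)) ^ (p - 2) := by
    refine Continuous.mul continuous_const ?_
    exact Continuous.rpow_const (by fun_prop) (fun _ => Or.inr (by linarith))
  have lim := le_of_tendsto_of_tendsto (c1.continuousWithinAt (s := Set.Ioi 0) (x := 0))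
    (c2.continuousWithinAt (s := Set.Ioi 0) (x := 0)) (eventually_nhdsWithin_of_forall key)
  simp only [add_zero] at lim
  rw [Real.sqrt_sq_eq_abs, sq_rpow_half a, sq_rpow_half a] at lim
  rw [show 2 * (p / 2) = p by ring, show 2 * (p / 2 - 1) = p - 2 by ring] at lim
  rw [show (a + x) ^ 2 + y ^ 2 = a ^ 2 + 2 * (a * x) + (x ^ 2 + y ^ 2) by ring]
  linarith

theorem young (p k h v : ℝ) (hp : 0 < p) (hk : 0 ≤ k) (hkp : k ≤ p) (hh : 0 ≤ h) (hv : 0 ≤ v) :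
    v ^ k * h ^ (p - k) ≤ (p - k) / p * h ^ p + k / p * v ^ p := by
  have := Real.geom_mean_le_arith_mean2_weighted (w₁ := (p - k)/p) (w₂ := k/p) (p₁ := h ^ p)
    (p₂ := v ^ p) (div_nonneg (by linarith) hp.le) (div_nonneg hk hp.le)
    (by positivity) (by positivity) (by field_simp; ring)
  rw [← Real.rpow_mul hh, ← Real.rpow_mul hv, mul_div_cancel₀ _ hp.ne', mul_div_cancel₀ _ hp.ne'] at this
  linarith

/-- lower bound -/
theorem P1 (p l a x y : ℝ) (hp : 2 < p) (hl : 0 ≤ l) :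
    p * l ^ (p - 1) * (|a| ^ p + a * |a| ^ (p - 2) * x) ≤
      ((a + x) ^ 2 + y ^ 2) ^ (p/2) + (p - 1) * l ^ p * |a| ^ p := by
  set g := √((a + x) ^ 2 + y ^ 2) with hg
  have hg0 : 0 ≤ g := Real.sqrt_nonneg _
  have e1 : ((a + x) ^ 2 + y ^ 2) ^ (p/2) = g ^ p := by
    rw [hg, Real.sqrt_eq_rpow, ← Real.rpow_mul (by positivity)]; congr 1; ring
  rw [e1]
  have Y := young p 1 (l * |a|) g (by linarith) (by norm_num) (by linarith) (by positivity) hg0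
  rw [Real.mul_rpow hl (abs_nonneg a), Real.mul_rpow hl (abs_nonneg a), Real.rpow_one] at Y
  have e2 : |a| ^ p + a * |a| ^ (p - 2) * x = |a| ^ (p - 2) * (a * (a + x)) := by
    rcases eq_or_ne a 0 with rfl | ha
    · simp [Real.zero_rpow (show p ≠ 0 by linarith)]
    · have : |a| ^ p = |a| ^ (p - 2) * a ^ 2 := by
        rw [← sq_abs a, ← Real.rpow_natCast _ 2, ← Real.rpow_add (abs_pos.mpr ha)]; congr 1; push_cast; ring
      rw [this]; ring
  have e3 : |a| ^ (p - 1) = |a| ^ (p - 2) * |a| := by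
    rcases eq_or_ne a 0 with rfl | ha
    · simp [Real.zero_rpow (show p - 1 ≠ 0 by linarith)]
    · rw [← Real.rpow_add_one (abs_pos.mpr ha).ne']; congr 1; ring
  have e4 : a * (a + x) ≤ |a| * g := by
    calc a * (a + x) ≤ |a * (a + x)| := le_abs_self _
      _ = |a| * |a + x| := abs_mul _ _
      _ ≤ |a| * g := by
        gcongr
        rw [hg]; apply Real.abs_le_sqrt; nlinarith [sq_nonneg y]
  rw [e2]
  have h0 : 0 ≤ |a| ^ (p - 2) := by positivity
  have h1 : 0 ≤ l ^ (p - 1) := by positivity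
  calc p * l ^ (p - 1) * (|a| ^ (p - 2) * (a * (a + x)))
      ≤ p * l ^ (p - 1) * (|a| ^ (p - 2) * (|a| * g)) := by gcongr
    _ = p * (g * (l ^ (p - 1) * |a| ^ (p - 1))) := by rw [e3]; ring
    _ ≤ p * ((p - 1) / p * (l ^ p * |a| ^ p) + 1 / p * g ^ p) := by gcongr
    _ = _ := by field_simp; ring

theorem quad_le (p a x y : ℝ) (hp : 2 < p) :
    p / 2 * ((p - 1) * (|a| ^ (p - 2) * x ^ 2) + |a| ^ (p - 2) * y ^ 2)
     ≤ p * (p - 1) / 2 * (x ^ 2 + y ^ 2) * (|a| + √(x ^ 2 + y ^ 2)) ^ (p - 2) := by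
  have h0 : 0 ≤ |a| ^ (p - 2) := by positivity
  have h1 : |a| ^ (p - 2) ≤ (|a| + √(x ^ 2 + y ^ 2)) ^ (p - 2) := by
    apply Real.rpow_le_rpow (abs_nonneg a) _ (by linarith)
    linarith [Real.sqrt_nonneg (x ^ 2 + y ^ 2)]
  calc _ ≤ p / 2 * ((p - 1) * (|a| ^ (p - 2) * x ^ 2) + (p - 1) * (|a| ^ (p - 2) * y ^ 2)) := by
        have := mul_nonneg h0 (sq_nonneg y)
        have : |a| ^ (p - 2) * y ^ 2 ≤ (p - 1) * (|a| ^ (p - 2) * y ^ 2) := by nlinarith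
        gcongr
    _ = p * (p - 1) / 2 * (x ^ 2 + y ^ 2) * |a| ^ (p - 2) := by ring
    _ ≤ _ := by
        apply mul_le_mul_of_nonneg_left h1
        have : 0 < p * (p - 1) := by nlinarith
        positivity

theorem Tcrude (p a x y : ℝ) (hp : 2 < p) :
    |((a + x) ^ 2 + y ^ 2) ^ (p/2) - |a| ^ p - p * (a * |a| ^ (p - 2) * x)
      - p / 2 * ((p - 1) * (|a| ^ (p - 2) * x ^ 2) + |a| ^ (p - 2) * y ^ 2)|
      ≤ p * (p - 1) / 2 * (x ^ 2 + y ^ 2) * (|a| + √(x ^ 2 + y ^ 2)) ^ (p - 2) := by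
  have h1 := P1 p 1 a x y hp (by norm_num)
  simp only [Real.one_rpow, mul_one] at h1
  have h2 := P2 p a x y hp
  have h3 := quad_le p a x y hp
  have h4 : 0 ≤ p / 2 * ((p - 1) * (|a| ^ (p - 2) * x ^ 2) + |a| ^ (p - 2) * y ^ 2) := by
    have : 0 < p - 1 := by linarith
    positivity
  rw [abs_le]; constructor <;> linarith

theorem sbounds (a x y : ℝ) (t : ℝ) (ht : t ∈ Set.Icc (0:ℝ) 1) :
    (|a| - t * √(x ^ 2 + y ^ 2)) ^ 2 ≤ a ^ 2 + 2 * (a * x) * t + (x ^ 2 + y ^ 2) * t ^ 2 ∧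
    a ^ 2 + 2 * (a * x) * t + (x ^ 2 + y ^ 2) * t ^ 2 ≤ (|a| + √(x ^ 2 + y ^ 2)) ^ 2 := by
  set r := √(x ^ 2 + y ^ 2) with hr
  have hr0 : 0 ≤ r := Real.sqrt_nonneg _
  have hr2 : r ^ 2 = x ^ 2 + y ^ 2 := Real.sq_sqrt (by positivity)
  have hx : |x| ≤ r := Real.abs_le_sqrt (by nlinarith [sq_nonneg y])
  have hax : |a * x| ≤ |a| * r := by rw [abs_mul]; gcongr
  obtain ⟨h1, h2⟩ := abs_le.mp hax
  have h0 : 0 ≤ |a| * r := by positivity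
  rw [← hr2, ← sq_abs a]
  have t1 : t ^ 2 ≤ 1 := pow_le_one₀ ht.1 ht.2
  constructor
  · nlinarith [ht.1]
  · have : a * x * t ≤ |a| * r := by nlinarith [ht.1, ht.2]
    nlinarith [sq_nonneg r]

/-- small-perturbation third-order bound -/
theorem Tfine (p k a x y M : ℝ) (hp : 2 < p) (hk : 2 ≤ k) (hkp : p - 1 ≤ k)
    (h : √(x ^ 2 + y ^ 2) < |a|)
    (hM : ∀ s, (|a| - √(x ^ 2 + y ^ 2)) ≤ s → s ≤ |a| + √(x ^ 2 + y ^ 2) → s ^ (p - 3) ≤ M) :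
    |((a + x) ^ 2 + y ^ 2) ^ (p/2) - |a| ^ p - p * (a * |a| ^ (p - 2) * x)
      - p / 2 * ((p - 1) * (|a| ^ (p - 2) * x ^ 2) + |a| ^ (p - 2) * y ^ 2)|
      ≤ p * (p - 2) * k / 6 * √(x ^ 2 + y ^ 2) ^ (3:ℝ) * M := by
  set r := √(x ^ 2 + y ^ 2) with hr
  have hr0 : 0 ≤ r := Real.sqrt_nonneg _
  have hr2 : r ^ 2 = x ^ 2 + y ^ 2 := Real.sq_sqrt (by positivity)
  have ha : 0 < |a| := by linarith
  have hb : ∀ t ∈ Set.Icc (0:ℝ) 1, (|a| - r) ^ 2 ≤ a ^ 2 + 2 * (a * x) * t + (x ^ 2 + y ^ 2) * t ^ 2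
      ∧ a ^ 2 + 2 * (a * x) * t + (x ^ 2 + y ^ 2) * t ^ 2 ≤ (|a| + r) ^ 2 := by
    intro t ht
    obtain ⟨h1, h2⟩ := sbounds a x y t ht
    refine ⟨le_trans ?_ h1, h2⟩
    have : t * r ≤ r := by nlinarith [ht.2]
    apply pow_le_pow_left₀ <;> linarith
  have main := TL3 p k (a ^ 2) (a * x) (x ^ 2 + y ^ 2) M hp hk hkp (by positivity)
    (by nlinarith [sq_nonneg (a * y)])
    (fun t ht => lt_of_lt_of_le (pow_pos (by linarith) 2) (hb t ht).1)
    (by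
      intro t ht
      obtain ⟨h1, h2⟩ := hb t ht
      set s := a ^ 2 + 2 * (a * x) * t + (x ^ 2 + y ^ 2) * t ^ 2
      have hs0 : 0 ≤ s := le_trans (sq_nonneg _) h1
      have : s ^ ((p - 3)/2) = (√s) ^ (p - 3) := by
        rw [Real.sqrt_eq_rpow, ← Real.rpow_mul hs0]; congr 1; ring
      rw [this]
      apply hM
      · exact Real.le_sqrt_of_sq_le h1
      · exact Real.sqrt_le_iff.mpr ⟨by linarith, h2⟩)
  have e1 : (x ^ 2 + y ^ 2) ^ ((3:ℝ)/2) = r ^ (3:ℝ) := by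
    rw [← hr2, sq_rpow_half, abs_of_nonneg hr0]; norm_num
  have e2 : |a| ^ (2 * (p/2 - 2)) * a ^ 2 = |a| ^ (p - 2) := by
    rw [← sq_abs a, ← Real.rpow_natCast _ 2, ← Real.rpow_add ha]; congr 1; push_cast; ring
  rw [e1, sq_rpow_half a, sq_rpow_half a, sq_rpow_half a] at main
  rw [show 2 * (p / 2) = p by ring, show 2 * (p / 2 - 1) = p - 2 by ring] at main
  convert main using 1
  · congr 1
    rw [show (a + x) ^ 2 + y ^ 2 = a ^ 2 + 2 * (a * x) + (x ^ 2 + y ^ 2) by ring]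
    rw [← e2]
    have : p * (p - 2) * (a * x) ^ 2 * |a| ^ (2 * (p/2 - 2)) =
       p * (p - 2) * x ^ 2 * (|a| ^ (2 * (p/2 - 2)) * a ^ 2) := by ring
    rw [this]; ring
  · ring

theorem P3a (p K a x y : ℝ) (hp : 3 ≤ p) (hK : 2 ≤ K) (hK' : (p - 2) / 3 ≤ K) :
    |((a + x) ^ 2 + y ^ 2) ^ (p/2) - |a| ^ p - p * (a * |a| ^ (p - 2) * x)
      - p / 2 * ((p - 1) * (|a| ^ (p - 2) * x ^ 2) + |a| ^ (p - 2) * y ^ 2)|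
      ≤ p * (p - 1) / 2 * K * (√(x ^ 2 + y ^ 2) ^ (3:ℝ) * (|a| + √(x ^ 2 + y ^ 2)) ^ (p - 3)) := by
  have hr0 : 0 ≤ √(x ^ 2 + y ^ 2) := Real.sqrt_nonneg _
  have hr2 : √(x ^ 2 + y ^ 2) ^ 2 = x ^ 2 + y ^ 2 := Real.sq_sqrt (by positivity)
  have hpp : 0 < p * (p - 1) := by nlinarith
  rcases lt_or_ge (√(x ^ 2 + y ^ 2)) |a| with h | h
  · refine (Tfine p (p - 1) a x y ((|a| + √(x ^ 2 + y ^ 2)) ^ (p - 3)) (by linarith) (by linarith)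
      le_rfl h ?_).trans ?_
    · intro s h1 h2
      exact Real.rpow_le_rpow (by linarith) h2 (by linarith)
    · rw [mul_assoc]
      apply mul_le_mul_of_nonneg_right _ (by positivity)
      nlinarith
  · refine (Tcrude p a x y (by linarith)).trans ?_
    set r := √(x ^ 2 + y ^ 2)
    rw [← hr2]
    have ha : 0 ≤ |a| := abs_nonneg a
    have e1 : (|a| + r) ^ (p - 2) ≤ (|a| + r) ^ (p - 3) * (2 * r) := by
      rcases eq_or_lt_of_le (show 0 ≤ |a| + r by linarith) with h0 | h0
      · rw [← h0, Real.zero_rpow (by linarith)]; positivity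
      · rw [show p - 2 = (p - 3) + 1 by ring, Real.rpow_add_one h0.ne']
        gcongr; linarith
    have e2 : r ^ (3:ℝ) = r ^ 2 * r := by
      rw [show (3:ℝ) = ((3:ℕ):ℝ) by norm_num, Real.rpow_natCast]; ring
    have hP : 0 ≤ (|a| + r) ^ (p - 3) := by positivity
    calc p * (p - 1) / 2 * r ^ 2 * (|a| + r) ^ (p - 2)
        ≤ p * (p - 1) / 2 * r ^ 2 * ((|a| + r) ^ (p - 3) * (2 * r)) := by gcongr
      _ = p * (p - 1) / 2 * 2 * (r ^ (3:ℝ) * (|a| + r) ^ (p - 3)) := by rw [e2]; ring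
      _ ≤ _ := by gcongr

theorem P3b (p a x y : ℝ) (hp : 2 < p) (hp3 : p ≤ 3) :
    |((a + x) ^ 2 + y ^ 2) ^ (p/2) - |a| ^ p - p * (a * |a| ^ (p - 2) * x)
      - p / 2 * ((p - 1) * (|a| ^ (p - 2) * x ^ 2) + |a| ^ (p - 2) * y ^ 2)|
      ≤ p * (p - 1) / 2 * 3 ^ (p - 2) * (√(x ^ 2 + y ^ 2) ^ p * (|a| + √(x ^ 2 + y ^ 2)) ^ (p - p)) := by
  have hr0 : 0 ≤ √(x ^ 2 + y ^ 2) := Real.sqrt_nonneg _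
  have hr2 : √(x ^ 2 + y ^ 2) ^ 2 = x ^ 2 + y ^ 2 := Real.sq_sqrt (by positivity)
  have hpp : 0 < p * (p - 1) := by nlinarith
  have h3 : (1:ℝ) ≤ 3 ^ (p - 2) := Real.one_le_rpow (by norm_num) (by linarith)
  rw [sub_self, Real.rpow_zero, mul_one]
  rcases le_or_gt (2 * √(x ^ 2 + y ^ 2)) |a| with h | h
  · rcases hr0.eq_or_lt with h0 | h0
    · have hz : x ^ 2 + y ^ 2 = 0 := by rw [← hr2, ← h0]; norm_num
      have hx : x = 0 := by nlinarith [sq_nonneg x, sq_nonneg y]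
      have hy : y = 0 := by nlinarith [sq_nonneg x, sq_nonneg y]
      subst hx hy
      simp only [add_zero, ne_eq, OfNat.ofNat_ne_zero, not_false_eq_true, zero_pow, mul_zero]
      rw [sq_rpow_half, show 2 * (p / 2) = p by ring]
      simp
      rw [Real.zero_rpow (by linarith)]; simp
    refine (Tfine p 2 a x y (√(x ^ 2 + y ^ 2) ^ (p - 3)) hp le_rfl (by linarith) (by linarith)
       ?_).trans ?_
    · intro s h1 h2
      exact Real.rpow_le_rpow_of_nonpos h0 (by linarith) (by linarith)
    · rw [mul_assoc, ← Real.rpow_add h0, show (3:ℝ) + (p - 3) = p by ring]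
      apply mul_le_mul_of_nonneg_right _ (by positivity)
      nlinarith
  · refine (Tcrude p a x y (by linarith)).trans ?_
    set r := √(x ^ 2 + y ^ 2)
    rw [← hr2]
    have ha : 0 ≤ |a| := abs_nonneg a
    have h0 : 0 < r := by linarith
    have e1 : (|a| + r) ^ (p - 2) ≤ 3 ^ (p - 2) * r ^ (p - 2) := by
      rw [← Real.mul_rpow (by norm_num) h0.le]
      apply Real.rpow_le_rpow <;> linarith
    have e2 : r ^ p = r ^ 2 * r ^ (p - 2) := by
      rw [← Real.rpow_natCast r 2, ← Real.rpow_add h0]; congr 1; push_cast; ring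
    calc p * (p - 1) / 2 * r ^ 2 * (|a| + r) ^ (p - 2)
        ≤ p * (p - 1) / 2 * r ^ 2 * (3 ^ (p - 2) * r ^ (p - 2)) := by gcongr
      _ = _ := by rw [e2]; ring

/-- 1D third order expansion, for the scalar part -/
theorem P3s (p k a e M : ℝ) (hp : 2 < p) (hk : 2 ≤ k) (hkp : p - 1 ≤ k) (he : e < 1) (ha : |a| ≤ e)
    (hM : ∀ s, 1 - e ≤ s → s ≤ 1 + e → s ^ (p - 3) ≤ M) :
    |(1 + a) ^ p - 1 - p * a - p * (p - 1) / 2 * a ^ 2| ≤ p * (p - 2) * k / 6 * e ^ 3 * M := by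
  have h := Tfine p k 1 a 0 M hp hk hkp (by simp [Real.sqrt_sq_eq_abs]; linarith) (by
    intro s h1 h2
    simp [Real.sqrt_sq_eq_abs] at h1 h2
    apply hM <;> linarith)
  have h0 : 0 ≤ 1 + a := by linarith [(abs_le.mp ha).1]
  simp [Real.sqrt_sq_eq_abs] at h
  rw [sq_rpow_half, show 2 * (p / 2) = p by ring, abs_of_nonneg h0] at h
  have hM0 : 0 ≤ M := le_trans (by positivity) (hM 1 (by linarith [abs_nonneg a]) (by linarith [abs_nonneg a]))
  have e3 : |a| ^ (3:ℝ) ≤ e ^ 3 := by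
    rw [show (3:ℝ) = ((3:ℕ):ℝ) by norm_num, Real.rpow_natCast]
    gcongr
  have hpk : 0 ≤ p * (p - 2) * k / 6 := by
    have : 0 < p - 2 := by linarith
    positivity
  have e4 : p * (p - 2) * k / 6 * |a| ^ (3:ℝ) * M ≤ p * (p - 2) * k / 6 * e ^ 3 * M := by gcongr
  refine le_trans (le_of_eq ?_) (h.trans ?_)
  · congr 1; ring
  · first | exact e4 | (refine le_trans (le_of_eq ?_) e4; norm_num)


theorem bern2 (q z : ℝ) (hq : 0 ≤ q) (hq1 : q ≤ 1) (hz : 0 ≤ z) :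
    1 + q * z - q * (1 - q) * z ^ 2 ≤ (1 + z) ^ q := by
  have h1 : (1 + z) ^ (1 - q) ≤ 1 + (1 - q) * z :=
    rpow_one_add_le_one_add_mul_self (by linarith) (by linarith) (by linarith)
  have h2 : (1 + z) ^ q * (1 + z) ^ (1 - q) = 1 + z := by
    rw [← Real.rpow_add (by linarith)]; simp
  have hA : 0 < (1 + z) ^ q := Real.rpow_pos_of_pos (by linarith) _
  have h4 : 0 < 1 + (1 - q) * z := by nlinarith
  have h3 : 1 + z ≤ (1 + z) ^ q * (1 + (1 - q) * z) := by
    calc 1 + z = (1 + z) ^ q * (1 + z) ^ (1 - q) := by rw [h2]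
      _ ≤ _ := by gcongr
  have h5 : (1 + q * z - q * (1 - q) * z ^ 2) * (1 + (1 - q) * z) ≤ 1 + z := by
    have : 0 ≤ q * (1 - q) ^ 2 * z ^ 3 := by positivity
    nlinarith
  exact le_of_mul_le_mul_right (h5.trans h3) h4

theorem R1 (p F a b c e : ℝ) (hp : 2 < p) (he : 0 ≤ e) (he1 : e ≤ 1) (ha : |a| ≤ e)
    (hab : a ^ 2 ≤ b) (hc : 0 ≤ c) (hbc : b + c ≤ e ^ 2) (hF : (1 + a) ^ p ≤ F)
    (hS : F - 1 - p * a ≤ p * (p - 1) / 2 * (e ^ 2 * (1 + e) ^ (p - 2))) :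
    |F ^ (2/p) - 1 - 2 * a - (-(p - 2) * a ^ 2 + (p - 1) * b + c)|
      ≤ (p - 1) * e ^ 2 * (1 + e) ^ (p - 2) := by
  have h0 : 0 ≤ 1 + a := by linarith [(abs_le.mp ha).1]
  have hF0 : 0 ≤ F := le_trans (by positivity) hF
  have hp0 : 0 < p := by linarith
  have l1 : (1 + a) ^ 2 ≤ F ^ (2/p) := by
    have := Real.rpow_le_rpow (by positivity) hF (show 0 ≤ 2/p by positivity)
    rwa [← Real.rpow_mul h0, mul_div_cancel₀ _ hp0.ne', Real.rpow_two] at this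
  have l2 : F ^ (2/p) ≤ 1 + 2/p * (F - 1) := by
    have := rpow_one_add_le_one_add_mul_self (s := F - 1) (p := 2/p) (by linarith) (by positivity)
      (by rw [div_le_one hp0]; exact hp.le)
    simpa using this
  have l3 : 2/p * (F - 1) ≤ 2 * a + (p - 1) * e ^ 2 * (1 + e) ^ (p - 2) := by
    have : 2/p * (F - 1) = 2 * a + 2/p * (F - 1 - p * a) := by field_simp; ring
    rw [this]
    have : 2/p * (F - 1 - p * a) ≤ 2/p * (p * (p - 1) / 2 * (e ^ 2 * (1 + e) ^ (p - 2))) := by gcongr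
    have h2 : 2/p * (p * (p - 1) / 2 * (e ^ 2 * (1 + e) ^ (p - 2))) = (p - 1) * e ^ 2 * (1 + e) ^ (p - 2) := by
      field_simp
    linarith
  have q0 : 0 ≤ -(p - 2) * a ^ 2 + (p - 1) * b + c := by nlinarith [sq_nonneg a]
  have q1 : -(p - 2) * a ^ 2 + (p - 1) * b + c ≤ (p - 1) * e ^ 2 := by nlinarith [sq_nonneg a]
  have u : (1:ℝ) ≤ (1 + e) ^ (p - 2) := Real.one_le_rpow (by linarith) (by linarith)
  have v : (p - 1) * e ^ 2 ≤ (p - 1) * e ^ 2 * (1 + e) ^ (p - 2) :=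
    le_mul_of_one_le_right (mul_nonneg (by linarith) (sq_nonneg e)) u
  rw [abs_le]
  constructor <;> nlinarith [sq_nonneg a]

theorem R1' (p F a b c e : ℝ) (hp : 2 < p) (he : 0 ≤ e) (he1 : e ≤ 1) (ha : |a| ≤ e)
    (hab : a ^ 2 ≤ b) (hc : 0 ≤ c) (hbc : b + c ≤ e ^ 2) (hF : (1 + a) ^ p ≤ F)
    (hF' : F ≤ (1 + e) ^ p) :
    |F ^ (2/p) - 1 - 2 * a - (-(p - 2) * a ^ 2 + (p - 1) * b + c)|
      ≤ max (5 * e) ((p - 1) * e ^ 2) := by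
  have h0 : 0 ≤ 1 + a := by linarith [(abs_le.mp ha).1]
  have hF0 : 0 ≤ F := le_trans (by positivity) hF
  have hp0 : 0 < p := by linarith
  have l1 : (1 + a) ^ 2 ≤ F ^ (2/p) := by
    have := Real.rpow_le_rpow (by positivity) hF (show 0 ≤ 2/p by positivity)
    rwa [← Real.rpow_mul h0, mul_div_cancel₀ _ hp0.ne', Real.rpow_two] at this
  have l2 : F ^ (2/p) ≤ (1 + e) ^ 2 := by
    have := Real.rpow_le_rpow hF0 hF' (show 0 ≤ 2/p by positivity)
    rwa [← Real.rpow_mul (by linarith), mul_div_cancel₀ _ hp0.ne', Real.rpow_two] at this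
  have q0 : 0 ≤ -(p - 2) * a ^ 2 + (p - 1) * b + c := by nlinarith [sq_nonneg a]
  have q1 : -(p - 2) * a ^ 2 + (p - 1) * b + c ≤ (p - 1) * e ^ 2 := by nlinarith [sq_nonneg a]
  have := abs_le.mp ha
  rw [abs_le]
  constructor
  · have := le_max_right (5 * e) ((p - 1) * e ^ 2)
    nlinarith [sq_nonneg a]
  · have := le_max_left (5 * e) ((p - 1) * e ^ 2)
    nlinarith [sq_nonneg a]

theorem Rmain (p F a b c e H k M : ℝ) (hp : 2 < p) (he : 0 ≤ e) (he1 : e < 1) (ha : |a| ≤ e)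
    (hab : a ^ 2 ≤ b) (hc : 0 ≤ c) (hF : (1 + a) ^ p ≤ F)
    (hS : F - 1 - p * a ≤ p * (p - 1) / 2 * (e ^ 2 * (1 + e) ^ (p - 2)))
    (hH : |F - 1 - p * a - p / 2 * ((p - 1) * b + c)| ≤ H)
    (hk : 2 ≤ k) (hkp : p - 1 ≤ k)
    (hM : ∀ s, 1 - e ≤ s → s ≤ 1 + e → s ^ (p - 3) ≤ M) :
    |F ^ (2/p) - 1 - 2 * a - (-(p - 2) * a ^ 2 + (p - 1) * b + c)|
      ≤ 2/p * H + (p - 2) * k / 3 * e ^ 3 * M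
        + ((1 - e) ^ (2 - p) - 1) * ((p - 1) * e ^ 2 * (1 + e) ^ (p - 2))
        + (p - 2)/2 * (1 - e) ^ (2 - 2 * p) * ((p - 1) * e ^ 2 * (1 + e) ^ (p - 2)) ^ 2 := by
  obtain ⟨ha1, ha2⟩ := abs_le.mp ha
  have hp0 : 0 < p := by linarith
  set l := 1 + a with hl
  have hl0 : 0 < l := by linarith
  have hlp : 0 < l ^ p := Real.rpow_pos_of_pos hl0 _
  set G0 := (p - 1) * e ^ 2 * (1 + e) ^ (p - 2) with hG0
  set G := 2/p * (F - l ^ p) with hG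
  set W := (p - 1) * (b - a ^ 2) + c with hW
  have hGn : 0 ≤ G := by
    have : 0 ≤ F - l ^ p := by linarith
    positivity
  have hB : 1 + p * a ≤ l ^ p := one_add_mul_self_le_rpow_one_add (by linarith) (by linarith)
  have hGle : G ≤ G0 := by
    calc G ≤ 2/p * (p * (p - 1) / 2 * (e ^ 2 * (1 + e) ^ (p - 2))) := by
            rw [hG]; gcongr; linarith
      _ = G0 := by rw [hG0]; field_simp
  have hs := P3s p k a e M hp hk hkp he1 ha hM
  have hGW : |G - W| ≤ 2/p * H + (p - 2) * k / 3 * e ^ 3 * M := by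
    have e1 : G - W = 2/p * ((F - 1 - p * a - p / 2 * ((p - 1) * b + c))
        - (l ^ p - 1 - p * a - p * (p - 1) / 2 * a ^ 2)) := by
      rw [hG, hW]; field_simp; ring
    rw [e1, abs_mul, abs_of_pos (show 0 < 2/p by positivity)]
    calc _ ≤ 2/p * (H + p * (p - 2) * k / 6 * e ^ 3 * M) := by
          gcongr
          exact (abs_sub _ _).trans (add_le_add hH hs)
      _ = _ := by field_simp; ring
  set z := (F - l ^ p) / l ^ p with hz
  have hz0 : 0 ≤ z := div_nonneg (by linarith) hlp.le
  have hFz : F ^ (2/p) = l ^ 2 * (1 + z) ^ (2/p) := by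
    have : F = l ^ p * (1 + z) := by rw [hz]; field_simp; ring
    rw [this, Real.mul_rpow hlp.le (by linarith), ← Real.rpow_mul hl0.le, mul_div_cancel₀ _ hp0.ne',
      Real.rpow_two]
  have hq1 : 2/p ≤ 1 := by rw [div_le_one hp0]; exact hp.le
  have hup : (1 + z) ^ (2/p) ≤ 1 + 2/p * z :=
    rpow_one_add_le_one_add_mul_self (by linarith) (by positivity) hq1
  have hlo := bern2 (2/p) z (by positivity) hq1 hz0
  set L := l ^ (2 - p) with hL
  have hL0 : 0 < L := Real.rpow_pos_of_pos hl0 _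
  have hLl : l ^ 2 = L * l ^ p := by
    rw [hL, ← Real.rpow_add hl0, ← Real.rpow_two]; congr 1; ring
  have m1 : l ^ 2 * (2/p * z) = L * G := by
    rw [hLl, hz, hG]; field_simp
  set P := l ^ (2 - 2 * p) with hP
  have hP0 : 0 < P := Real.rpow_pos_of_pos hl0 _
  have hPl : l ^ 2 = P * (l ^ p) ^ 2 := by
    rw [hP, ← Real.rpow_natCast (l ^ p) 2, ← Real.rpow_mul hl0.le, ← Real.rpow_add hl0, ← Real.rpow_two]
    congr 1; push_cast; ring
  have m2 : l ^ 2 * (2/p * (1 - 2/p) * z ^ 2) = (p - 2)/2 * P * G ^ 2 := by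
    rw [hPl, hz, hG]; field_simp
  have hR : F ^ (2/p) - 1 - 2 * a - (-(p - 2) * a ^ 2 + (p - 1) * b + c)
      = l ^ 2 * ((1 + z) ^ (2/p) - 1) - W := by
    rw [hFz, hW, hl]; ring
  have up : l ^ 2 * ((1 + z) ^ (2/p) - 1) ≤ L * G := by
    rw [← m1]; gcongr; linarith
  have lo : L * G - (p - 2)/2 * P * G ^ 2 ≤ l ^ 2 * ((1 + z) ^ (2/p) - 1) := by
    rw [← m1, ← m2, ← mul_sub]
    apply mul_le_mul_of_nonneg_left _ (sq_nonneg l); linarith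
  have hPle : P ≤ (1 - e) ^ (2 - 2 * p) :=
    Real.rpow_le_rpow_of_nonpos (by linarith) (by linarith) (by linarith)
  have hLle : L ≤ (1 - e) ^ (2 - p) :=
    Real.rpow_le_rpow_of_nonpos (by linarith) (by linarith) (by linarith)
  have hLge : (1 + e) ^ (2 - p) ≤ L :=
    Real.rpow_le_rpow_of_nonpos (by linarith) (by linarith) (by linarith)
  have hprod : 1 ≤ (1 + e) ^ (2 - p) * (1 - e) ^ (2 - p) := by
    rw [← Real.mul_rpow (by linarith) (by linarith)]
    exact Real.one_le_rpow_of_pos_of_le_one_of_nonpos (mul_pos (by linarith) (by linarith))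
      (by linarith [sq_nonneg e, show (1 + e) * (1 - e) = 1 - e ^ 2 by ring]) (by linarith)
  set L1 := (1 - e) ^ (2 - p)
  set L2 := (1 + e) ^ (2 - p)
  have hL2 : 0 < L2 := Real.rpow_pos_of_pos (by linarith) _
  have hL10 : 0 < L1 := Real.rpow_pos_of_pos (by linarith) _
  have hsum : 2 ≤ L2 + L1 := by
    clear_value L1 L2
    have : 4 ≤ (L2 + L1) ^ 2 := by linarith [sq_nonneg (L1 - L2), show (L2 + L1) ^ 2 = (L1 - L2) ^ 2 + 4 * (L2 * L1) by ring]
    by_contra hcon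
    push Not at hcon
    have : (L2 + L1) ^ 2 < 2 ^ 2 := pow_lt_pow_left₀ hcon (by linarith) (by norm_num)
    linarith
  have hL1 : 0 ≤ L1 - 1 := by linarith
  have t1 : |(L - 1) * G| ≤ (L1 - 1) * G0 := by
    rw [abs_mul, abs_of_nonneg hGn]
    have : |L - 1| ≤ L1 - 1 := by rw [abs_le]; constructor <;> linarith
    gcongr
  have t2 : (p - 2)/2 * P * G ^ 2 ≤ (p - 2)/2 * (1 - e) ^ (2 - 2 * p) * G0 ^ 2 := by
    have : 0 < p - 2 := by linarith
    gcongr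
  have t3 : 0 ≤ (p - 2)/2 * P * G ^ 2 := by
    have : 0 < p - 2 := by linarith
    positivity
  rw [hR]
  obtain ⟨g1, g2⟩ := abs_le.mp hGW
  obtain ⟨g3, g4⟩ := abs_le.mp t1
  rw [abs_le]
  constructor <;> linarith



theorem epow (p e : ℝ) (hp : 2 < p) (he : 0 ≤ e) : e ^ (1 + p/2) = e ^ 2 * e ^ (p/2 - 1) := by
  rw [← Real.rpow_two, ← Real.rpow_add_of_nonneg he (by norm_num) (by linarith)]; congr 1; ring

set_option maxHeartbeats 1000000 in
theorem caseA (p F a b c e : ℝ) (hp : 2 < p) (hp3 : p ≤ 3) (he : 0 ≤ e) (he1 : e ≤ 1) (ha : |a| ≤ e)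
    (hab : a ^ 2 ≤ b) (hc : 0 ≤ c) (hbc : b + c ≤ e ^ 2) (hF : (1 + a) ^ p ≤ F)
    (hS : F - 1 - p * a ≤ p * (p - 1) / 2 * (e ^ 2 * (1 + e) ^ (p - 2)))
    (hH : |F - 1 - p * a - p / 2 * ((p - 1) * b + c)|
      ≤ p * (p - 1) / 2 * 3 ^ (p - 2) * (e ^ p * (1 + e) ^ (p - p))) :
    |F ^ (2/p) - 1 - 2 * a - (-(p - 2) * a ^ 2 + (p - 1) * b + c)|
      ≤ (16 * (p - 1) / (p * (p + 2))) * (4 * (p - 2) + (3 * p / (p - 2)) ^ (p / 2 - 1))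
        * e ^ (1 + p/2) := by
  have hd : 0 < p - 2 := by linarith
  have hp1 : 0 < p - 1 := by linarith
  set Z := e ^ (p/2 - 1) with hZ
  have hZ0 : 0 ≤ Z := by positivity
  have hZe : e ≤ Z := by
    rcases he.eq_or_lt with h | h
    · linarith
    · calc e = e ^ (1:ℝ) := (Real.rpow_one e).symm
        _ ≤ Z := Real.rpow_le_rpow_of_exponent_ge h he1 (by linarith)
  have h3 : (3:ℝ) ^ (p - 2) ≤ (3 * p / (p - 2)) ^ (p / 2 - 1) := by
    have : (3:ℝ) ^ (p - 2) = (3 ^ 2) ^ (p / 2 - 1) := by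
      rw [sq_rpow_half]; norm_num; ring_nf
    rw [this]
    apply Real.rpow_le_rpow (by norm_num) _ (by linarith)
    rw [le_div_iff₀ hd]; nlinarith
  have h30 : (0:ℝ) < 3 ^ (p - 2) := by positivity
  have tgt : (p - 1) * e ^ 2 * ((4 * (p - 2) + 3 ^ (p - 2)) * Z) ≤
     (16 * (p - 1) / (p * (p + 2))) * (4 * (p - 2) + (3 * p / (p - 2)) ^ (p / 2 - 1))
        * e ^ (1 + p/2) := by
    rw [epow p e hp he, ← hZ]
    have h16 : (p - 1) ≤ 16 * (p - 1) / (p * (p + 2)) := by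
      have h160 : p * (p + 2) ≤ 16 := by nlinarith
      rw [le_div_iff₀ (by positivity), mul_comm 16]
      exact mul_le_mul_of_nonneg_left h160 hp1.le
    calc _ = (p - 1) * (4 * (p - 2) + 3 ^ (p - 2)) * (e ^ 2 * Z) := by ring
      _ ≤ _ := by gcongr
  refine le_trans ?_ tgt
  rcases le_or_gt e (1/4) with h4 | h4
  · have main := Rmain p F a b c e _ 2 ((1 - e) ^ (p - 3)) hp he (by linarith) ha hab hc hF hS hH
      le_rfl (by linarith) (by
        intro s h1 h2
        exact Real.rpow_le_rpow_of_nonpos (by linarith) h1 (by linarith))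
    refine main.trans ?_
    clear main tgt hF hS hH ha hab hc hbc
    have b34 : (3/4:ℝ) ≤ 1 - e := by linarith
    have M1 : (1 - e) ^ (p - 3) ≤ 4/3 := by
      calc (1 - e) ^ (p - 3) ≤ (1 - e) ^ (-1:ℝ) :=
            Real.rpow_le_rpow_of_exponent_ge (by linarith) (by linarith) (by linarith)
        _ = (1 - e)⁻¹ := Real.rpow_neg_one _
        _ ≤ (3/4)⁻¹ := by gcongr
        _ = _ := by norm_num
    have U1 : (1 + e) ^ (p - 2) ≤ 5/4 := by
      calc (1 + e) ^ (p - 2) ≤ (1 + e) ^ (1:ℝ) :=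
            Real.rpow_le_rpow_of_exponent_le (by linarith) (by linarith)
        _ ≤ _ := by rw [Real.rpow_one]; linarith
    have L1 : (1 - e) ^ (2 - p) - 1 ≤ 4/3 * (p - 2) * e := by
      have h1 : (1 - e) ^ (2 - p) = (1 + e/(1 - e)) ^ (p - 2) := by
        rw [show 2 - p = -(p - 2) by ring, Real.rpow_neg (by linarith), ← Real.inv_rpow (by linarith)]
        congr 1
        have : 1 - e ≠ 0 := by linarith
        field_simp; ring
      have h0 : 0 ≤ e/(1 - e) := div_nonneg he (by linarith)
      have h2 : (1 + e/(1 - e)) ^ (p - 2) ≤ 1 + (p - 2) * (e/(1 - e)) :=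
        rpow_one_add_le_one_add_mul_self (by linarith) (by linarith) (by linarith)
      have h3 : e/(1 - e) ≤ 4/3 * e := by
        rw [div_le_iff₀ (by linarith)]; nlinarith
      rw [h1]; nlinarith
    have P1 : (1 - e) ^ (2 - 2 * p) ≤ 256/81 := by
      calc (1 - e) ^ (2 - 2 * p) ≤ (3/4) ^ (2 - 2 * p) :=
            Real.rpow_le_rpow_of_nonpos (by norm_num) b34 (by linarith)
        _ ≤ (3/4:ℝ) ^ (-4:ℝ) :=
            Real.rpow_le_rpow_of_exponent_ge (by norm_num) (by norm_num) (by linarith)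
        _ = _ := by
            rw [Real.rpow_neg (by norm_num), show (4:ℝ) = ((4:ℕ):ℝ) by norm_num, Real.rpow_natCast]
            norm_num
    have hU0 : 0 < (1 + e) ^ (p - 2) := Real.rpow_pos_of_pos (by linarith) _
    have hP0 : 0 < (1 - e) ^ (2 - 2 * p) := Real.rpow_pos_of_pos (by linarith) _
    have ep : e ^ p = e ^ 2 * (Z * Z) := by
      rw [hZ, ← Real.rpow_add_of_nonneg he (by linarith) (by linarith), ← Real.rpow_two,
        ← Real.rpow_add_of_nonneg he (by norm_num) (by linarith)]
      congr 1; ring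
    have hZ1 : Z ≤ 1 := Real.rpow_le_one he he1 (by linarith)
    have s1 : 2/p * (p * (p - 1) / 2 * 3 ^ (p - 2) * (e ^ p * (1 + e) ^ (p - p)))
        ≤ (p - 1) * e ^ 2 * (3 ^ (p - 2) * Z) := by
      rw [sub_self, Real.rpow_zero, ep]
      have : 2/p * (p * (p - 1) / 2 * 3 ^ (p - 2) * (e ^ 2 * (Z * Z) * 1))
        = (p - 1) * e ^ 2 * (3 ^ (p - 2) * (Z * Z)) := by field_simp
      rw [this]
      have : Z * Z ≤ Z := mul_le_of_le_one_right hZ0 hZ1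
      gcongr
    have s2 : (p - 2) * 2 / 3 * e ^ 3 * (1 - e) ^ (p - 3) ≤ (p - 1) * e ^ 2 * ((p - 2) * Z) := by
      calc _ ≤ (p - 2) * 2 / 3 * e ^ 3 * (4/3) := by gcongr
        _ = 8/9 * e ^ 2 * ((p - 2) * e) := by ring
        _ ≤ (p - 1) * e ^ 2 * ((p - 2) * Z) := by gcongr; linarith
    have s3 : ((1 - e) ^ (2 - p) - 1) * ((p - 1) * e ^ 2 * (1 + e) ^ (p - 2)) ≤
        (p - 1) * e ^ 2 * (5/3 * (p - 2) * Z) := by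
      calc _ ≤ (4/3 * (p - 2) * e) * ((p - 1) * e ^ 2 * (5/4)) := by gcongr
        _ = (p - 1) * e ^ 2 * (5/3 * (p - 2) * e) := by ring
        _ ≤ _ := by gcongr
    have s4 : (p - 2)/2 * (1 - e) ^ (2 - 2 * p) * ((p - 1) * e ^ 2 * (1 + e) ^ (p - 2)) ^ 2 ≤
        (p - 1) * e ^ 2 * (5/4 * (p - 2) * Z) := by
      calc _ ≤ (p - 2)/2 * (256/81) * ((p - 1) * e ^ 2 * (5/4)) ^ 2 := by gcongr
        _ = (p - 1) * e ^ 2 * ((p - 2) * (200/81) * (p - 1) * e * e) := by ring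
        _ ≤ (p - 1) * e ^ 2 * ((p - 2) * (200/81) * 2 * (1/4) * Z) := by gcongr; linarith
        _ = (100/81) * ((p - 1) * e ^ 2 * ((p - 2) * Z)) := by ring
        _ ≤ (5/4) * ((p - 1) * e ^ 2 * ((p - 2) * Z)) :=
            mul_le_mul_of_nonneg_right (by norm_num) (by positivity)
        _ = _ := by ring
    have s5 : 0 ≤ (p - 1) * e ^ 2 * ((p - 2) * Z) := by positivity
    have r : (p - 1) * e ^ 2 * ((4 * (p - 2) + 3 ^ (p - 2)) * Z)
      = (p - 1) * e ^ 2 * (3 ^ (p - 2) * Z) + 4 * ((p - 1) * e ^ 2 * ((p - 2) * Z)) := by ring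
    have r3 : (p - 1) * e ^ 2 * (5/3 * (p - 2) * Z) = 5/3 * ((p - 1) * e ^ 2 * ((p - 2) * Z)) := by
      ring
    have r4 : (p - 1) * e ^ 2 * (5/4 * (p - 2) * Z) = 5/4 * ((p - 1) * e ^ 2 * ((p - 2) * Z)) := by
      ring
    rw [r3] at s3
    rw [r4] at s4
    rw [r]
    clear_value Z
    generalize (p - 1) * e ^ 2 * ((p - 2) * Z) = W at *
    generalize (p - 1) * e ^ 2 * (3 ^ (p - 2) * Z) = W2 at *
    linarith only [s1, s2, s3, s4, s5]
  · refine (R1 p F a b c e hp he he1 ha hab hc hbc hF hS).trans ?_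
    apply mul_le_mul_of_nonneg_left _ (by positivity)
    have h1 : (1 + e) ^ (p - 2) ≤ 1 + (p - 2) * e :=
      rpow_one_add_le_one_add_mul_self (by linarith) (by linarith) (by linarith)
    have h2 : 1 ≤ 3 ^ (p - 2) * Z := by
      have : (3:ℝ) ^ (p - 2) = 9 ^ (p / 2 - 1) := by
        rw [show (9:ℝ) = 3 ^ 2 by norm_num, sq_rpow_half]; norm_num; ring_nf
      rw [this, hZ, ← Real.mul_rpow (by norm_num) he]
      exact Real.one_le_rpow (by linarith) (by linarith)
    nlinarith

set_option maxHeartbeats 1000000 in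
theorem caseB (p F a b c e : ℝ) (hp : 3 ≤ p) (hp4 : p ≤ 4) (he : 0 ≤ e) (he1 : e ≤ 1) (ha : |a| ≤ e)
    (hab : a ^ 2 ≤ b) (hc : 0 ≤ c) (hbc : b + c ≤ e ^ 2) (hF : (1 + a) ^ p ≤ F)
    (hS : F - 1 - p * a ≤ p * (p - 1) / 2 * (e ^ 2 * (1 + e) ^ (p - 2)))
    (hH : |F - 1 - p * a - p / 2 * ((p - 1) * b + c)|
      ≤ p * (p - 1) / 2 * 2 * (e ^ (3:ℝ) * (1 + e) ^ (p - 3))) :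
    |F ^ (2/p) - 1 - 2 * a - (-(p - 2) * a ^ 2 + (p - 1) * b + c)|
      ≤ (16 * (p - 1) / (p * (p + 2))) * (4 * (p - 2) + (3 * p / (p - 2)) ^ (p / 2 - 1))
        * e ^ (1 + p/2) := by
  have hp2 : 2 < p := by linarith
  have hd : 0 < p - 2 := by linarith
  have hp1 : 0 < p - 1 := by linarith
  set Z := e ^ (p/2 - 1) with hZ
  have hZ0 : 0 ≤ Z := by positivity
  have hZe : e ≤ Z := by
    rcases he.eq_or_lt with h | h
    · linarith
    · calc e = e ^ (1:ℝ) := (Real.rpow_one e).symm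
        _ ≤ Z := Real.rpow_le_rpow_of_exponent_ge h he1 (by linarith)
  have hbase : 6 * e ≤ 3 * p / (p - 2) * e := by
    gcongr; rw [le_div_iff₀ hd]; linarith
  have hy1 : ((6 * e)) ^ (p/2 - 1) ≤ (3 * p / (p - 2)) ^ (p / 2 - 1) * Z := by
    rw [hZ, ← Real.mul_rpow (by positivity) he]
    exact Real.rpow_le_rpow (by positivity) hbase (by linarith)
  have hchord : p * (p + 2) ≤ 9 * p - 12 := by nlinarith
  have tgt : ∀ X : ℝ, X ≤ 16 / (p * (p + 2)) * (4 * (p - 2) * e + (6 * e) ^ (p/2 - 1)) →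
     (p - 1) * e ^ 2 * X ≤
     (16 * (p - 1) / (p * (p + 2))) * (4 * (p - 2) + (3 * p / (p - 2)) ^ (p / 2 - 1))
        * e ^ (1 + p/2) := by
    intro X hX
    rw [epow p e hp2 he, ← hZ]
    calc _ ≤ (p - 1) * e ^ 2 * (16 / (p * (p + 2)) * (4 * (p - 2) * Z +
              (3 * p / (p - 2)) ^ (p / 2 - 1) * Z)) := by
            gcongr
            refine hX.trans ?_
            gcongr
      _ = _ := by ring
  have h28 : 28/3 * e ≤ 16 / (p * (p + 2)) * ((4 * (p - 2) + 6) * e) := by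
    have h280 : 28/3 * (p * (p + 2)) ≤ 16 * (4 * (p - 2) + 6) := by nlinarith
    have h281 : 28/3 ≤ 16 * (4 * (p - 2) + 6) / (p * (p + 2)) := by
      rw [le_div_iff₀ (by positivity)]; exact h280
    calc _ ≤ 16 * (4 * (p - 2) + 6) / (p * (p + 2)) * e := mul_le_mul_of_nonneg_right h281 he
      _ = _ := by ring
  have U2 : (1 + e) ^ (p - 2) ≤ (1 + e) ^ 2 := by
    rw [← Real.rpow_two]
    exact Real.rpow_le_rpow_of_exponent_le (by linarith) (by linarith)
  rcases le_or_gt e (7/50) with h4 | h4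
  · have main := Rmain p F a b c e _ (p - 1) ((1 + e) ^ (p - 3)) hp2 he (by linarith) ha hab hc hF hS hH
      (by linarith) le_rfl (by
        intro s h1 h2
        exact Real.rpow_le_rpow (by linarith) h2 (by linarith))
    refine main.trans ?_
    clear main hF hS hH ha hab hc hbc
    refine le_trans ?_ (tgt (28/3 * e) ?_)
    all_goals clear tgt
    · have b34 : (43/50:ℝ) ≤ 1 - e := by linarith
      have M1 : (1 + e) ^ (p - 3) ≤ 57/50 := by
        calc (1 + e) ^ (p - 3) ≤ (1 + e) ^ (1:ℝ) :=
              Real.rpow_le_rpow_of_exponent_le (by linarith) (by linarith)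
          _ ≤ _ := by rw [Real.rpow_one]; linarith
      have U1 : (1 + e) ^ (p - 2) ≤ 13/10 := by nlinarith
      have L1 : (1 - e) ^ (2 - p) - 1 ≤ 252/100 * e := by
        have h1 : (1 - e) ^ (2 - p) ≤ ((1 - e) ^ 2)⁻¹ := by
          rw [← Real.rpow_two, ← Real.rpow_neg (by linarith)]
          exact Real.rpow_le_rpow_of_exponent_ge (by linarith) (by linarith) (by linarith)
        have h2 : ((1 - e) ^ 2)⁻¹ ≤ 1 + 252/100 * e := by
          rw [inv_le_iff_one_le_mul₀ (by positivity)]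
          nlinarith [mul_nonneg he (show 0 ≤ 7/50 - e by linarith), mul_nonneg he (mul_nonneg he he)]
        linarith
      have P1 : (1 - e) ^ (2 - 2 * p) ≤ 5/2 := by
        calc (1 - e) ^ (2 - 2 * p) ≤ (43/50) ^ (2 - 2 * p) :=
              Real.rpow_le_rpow_of_nonpos (by norm_num) b34 (by linarith)
          _ ≤ (43/50:ℝ) ^ (-6:ℝ) :=
              Real.rpow_le_rpow_of_exponent_ge (by norm_num) (by norm_num) (by linarith)
          _ ≤ _ := by
              rw [Real.rpow_neg (by norm_num), show (6:ℝ) = ((6:ℕ):ℝ) by norm_num, Real.rpow_natCast]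
              norm_num
      have hU0 : 0 < (1 + e) ^ (p - 2) := Real.rpow_pos_of_pos (by linarith) _
      have hM0 : 0 < (1 + e) ^ (p - 3) := Real.rpow_pos_of_pos (by linarith) _
      have hP0 : 0 < (1 - e) ^ (2 - 2 * p) := Real.rpow_pos_of_pos (by linarith) _
      have e3 : e ^ (3:ℝ) = e ^ 3 := by
        rw [show (3:ℝ) = ((3:ℕ):ℝ) by norm_num, Real.rpow_natCast]
      have s1 : 2/p * (p * (p - 1) / 2 * 2 * (e ^ (3:ℝ) * (1 + e) ^ (p - 3)))
          ≤ (p - 1) * e ^ 2 * (57/25 * e) := by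
        rw [e3]
        calc _ = (p - 1) * 2 * (e ^ 3 * (1 + e) ^ (p - 3)) := by field_simp
          _ ≤ (p - 1) * 2 * (e ^ 3 * (57/50)) := by gcongr
          _ = _ := by ring
      have s2 : (p - 2) * (p - 1) / 3 * e ^ 3 * (1 + e) ^ (p - 3) ≤ (p - 1) * e ^ 2 * (19/25 * e) := by
        calc _ ≤ 2 * (p - 1) / 3 * e ^ 3 * (57/50) := by gcongr; linarith
          _ = _ := by ring
      have s3 : ((1 - e) ^ (2 - p) - 1) * ((p - 1) * e ^ 2 * (1 + e) ^ (p - 2)) ≤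
          (p - 1) * e ^ 2 * (328/100 * e) := by
        calc _ ≤ (252/100 * e) * ((p - 1) * e ^ 2 * (13/10)) := by gcongr
          _ = (p - 1) * e ^ 2 * (3.276 * e) := by ring
          _ ≤ _ := by gcongr; norm_num
      have s4 : (p - 2)/2 * (1 - e) ^ (2 - 2 * p) * ((p - 1) * e ^ 2 * (1 + e) ^ (p - 2)) ^ 2 ≤
          (p - 1) * e ^ 2 * (18/10 * e) := by
        calc _ ≤ (2)/2 * (5/2) * ((p - 1) * e ^ 2 * (13/10)) ^ 2 := by gcongr; linarith
          _ = (p - 1) * e ^ 2 * ((4.225) * (p - 1) * e * e) := by ring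
          _ ≤ (p - 1) * e ^ 2 * ((4.225) * 3 * (7/50) * e) := by gcongr; linarith
          _ = (p - 1) * e ^ 2 * (1.7745 * e) := by ring
          _ ≤ _ := by gcongr; norm_num
      have s5 : 0 ≤ (p - 1) * e ^ 2 * e := by positivity
      have r : ∀ t : ℝ, (p - 1) * e ^ 2 * (t * e) = t * ((p - 1) * e ^ 2 * e) := by intro t; ring
      rw [r] at s1 s2 s3 s4 ⊢
      linarith only [s1, s2, s3, s4, s5]
    · have h6 : 6 * e ≤ (6 * e) ^ (p/2 - 1) := by
        rcases he.eq_or_lt with h | h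
        · rw [← h]; simp; positivity
        · calc 6 * e = (6 * e) ^ (1:ℝ) := (Real.rpow_one _).symm
            _ ≤ _ := Real.rpow_le_rpow_of_exponent_ge (by linarith) (by linarith) (by linarith)
      calc 28/3 * e ≤ 16 / (p * (p + 2)) * ((4 * (p - 2) + 6) * e) := h28
        _ ≤ _ := by gcongr; linarith
  · refine (R1 p F a b c e hp2 he he1 ha hab hc hbc hF hS).trans (tgt _ (U2.trans ?_))
    clear tgt hF hS hH ha hab hc hbc U2
    rcases le_or_gt e (1/6) with h5 | h5
    · have h6 : 6 * e ≤ (6 * e) ^ (p/2 - 1) := by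
        calc 6 * e = (6 * e) ^ (1:ℝ) := (Real.rpow_one _).symm
            _ ≤ _ := Real.rpow_le_rpow_of_exponent_ge (by linarith) (by linarith) (by linarith)
      calc (1 + e) ^ 2 ≤ 28/3 * e := by nlinarith
        _ ≤ 16 / (p * (p + 2)) * ((4 * (p - 2) + 6) * e) := h28
        _ ≤ _ := by gcongr; linarith
    · have h6 : 1 ≤ (6 * e) ^ (p/2 - 1) := Real.one_le_rpow (by linarith) (by linarith)
      calc (1 + e) ^ 2 ≤ 16 / (p * (p + 2)) * (4 * (p - 2) * e + 1) := by
            rw [div_mul_eq_mul_div, le_div_iff₀ (by positivity)]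
            have h7 : (1 + e) ^ 2 * (p * (p + 2)) ≤ (1 + e) ^ 2 * (9 * p - 12) := by gcongr
            have k1 : (1 + e) ^ 2 * 15 ≤ 16 * (4 * e + 1) := by nlinarith
            have k2 : (1 + e) ^ 2 * 24 ≤ 16 * (8 * e + 1) := by nlinarith
            nlinarith [mul_le_mul_of_nonneg_left k1 (show 0 ≤ 4 - p by linarith),
              mul_le_mul_of_nonneg_left k2 (show 0 ≤ p - 3 by linarith)]
        _ ≤ _ := by gcongr

set_option maxHeartbeats 1000000 in
theorem caseC (p F a b c e : ℝ) (hp : 4 ≤ p) (he : 0 ≤ e) (he1 : e ≤ 1) (ha : |a| ≤ e)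
    (hab : a ^ 2 ≤ b) (hc : 0 ≤ c) (hbc : b + c ≤ e ^ 2) (hF : (1 + a) ^ p ≤ F)
    (hF' : F ≤ (1 + e) ^ p)
    (hS : F - 1 - p * a ≤ p * (p - 1) / 2 * (e ^ 2 * (1 + e) ^ (p - 2)))
    (hH : |F - 1 - p * a - p / 2 * ((p - 1) * b + c)|
      ≤ p * (p - 1) / 2 * ((p + 2)/3) * (e ^ (3:ℝ) * (1 + e) ^ (p - 3))) :
    |F ^ (2/p) - 1 - 2 * a - (-(p - 2) * a ^ 2 + (p - 1) * b + c)|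
      ≤ (4 / 3) * (5 * p ^ 2 - 12 * p + 7) * e ^ (3:ℝ) := by
  have hp2 : 2 < p := by linarith
  have hd : 0 < p - 2 := by linarith
  have hp1 : 0 < p - 1 := by linarith
  have e3 : e ^ (3:ℝ) = e ^ 3 := by
    rw [show (3:ℝ) = ((3:ℕ):ℝ) by norm_num, Real.rpow_natCast]
  have tgt : ∀ X : ℝ, X ≤ 13/3 * (p * e) →
      (p - 1) * e ^ 2 * X ≤ (4 / 3) * (5 * p ^ 2 - 12 * p + 7) * e ^ (3:ℝ) := by
    intro X hX
    rw [e3]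
    calc _ ≤ (p - 1) * e ^ 2 * (4/3 * (5 * p - 7) * e) := by
          gcongr; refine hX.trans ?_; nlinarith
      _ = _ := by ring
  rcases le_or_gt (p * e) (1/3) with h4 | h4
  · have he2 : e ≤ 1/12 := by nlinarith
    have main := Rmain p F a b c e _ (p - 1) ((1 + e) ^ (p - 3)) hp2 he (by linarith) ha hab hc hF hS hH
      (by linarith) le_rfl (by
        intro s h1 h2
        exact Real.rpow_le_rpow (by linarith) h2 (by linarith))
    refine main.trans (le_trans ?_ (tgt _ le_rfl))
    clear main tgt hF hF' hS hH ha hab hc hbc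
    have D : ∀ q : ℝ, 1 ≤ q → q ≤ p → 2/3 ≤ (1 - e) ^ q := by
      intro q h1 h2
      have := one_add_mul_self_le_rpow_one_add (s := -e) (by linarith) h1
      rw [← sub_eq_add_neg] at this
      nlinarith
    have U : ∀ q : ℝ, 1 ≤ q → q ≤ p → (1 + e) ^ q ≤ 3/2 := by
      intro q h1 h2
      have h3 := D q h1 h2
      have h5 : (1 + e) ^ q * (1 - e) ^ q ≤ 1 := by
        rw [← Real.mul_rpow (by linarith) (by linarith)]
        exact Real.rpow_le_one (mul_nonneg (by linarith) (by linarith)) (by nlinarith) (by linarith)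
      have : 0 < (1 + e) ^ q := Real.rpow_pos_of_pos (by linarith) _
      nlinarith
    have U1 := U (p - 2) (by linarith) (by linarith)
    have M1 := U (p - 3) (by linarith) (by linarith)
    have L1 : (1 - e) ^ (2 - p) - 1 ≤ 3/2 * (p * e) := by
      have h1 := D (p - 2) (by linarith) (by linarith)
      have h2 := one_add_mul_self_le_rpow_one_add (s := -e) (p := p - 2) (by linarith) (by linarith)
      rw [← sub_eq_add_neg] at h2
      rw [show 2 - p = -(p - 2) by ring, Real.rpow_neg (by linarith)]
      set D1 := (1 - e) ^ (p - 2)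
      have hD1 : 0 < D1 := by linarith
      have h3 : D1⁻¹ ≤ 3/2 := by
        rw [inv_le_comm₀ hD1 (by norm_num)]; norm_num; linarith
      have h5 : D1⁻¹ - 1 = D1⁻¹ * (1 - D1) := by field_simp
      have h6 : 1 - D1 ≤ p * e := by nlinarith
      rw [h5]
      have : 0 < D1⁻¹ := by positivity
      calc D1⁻¹ * (1 - D1) ≤ D1⁻¹ * (p * e) := by gcongr
        _ ≤ 3/2 * (p * e) := by gcongr
    have P1 : (1 - e) ^ (2 - 2 * p) ≤ 9/4 := by
      have h1 := D (p - 1) (by linarith) (by linarith)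
      have : (1 - e) ^ (2 - 2 * p) = (((1 - e) ^ (p - 1)) ^ 2)⁻¹ := by
        rw [← Real.rpow_natCast _ 2, ← Real.rpow_mul (by linarith), ← Real.rpow_neg (by linarith)]
        congr 1; push_cast; ring
      rw [this, inv_le_comm₀ (by positivity) (by norm_num)]
      norm_num; nlinarith
    have hU0 : 0 < (1 + e) ^ (p - 2) := Real.rpow_pos_of_pos (by linarith) _
    have hM0 : 0 < (1 + e) ^ (p - 3) := Real.rpow_pos_of_pos (by linarith) _
    have hP0 : 0 < (1 - e) ^ (2 - 2 * p) := Real.rpow_pos_of_pos (by linarith) _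
    have s1 : 2/p * (p * (p - 1) / 2 * ((p + 2)/3) * (e ^ (3:ℝ) * (1 + e) ^ (p - 3)))
        + (p - 2) * (p - 1) / 3 * e ^ 3 * (1 + e) ^ (p - 3) ≤ (p - 1) * e ^ 2 * (p * e) := by
      rw [e3]
      calc _ = (p - 1) * (2 * p / 3) * (e ^ 3 * (1 + e) ^ (p - 3)) := by field_simp; ring
        _ ≤ (p - 1) * (2 * p / 3) * (e ^ 3 * (3/2)) := by gcongr
        _ = _ := by ring
    have s3 : ((1 - e) ^ (2 - p) - 1) * ((p - 1) * e ^ 2 * (1 + e) ^ (p - 2)) ≤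
        (p - 1) * e ^ 2 * (9/4 * (p * e)) := by
      calc _ ≤ (3/2 * (p * e)) * ((p - 1) * e ^ 2 * (3/2)) := by gcongr
        _ = _ := by ring
    have s4 : (p - 2)/2 * (1 - e) ^ (2 - 2 * p) * ((p - 1) * e ^ 2 * (1 + e) ^ (p - 2)) ^ 2 ≤
        (p - 1) * e ^ 2 * (27/32 * (p * e)) := by
      calc _ ≤ p/2 * (9/4) * ((p - 1) * e ^ 2 * (3/2)) ^ 2 := by gcongr; linarith
        _ = (p - 1) * e ^ 2 * (81/32 * (p * e) * ((p - 1) * e)) := by ring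
        _ ≤ (p - 1) * e ^ 2 * (81/32 * (p * e) * (1/3)) := by
            gcongr; nlinarith
        _ = _ := by ring
    have s5 : 0 ≤ (p - 1) * e ^ 2 * (p * e) := by positivity
    have r : ∀ t : ℝ, (p - 1) * e ^ 2 * (t * (p * e)) = t * ((p - 1) * e ^ 2 * (p * e)) := by
      intro t; ring
    rw [r] at s3 s4 ⊢
    linarith only [s1, s3, s4, s5]
  rcases le_or_gt (p * e) (5/4) with h5 | h5
  · refine (R1 p F a b c e hp2 he he1 ha hab hc hbc hF hS).trans (tgt _ ?_)
    clear tgt hF hF' hS hH ha hab hc hbc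
    have h1 : (1 + e) ^ (p - 2) ≤ Real.exp (p * e) := by
      calc (1 + e) ^ (p - 2) ≤ (Real.exp e) ^ (p - 2) :=
            Real.rpow_le_rpow (by linarith) (by linarith [Real.add_one_le_exp e]) (by linarith)
        _ = Real.exp (e * (p - 2)) := (Real.exp_mul e (p-2)).symm
        _ ≤ _ := Real.exp_le_exp.mpr (by nlinarith)
    refine h1.trans ?_
    set w := p * e
    have x1 : Real.exp (1/3) ≤ 13/9 := by
      have h := Real.exp_one_lt_d9
      have h3 : Real.exp (1/3) ^ 3 = Real.exp 1 := by rw [← Real.exp_nat_mul]; norm_num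
      by_contra hcon
      push Not at hcon
      have : (13/9:ℝ) ^ 3 < Real.exp (1/3) ^ 3 := pow_lt_pow_left₀ hcon (by norm_num) (by norm_num)
      rw [h3] at this
      norm_num at this
      linarith
    have x2 : Real.exp (5/4) ≤ 65/12 := by
      have h := Real.exp_one_lt_d9
      have h2 : Real.exp (5/4) ≤ Real.exp 1 * Real.exp (1/4) := by
        rw [← Real.exp_add]; norm_num
      have h3 : Real.exp (1/4) ≤ 4/3 := by
        have := Real.add_one_le_exp (-(1/4:ℝ))
        rw [Real.exp_neg] at this
        rw [← inv_le_inv₀ (by norm_num) (Real.exp_pos _)]; norm_num at this ⊢; linarith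
      nlinarith [Real.exp_pos 1, Real.exp_pos (1/4)]
    have cv := convexOn_exp.2 (Set.mem_univ (1/3:ℝ)) (Set.mem_univ (5/4:ℝ))
      (show 0 ≤ (5/4 - w) * (12/11) by linarith) (show 0 ≤ (w - 1/3) * (12/11) by linarith) (by ring)
    simp only [smul_eq_mul] at cv
    rw [show (5/4 - w) * (12/11) * (1/3) + (w - 1/3) * (12/11) * (5/4) = w by ring] at cv
    nlinarith
  · refine (R1' p F a b c e hp2 he he1 ha hab hc hbc hF hF').trans (max_le ?_ ?_)
    · rw [e3]
      have h1 : (39/16) * p ^ 2 ≤ 5 * p ^ 2 - 12 * p + 7 := by nlinarith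
      calc 5 * e ≤ (4/3) * (39/16) * (p * e) ^ 2 * e := by gcongr; nlinarith
        _ = 4/3 * ((39/16) * p ^ 2) * e ^ 3 := by ring
        _ ≤ _ := by gcongr
    · have := tgt 1 (by linarith)
      linarith


/-- key pointwise bound -/
theorem keyPt (p k e : ℝ) (hp : 2 < p) (hk : 0 ≤ k) (hkp : k ≤ p) (he : 0 ≤ e) :
    ∃ c1 c2 : ℝ, c1 + c2 = 1 ∧ ∀ u v : ℝ, 0 ≤ u → 0 ≤ v →
      (e * v) ^ k * (u + e * v) ^ (p - k) ≤ e ^ k * (1 + e) ^ (p - k) * (c1 * u ^ p + c2 * v ^ p) := by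
  have h1e : 0 < 1 + e := by linarith
  have hp0 : 0 < p := by linarith
  refine ⟨((p - k)/p) / (1 + e), ((p - k)/p) * e / (1 + e) + k / p, by field_simp; ring, ?_⟩
  intro u v hu hv
  have hh : 0 ≤ (u + e * v) / (1 + e) := by positivity
  have hy := young p k ((u + e * v) / (1 + e)) v hp0 hk hkp hh hv
  have hconv : ((u + e * v) / (1 + e)) ^ p ≤ 1 / (1 + e) * u ^ p + e / (1 + e) * v ^ p := by
    have := (convexOn_rpow (p := p) (by linarith)).2 (Set.mem_Ici.2 hu) (Set.mem_Ici.2 hv)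
      (show 0 ≤ 1 / (1 + e) by positivity) (show 0 ≤ e / (1 + e) by positivity) (by field_simp)
    simp only [smul_eq_mul] at this
    calc _ = (1 / (1 + e) * u + e / (1 + e) * v) ^ p := by congr 1; field_simp
      _ ≤ _ := this
  have hpk : 0 ≤ (p - k)/p := div_nonneg (by linarith) hp0.le
  have e1 : (e * v) ^ k * (u + e * v) ^ (p - k)
      = e ^ k * (1 + e) ^ (p - k) * (v ^ k * ((u + e * v) / (1 + e)) ^ (p - k)) := by
    rw [Real.mul_rpow he hv, Real.div_rpow (by positivity) h1e.le]
    have : (1 + e) ^ (p - k) ≠ 0 := (Real.rpow_pos_of_pos h1e _).ne'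
    field_simp
  rw [e1]
  apply mul_le_mul_of_nonneg_left _ (by positivity)
  calc _ ≤ _ := hy
    _ ≤ (p - k)/p * (1 / (1 + e) * u ^ p + e / (1 + e) * v ^ p) + k / p * v ^ p := by gcongr
    _ = _ := by ring

/-- Hypothesis package used in the integration step. -/
structure HH {X : Type*} [MeasurableSpace X] (μ : Measure X) (p : ℝ) (f ξ η : X → ℝ) : Prop where
  hp : 2 < p
  mf : Measurable f
  mx : Measurable ξ
  my : Measurable η
  iu : Integrable (fun x => |f x| ^ p) μ
  iv : Integrable (fun x => √(ξ x ^ 2 + η x ^ 2) ^ p) μ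
  hu : ∫ x, |f x| ^ p ∂μ = 1
  hv : ∫ x, √(ξ x ^ 2 + η x ^ 2) ^ p ∂μ = 1

namespace HH
variable {X : Type*} [MeasurableSpace X] {μ : Measure X} {p : ℝ} {f ξ η : X → ℝ}

theorem ilin (h : HH μ p f ξ η) (c d : ℝ) :
    Integrable (fun x => c * |f x| ^ p + d * √(ξ x ^ 2 + η x ^ 2) ^ p) μ :=
  (h.iu.const_mul c).add (h.iv.const_mul d)

theorem inlin (h : HH μ p f ξ η) (c d : ℝ) :
    ∫ x, (c * |f x| ^ p + d * √(ξ x ^ 2 + η x ^ 2) ^ p) ∂μ = c + d := by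
  rw [integral_add (h.iu.const_mul c) (h.iv.const_mul d), integral_const_mul, integral_const_mul,
    h.hu, h.hv]; ring

theorem xle (a b : ℝ) : |a| ≤ √(a ^ 2 + b ^ 2) := by
  rw [← Real.sqrt_sq_eq_abs]; exact Real.sqrt_le_sqrt (by nlinarith [sq_nonneg b])

theorem apow (a p : ℝ) (hp : 2 < p) : |a| * |a| ^ (p - 2) = |a| ^ (p - 1) := by
  nth_rewrite 1 [← Real.rpow_one |a|]
  rw [← Real.rpow_add_of_nonneg (abs_nonneg a) (by norm_num) (by linarith)]; congr 1; ring

theorem apow2 (a p : ℝ) (hp : 2 < p) : |a| ^ (p - 2) * a ^ 2 = |a| ^ p := by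
  rw [← sq_abs a, ← Real.rpow_two, ← Real.rpow_add_of_nonneg (abs_nonneg a) (by linarith) (by norm_num)]
  congr 1; ring

/-- pointwise for `A` -/
theorem ptA (p a b c : ℝ) (hp : 2 < p) : |a * |a| ^ (p - 2) * b| ≤
    (p - 1)/p * |a| ^ p + 1/p * √(b ^ 2 + c ^ 2) ^ p := by
  have h := young p 1 |a| √(b ^ 2 + c ^ 2) (by linarith) (by norm_num) (by linarith) (abs_nonneg _)
    (Real.sqrt_nonneg _)
  refine le_trans ?_ h
  rw [abs_mul, abs_mul, abs_of_nonneg (show 0 ≤ |a| ^ (p - 2) by positivity), apow a p hp,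
    Real.rpow_one, mul_comm]
  gcongr
  exact xle b c

theorem ptBC (p a b c : ℝ) (hp : 2 < p) : |a| ^ (p - 2) * b ^ 2 + |a| ^ (p - 2) * c ^ 2 ≤
    (p - 2)/p * |a| ^ p + 2/p * √(b ^ 2 + c ^ 2) ^ p := by
  have h := young p 2 |a| √(b ^ 2 + c ^ 2) (by linarith) (by norm_num) (by linarith) (abs_nonneg _)
    (Real.sqrt_nonneg _)
  refine le_trans (le_of_eq ?_) h
  rw [Real.rpow_two, Real.sq_sqrt (by positivity)]; ring

theorem iA (h : HH μ p f ξ η) : Integrable (fun x => f x * |f x| ^ (p - 2) * ξ x) μ := by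
  have := h.mf; have := h.mx; have := h.my
  refine (h.ilin ((p - 1)/p) (1/p)).mono' (by fun_prop) (Filter.Eventually.of_forall fun x => ?_)
  exact ptA p _ _ _ h.hp

theorem iB (h : HH μ p f ξ η) : Integrable (fun x => |f x| ^ (p - 2) * ξ x ^ 2) μ := by
  have := h.mf; have := h.mx; have := h.my
  refine (h.ilin ((p - 2)/p) (2/p)).mono' (by fun_prop) (Filter.Eventually.of_forall fun x => ?_)
  rw [Real.norm_eq_abs, abs_of_nonneg (by positivity)]
  have : 0 ≤ |f x| ^ (p - 2) * η x ^ 2 := by positivity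
  linarith [ptBC p (f x) (ξ x) (η x) h.hp]

theorem iC (h : HH μ p f ξ η) : Integrable (fun x => |f x| ^ (p - 2) * η x ^ 2) μ := by
  have := h.mf; have := h.mx; have := h.my
  refine (h.ilin ((p - 2)/p) (2/p)).mono' (by fun_prop) (Filter.Eventually.of_forall fun x => ?_)
  rw [Real.norm_eq_abs, abs_of_nonneg (by positivity)]
  have : 0 ≤ |f x| ^ (p - 2) * ξ x ^ 2 := by positivity
  linarith [ptBC p (f x) (ξ x) (η x) h.hp]

theorem sqe (ε b c : ℝ) : √((ε * b) ^ 2 + (ε * c) ^ 2) = |ε| * √(b ^ 2 + c ^ 2) := by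
  rw [show (ε * b) ^ 2 + (ε * c) ^ 2 = ε ^ 2 * (b ^ 2 + c ^ 2) by ring,
    Real.sqrt_mul (sq_nonneg _), Real.sqrt_sq_eq_abs]

theorem gle (a x y p : ℝ) (hp : 2 < p) :
    ((a + x) ^ 2 + y ^ 2) ^ (p/2) ≤ (|a| + √(x ^ 2 + y ^ 2)) ^ p := by
  have h1 : (|a| + √(x ^ 2 + y ^ 2)) ^ p = ((|a| + √(x ^ 2 + y ^ 2)) ^ 2) ^ (p/2) := by
    rw [sq_rpow_half, abs_of_nonneg (show 0 ≤ |a| + √(x ^ 2 + y ^ 2) by positivity)]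
    congr 1; ring
  rw [h1]
  apply Real.rpow_le_rpow (by positivity) _ (by linarith)
  have h2 := Real.sq_sqrt (show 0 ≤ x ^ 2 + y ^ 2 by positivity)
  have h3 : a * x ≤ |a| * √(x ^ 2 + y ^ 2) := by
    calc a * x ≤ |a * x| := le_abs_self _
      _ = |a| * |x| := abs_mul _ _
      _ ≤ _ := by gcongr; exact xle x y
  nlinarith [sq_abs a]

theorem iF (h : HH μ p f ξ η) (ε : ℝ) :
    Integrable (fun x => ((f x + ε * ξ x) ^ 2 + (ε * η x) ^ 2) ^ (p/2)) μ := by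
  have := h.mf; have := h.mx; have := h.my
  obtain ⟨c1, c2, hc, hpt⟩ := keyPt p 0 |ε| h.hp le_rfl (by linarith [h.hp]) (abs_nonneg _)
  have mm : Measurable (fun x => ((f x + ε * ξ x) ^ 2 + (ε * η x) ^ 2) ^ (p/2)) :=
    Measurable.pow_const (by fun_prop) _
  refine ((h.ilin c1 c2).const_mul (|ε| ^ (0:ℝ) * (1 + |ε|) ^ (p - 0))).mono' mm.aestronglyMeasurable
    (Filter.Eventually.of_forall fun x => ?_)
  rw [Real.norm_eq_abs, abs_of_nonneg (by positivity)]
  refine (gle _ _ _ p h.hp).trans ?_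
  have := hpt |f x| √(ξ x ^ 2 + η x ^ 2) (abs_nonneg _) (Real.sqrt_nonneg _)
  rw [sqe]
  simpa using this

theorem Fle (h : HH μ p f ξ η) (ε : ℝ) :
    ∫ x, ((f x + ε * ξ x) ^ 2 + (ε * η x) ^ 2) ^ (p/2) ∂μ ≤ (1 + |ε|) ^ p := by
  obtain ⟨c1, c2, hc, hpt⟩ := keyPt p 0 |ε| h.hp le_rfl (by linarith [h.hp]) (abs_nonneg _)
  have h1 : ∫ x, ((1 + |ε|) ^ p * (c1 * |f x| ^ p + c2 * √(ξ x ^ 2 + η x ^ 2) ^ p)) ∂μ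
      = (1 + |ε|) ^ p := by
    rw [integral_const_mul, h.inlin, hc, mul_one]
  rw [← h1]
  refine integral_mono (h.iF ε) ((h.ilin c1 c2).const_mul _) fun x => ?_
  refine (gle _ _ _ p h.hp).trans ?_
  have := hpt |f x| √(ξ x ^ 2 + η x ^ 2) (abs_nonneg _) (Real.sqrt_nonneg _)
  rw [sqe]
  simpa using this

theorem iD (h : HH μ p f ξ η) (ε : ℝ) : Integrable (fun x =>
    ((f x + ε * ξ x) ^ 2 + (ε * η x) ^ 2) ^ (p/2) - |f x| ^ p
      - p * (f x * |f x| ^ (p - 2) * (ε * ξ x))) μ := by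
  refine ((h.iF ε).sub h.iu).sub (Integrable.const_mul ?_ p)
  convert h.iA.const_mul ε using 2
  ring

theorem inD (h : HH μ p f ξ η) (ε : ℝ) : ∫ x,
    (((f x + ε * ξ x) ^ 2 + (ε * η x) ^ 2) ^ (p/2) - |f x| ^ p
      - p * (f x * |f x| ^ (p - 2) * (ε * ξ x))) ∂μ =
    (∫ x, ((f x + ε * ξ x) ^ 2 + (ε * η x) ^ 2) ^ (p/2) ∂μ) - 1
      - p * (ε * ∫ x, f x * |f x| ^ (p - 2) * ξ x ∂μ) := by
  have e1 : ∀ x, p * (f x * |f x| ^ (p - 2) * (ε * ξ x))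
      = p * (ε * (f x * |f x| ^ (p - 2) * ξ x)) := fun x => by ring
  simp only [e1]
  have i0 : Integrable (fun x => ((f x + ε * ξ x) ^ 2 + (ε * η x) ^ 2) ^ (p/2) - |f x| ^ p) μ :=
    (h.iF ε).sub h.iu
  rw [integral_sub i0 ((h.iA.const_mul ε).const_mul p),
    integral_sub (h.iF ε) h.iu, integral_const_mul, integral_const_mul, h.hu]

theorem Sle (h : HH μ p f ξ η) (ε : ℝ) :
    (∫ x, ((f x + ε * ξ x) ^ 2 + (ε * η x) ^ 2) ^ (p/2) ∂μ) - 1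
      - p * (ε * ∫ x, f x * |f x| ^ (p - 2) * ξ x ∂μ)
      ≤ p * (p - 1) / 2 * (|ε| ^ 2 * (1 + |ε|) ^ (p - 2)) := by
  have hp := h.hp
  obtain ⟨c1, c2, hc, hpt⟩ := keyPt p 2 |ε| h.hp (by norm_num) (by linarith [h.hp]) (abs_nonneg _)
  rw [← h.inD]
  have h1 : ∫ x, (p * (p - 1) / 2 * (|ε| ^ 2 * (1 + |ε|) ^ (p - 2)) *
      (c1 * |f x| ^ p + c2 * √(ξ x ^ 2 + η x ^ 2) ^ p)) ∂μ
      = p * (p - 1) / 2 * (|ε| ^ 2 * (1 + |ε|) ^ (p - 2)) := by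
    rw [integral_const_mul, h.inlin, hc, mul_one]
  rw [← h1]
  refine integral_mono (h.iD ε) ((h.ilin c1 c2).const_mul _) fun x => ?_
  refine (P2 p (f x) (ε * ξ x) (ε * η x) hp).trans ?_
  have h2 := hpt |f x| √(ξ x ^ 2 + η x ^ 2) (abs_nonneg _) (Real.sqrt_nonneg _)
  have h3 := Real.sq_sqrt (show 0 ≤ (ε * ξ x) ^ 2 + (ε * η x) ^ 2 by positivity)
  nth_rewrite 1 [← h3]
  rw [sqe]
  rw [Real.rpow_two, Real.rpow_two] at h2
  have : 0 ≤ p * (p - 1) / 2 := by nlinarith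
  calc _ = p * (p - 1) / 2 * ((|ε| * √(ξ x ^ 2 + η x ^ 2)) ^ 2 *
          (|f x| + |ε| * √(ξ x ^ 2 + η x ^ 2)) ^ (p - 2)) := by ring
    _ ≤ p * (p - 1) / 2 * (|ε| ^ 2 * (1 + |ε|) ^ (p - 2)
          * (c1 * |f x| ^ p + c2 * √(ξ x ^ 2 + η x ^ 2) ^ p)) := by gcongr
    _ = _ := by ring

theorem Hle (h : HH μ p f ξ η) (ε k K : ℝ) (hk : 0 ≤ k) (hkp : k ≤ p) (hK : 0 ≤ K)
    (P3 : ∀ a x y : ℝ, |((a+x)^2+y^2)^(p/2) - |a|^p - p*(a*|a|^(p-2)*x)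
      - p/2*((p-1)*(|a|^(p-2)*x^2)+|a|^(p-2)*y^2)|
      ≤ K * (√(x^2+y^2)^k*(|a|+√(x^2+y^2))^(p-k))) :
    |(∫ x, ((f x + ε * ξ x) ^ 2 + (ε * η x) ^ 2) ^ (p/2) ∂μ) - 1
      - p * (ε * ∫ x, f x * |f x| ^ (p - 2) * ξ x ∂μ)
      - p/2 * ((p - 1) * (ε ^ 2 * ∫ x, |f x| ^ (p - 2) * ξ x ^ 2 ∂μ)
          + ε ^ 2 * ∫ x, |f x| ^ (p - 2) * η x ^ 2 ∂μ)|
      ≤ K * (|ε| ^ k * (1 + |ε|) ^ (p - k)) := by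
  have hp := h.hp
  obtain ⟨c1, c2, hc, hpt⟩ := keyPt p k |ε| h.hp hk hkp (abs_nonneg _)
  have iQ : Integrable (fun x => p/2 * ((p - 1) * (ε ^ 2 * (|f x| ^ (p - 2) * ξ x ^ 2))
      + ε ^ 2 * (|f x| ^ (p - 2) * η x ^ 2))) μ :=
    (((h.iB.const_mul _).const_mul _).add (h.iC.const_mul _)).const_mul _
  have inQ : ∫ x, (p/2 * ((p - 1) * (ε ^ 2 * (|f x| ^ (p - 2) * ξ x ^ 2))
      + ε ^ 2 * (|f x| ^ (p - 2) * η x ^ 2))) ∂μ =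
      p/2 * ((p - 1) * (ε ^ 2 * ∫ x, |f x| ^ (p - 2) * ξ x ^ 2 ∂μ)
          + ε ^ 2 * ∫ x, |f x| ^ (p - 2) * η x ^ 2 ∂μ) := by
    rw [integral_const_mul, integral_add ((h.iB.const_mul _).const_mul _) (h.iC.const_mul _),
      integral_const_mul, integral_const_mul, integral_const_mul]
  rw [← h.inD, ← inQ, ← integral_sub (h.iD ε) iQ]
  have h1 : ∫ x, (K * (|ε| ^ k * (1 + |ε|) ^ (p - k)) *
      (c1 * |f x| ^ p + c2 * √(ξ x ^ 2 + η x ^ 2) ^ p)) ∂μ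
      = K * (|ε| ^ k * (1 + |ε|) ^ (p - k)) := by
    rw [integral_const_mul, h.inlin, hc, mul_one]
  rw [← h1, ← Real.norm_eq_abs]
  refine norm_integral_le_of_norm_le ((h.ilin c1 c2).const_mul _)
    (Filter.Eventually.of_forall fun x => ?_)
  rw [Real.norm_eq_abs]
  have h2 := hpt |f x| √(ξ x ^ 2 + η x ^ 2) (abs_nonneg _) (Real.sqrt_nonneg _)
  have h3 := P3 (f x) (ε * ξ x) (ε * η x)
  rw [sqe] at h3
  calc _ = |((f x + ε * ξ x)^2+(ε * η x)^2)^(p/2) - |f x|^p - p*(f x*|f x|^(p-2)*(ε * ξ x))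
      - p/2*((p-1)*(|f x|^(p-2)*(ε * ξ x)^2)+|f x|^(p-2)*(ε * η x)^2)| := by congr 1; ring
    _ ≤ _ := h3
    _ ≤ K * (|ε| ^ k * (1 + |ε|) ^ (p - k) * (c1 * |f x| ^ p + c2 * √(ξ x ^ 2 + η x ^ 2) ^ p)) := by
        gcongr
    _ = _ := by ring

theorem Ale (h : HH μ p f ξ η) : |∫ x, f x * |f x| ^ (p - 2) * ξ x ∂μ| ≤ 1 := by
  have hp := h.hp
  have h1 := h.inlin ((p - 1)/p) (1/p)
  rw [show (p - 1)/p + 1/p = 1 by field_simp; ring] at h1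
  rw [← h1, ← Real.norm_eq_abs]
  refine norm_integral_le_of_norm_le (h.ilin _ _) (Filter.Eventually.of_forall fun x => ?_)
  exact ptA p _ _ _ h.hp

theorem BCle (h : HH μ p f ξ η) : (∫ x, |f x| ^ (p - 2) * ξ x ^ 2 ∂μ)
    + ∫ x, |f x| ^ (p - 2) * η x ^ 2 ∂μ ≤ 1 := by
  have hp := h.hp
  have h1 := h.inlin ((p - 2)/p) (2/p)
  rw [show (p - 2)/p + 2/p = 1 by field_simp; ring] at h1
  rw [← h1, ← integral_add h.iB h.iC]
  exact integral_mono (h.iB.add h.iC) (h.ilin _ _) fun x => ptBC p _ _ _ h.hp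

theorem Cnn (h : HH μ p f ξ η) : 0 ≤ ∫ x, |f x| ^ (p - 2) * η x ^ 2 ∂μ :=
  integral_nonneg fun x => by positivity

theorem AB (h : HH μ p f ξ η) : (∫ x, f x * |f x| ^ (p - 2) * ξ x ∂μ) ^ 2
    ≤ ∫ x, |f x| ^ (p - 2) * ξ x ^ 2 ∂μ := by
  set A := ∫ x, f x * |f x| ^ (p - 2) * ξ x ∂μ with hA
  have h0 : 0 ≤ ∫ x, |f x| ^ (p - 2) * (ξ x - A * f x) ^ 2 ∂μ :=
    integral_nonneg fun x => by positivity
  have e1 : ∀ x, |f x| ^ (p - 2) * (ξ x - A * f x) ^ 2 = |f x| ^ (p - 2) * ξ x ^ 2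
      - 2 * A * (f x * |f x| ^ (p - 2) * ξ x) + A ^ 2 * |f x| ^ p := fun x => by
    rw [← apow2 (f x) p h.hp]; ring
  simp only [e1] at h0
  have i0 : Integrable (fun x => |f x| ^ (p - 2) * ξ x ^ 2
      - 2 * A * (f x * |f x| ^ (p - 2) * ξ x)) μ := h.iB.sub (h.iA.const_mul _)
  rw [integral_add i0 (h.iu.const_mul _),
    integral_sub h.iB (h.iA.const_mul _), integral_const_mul, integral_const_mul, h.hu, ← hA] at h0
  nlinarith

theorem Fge (h : HH μ p f ξ η) (ε : ℝ) (he : |ε| ≤ 1) :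
    (1 + ε * ∫ x, f x * |f x| ^ (p - 2) * ξ x ∂μ) ^ p ≤
      ∫ x, ((f x + ε * ξ x) ^ 2 + (ε * η x) ^ 2) ^ (p/2) ∂μ := by
  have hp := h.hp
  set A := ∫ x, f x * |f x| ^ (p - 2) * ξ x ∂μ with hA
  have hl : 0 ≤ 1 + ε * A := by
    have h1 : |ε * A| ≤ 1 := by
      rw [abs_mul]; exact mul_le_one₀ he (abs_nonneg _) h.Ale
    linarith [neg_abs_le (ε * A)]
  set l := 1 + ε * A with hle
  have i1 : Integrable (fun x => p * l ^ (p - 1) * (|f x| ^ p + ε * (f x * |f x| ^ (p - 2) * ξ x))) μ :=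
    (h.iu.add (h.iA.const_mul _)).const_mul _
  have i2 : Integrable (fun x => ((f x + ε * ξ x) ^ 2 + (ε * η x) ^ 2) ^ (p/2)
      + (p - 1) * l ^ p * |f x| ^ p) μ := (h.iF ε).add (h.iu.const_mul _)
  have h2 := integral_mono i1 i2 (fun x => by
    have := P1 p l (f x) (ε * ξ x) (ε * η x) hp hl
    calc _ = p * l ^ (p - 1) * (|f x| ^ p + f x * |f x| ^ (p - 2) * (ε * ξ x)) := by
            ring
      _ ≤ _ := this)
  rw [integral_const_mul, integral_add h.iu (h.iA.const_mul _), integral_const_mul,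
    integral_add (h.iF ε) (h.iu.const_mul _), integral_const_mul, h.hu, ← hA, ← hle] at h2
  have h3 : l ^ (p - 1) * l = l ^ p := by
    nth_rewrite 2 [← Real.rpow_one l]
    rw [← Real.rpow_add_of_nonneg hl (by linarith) (by norm_num)]; congr 1; ring
  rw [mul_assoc, h3] at h2
  linarith

end HH

theorem final_core {X : Type*} [MeasurableSpace X] {μ : Measure X} {p : ℝ} {f ξ η : X → ℝ}
    (h : HH μ p f ξ η) (ε : ℝ) (he : |ε| ≤ 1) :
    |(∫ x, ((f x + ε * ξ x) ^ 2 + (ε * η x) ^ 2) ^ (p/2) ∂μ) ^ (2 / p) - 1 -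
        2 * (ε * ∫ x, f x * |f x| ^ (p - 2) * ξ x ∂μ) -
        (-(p - 2) * (ε * ∫ x, f x * |f x| ^ (p - 2) * ξ x ∂μ) ^ 2 +
          (p - 1) * (ε ^ 2 * ∫ x, |f x| ^ (p - 2) * ξ x ^ 2 ∂μ) +
          ε ^ 2 * ∫ x, |f x| ^ (p - 2) * η x ^ 2 ∂μ)| ≤
      (if 4 ≤ p then (4 / 3) * (5 * p ^ 2 - 12 * p + 7)
  else (16 * (p - 1) / (p * (p + 2))) * (4 * (p - 2) + (3 * p / (p - 2)) ^ (p / 2 - 1))) *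
        |ε| ^ (if 4 ≤ p then 3 else 1 + p / 2) := by
  have hp := h.hp
  have ha : |ε * ∫ x, f x * |f x| ^ (p - 2) * ξ x ∂μ| ≤ |ε| := by
    rw [abs_mul]; exact mul_le_of_le_one_right (abs_nonneg _) h.Ale
  have hab : (ε * ∫ x, f x * |f x| ^ (p - 2) * ξ x ∂μ) ^ 2
      ≤ ε ^ 2 * ∫ x, |f x| ^ (p - 2) * ξ x ^ 2 ∂μ := by
    rw [mul_pow]; exact mul_le_mul_of_nonneg_left h.AB (sq_nonneg _)
  have hc : 0 ≤ ε ^ 2 * ∫ x, |f x| ^ (p - 2) * η x ^ 2 ∂μ := mul_nonneg (sq_nonneg _) h.Cnn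
  have hbc : ε ^ 2 * (∫ x, |f x| ^ (p - 2) * ξ x ^ 2 ∂μ)
      + ε ^ 2 * ∫ x, |f x| ^ (p - 2) * η x ^ 2 ∂μ ≤ |ε| ^ 2 := by
    rw [← mul_add, sq_abs]; exact mul_le_of_le_one_right (sq_nonneg _) h.BCle
  have hF := h.Fge ε he
  have hF' := h.Fle ε
  have hS := h.Sle ε
  have hpp : 0 ≤ p * (p - 1) / 2 := by nlinarith
  split_ifs with h4
  · have hH := h.Hle ε 3 (p * (p - 1) / 2 * ((p + 2)/3)) (by norm_num) (by linarith)
      (mul_nonneg hpp (by linarith))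
      (fun a x y => P3a p ((p + 2)/3) a x y (by linarith) (by linarith) (by linarith))
    exact caseC p _ _ _ _ _ h4 (abs_nonneg _) he ha hab hc hbc hF hF' hS hH
  · rcases le_or_gt 3 p with h3 | h3
    · have hH := h.Hle ε 3 (p * (p - 1) / 2 * 2) (by norm_num) (by linarith)
        (mul_nonneg hpp (by linarith))
        (fun a x y => P3a p 2 a x y (by linarith) (by linarith) (by linarith))
      exact caseB p _ _ _ _ _ h3 (by linarith) (abs_nonneg _) he ha hab hc hbc hF hS hH
    · have hH := h.Hle ε p (p * (p - 1) / 2 * 3 ^ (p - 2)) (by linarith) le_rfl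
        (mul_nonneg hpp (by positivity))
        (fun a x y => P3b p a x y hp h3.le)
      exact caseA p _ _ _ _ _ hp h3.le (abs_nonneg _) he ha hab hc hbc hF hS hH


/-- **Second-order Taylor expansion of `‖f + εψ‖_p²` with explicit remainder bound.**
For a measure space `(X,μ)`, `2 < p < ∞`, real-valued `f` and `ψ = ξ + iη` with
`∫|f|^p = ∫|ψ|^p = 1`, and every `ε ∈ [−1,1]`,
`| ‖f+εψ‖_p² − 1 − 2ε ∫ f|f|^{p−2}ξ − ε² Q | ≤ κ_p |ε|^{β_p}` where
`Q = −(p−2)(∫ f|f|^{p−2}ξ)² + (p−1)∫ |f|^{p−2}ξ² + ∫ |f|^{p−2}η²`. -/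
theorem taylor_expansion_lp_sq {X : Type*} [MeasurableSpace X] (μ : Measure X)
    (p : ℝ) (hp : 2 < p)
    (f ξ η : X → ℝ) (hf : Measurable f) (hξ : Measurable ξ) (hη : Measurable η)
    (ψ : X → ℂ) (hψ : ψ = fun x => (ξ x : ℂ) + (η x : ℂ) * Complex.I)
    (hfnorm : ∫ x, |f x| ^ p ∂μ = 1)
    (hψnorm : ∫ x, ‖ψ x‖ ^ p ∂μ = 1)
    (ε : ℝ) (hε : ε ∈ Set.Icc (-1 : ℝ) 1) :
    |(∫ x, ‖(f x : ℂ) + (ε : ℂ) * ψ x‖ ^ p ∂μ) ^ (2 / p) - 1 -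
        2 * ε * ∫ x, f x * |f x| ^ (p - 2) * ξ x ∂μ -
        ε ^ 2 * (-(p - 2) * (∫ x, f x * |f x| ^ (p - 2) * ξ x ∂μ) ^ 2 +
          (p - 1) * ∫ x, |f x| ^ (p - 2) * ξ x ^ 2 ∂μ +
          ∫ x, |f x| ^ (p - 2) * η x ^ 2 ∂μ)| ≤
      kappaP p * |ε| ^ betaP p := by
  have n1 : ∀ x, ‖ψ x‖ = √(ξ x ^ 2 + η x ^ 2) := fun x => by
    rw [hψ]; exact Complex.norm_add_mul_I _ _
  have n2 : ∀ x, ‖(f x : ℂ) + (ε : ℂ) * ψ x‖ ^ p =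
      ((f x + ε * ξ x) ^ 2 + (ε * η x) ^ 2) ^ (p/2) := fun x => by
    have h1 : (f x : ℂ) + (ε : ℂ) * ψ x
        = ((f x + ε * ξ x : ℝ) : ℂ) + ((ε * η x : ℝ) : ℂ) * Complex.I := by
      rw [hψ]; push_cast; ring
    rw [h1, Complex.norm_add_mul_I, Real.sqrt_eq_rpow, ← Real.rpow_mul (by positivity)]
    congr 1; ring
  simp only [n1] at hψnorm
  have hh : HH μ p f ξ η :=
    { hp := hp, mf := hf, mx := hξ, my := hη
      iu := by
        by_contra hcon
        rw [integral_undef hcon] at hfnorm; norm_num at hfnorm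
      iv := by
        by_contra hcon
        rw [integral_undef hcon] at hψnorm; norm_num at hψnorm
      hu := hfnorm, hv := hψnorm }
  have hc := final_core hh ε (abs_le.2 hε)
  simp only [n2]
  unfold kappaP betaP
  refine le_trans (le_of_eq ?_) hc
  congr 1; ring
end
end

section
/- Let (X,μ) be a measure space, 1 < p < ∞, and let f, g ∈ L^p(X,μ; ℂ) be nonzero. Define the duality map D_p(h) = ‖h‖_p^{1−p} |h|^{p−2} h̄, which lies in the unit sphere of L^{p'} where 1/p' = 1 − 1/p. Then: (i) if p ≥ 2, ‖D_p(f) − D_p(g)‖_{p'} ≤ 4(p−1) ‖f − g‖_p / (‖f‖_p + ‖g‖_p); (ii) if 1 < p ≤ 2, ‖D_p(f) − D_p(g)‖_{p'} ≤ 2 (p' ‖f − g‖_p / (‖f‖_p + ‖g‖_p))^{p−1}. -/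
open MeasureTheory

noncomputable section

/-- The `L^p(μ)` norm of a complex-valued function. -/
def lpNormC {X : Type*} [MeasurableSpace X] (μ : Measure X) (p : ℝ) (h : X → ℂ) : ℝ :=
  (∫ x, ‖h x‖ ^ p ∂μ) ^ (1 / p)

/-- The duality map `D_p(h) = ‖h‖_p^{1−p} |h|^{p−2} h̄`. -/
def dualityMap {X : Type*} [MeasurableSpace X] (μ : Measure X) (p : ℝ) (h : X → ℂ) :
    X → ℂ :=
  fun x => ((lpNormC μ p h ^ (1 - p) * ‖h x‖ ^ (p - 2) : ℝ) : ℂ) * (starRingEnd ℂ) (h x)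


lemma tang_convex {r x y : ℝ} (hr : 1 ≤ r) (hx : 0 < x) (hy : 0 ≤ y) :
    x ^ r + r * x ^ (r - 1) * (y - x) ≤ y ^ r := by
  have h := one_add_mul_self_le_rpow_one_add (s := y / x - 1) (by
    have : 0 ≤ y / x := by positivity
    linarith) hr
  have h1 : (1 + (y / x - 1)) = y / x := by ring
  rw [h1, Real.div_rpow hy hx.le, le_div_iff₀ (by positivity)] at h
  have h2 : x ^ (r - 1) = x ^ r / x := by rw [Real.rpow_sub hx, Real.rpow_one]
  rw [h2]
  refine le_trans (le_of_eq ?_) h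
  field_simp

lemma tang_concave {r x y : ℝ} (hr0 : 0 ≤ r) (hr : r ≤ 1) (hx : 0 < x) (hy : 0 ≤ y) :
    y ^ r ≤ x ^ r + r * x ^ (r - 1) * (y - x) := by
  have h := rpow_one_add_le_one_add_mul_self (s := y / x - 1) (by
    have : 0 ≤ y / x := by positivity
    linarith) hr0 hr
  have h1 : (1 + (y / x - 1)) = y / x := by ring
  rw [h1, Real.div_rpow hy hx.le, div_le_iff₀ (by positivity)] at h
  have h2 : x ^ (r - 1) = x ^ r / x := by rw [Real.rpow_sub hx, Real.rpow_one]
  rw [h2]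
  refine le_trans h (le_of_eq ?_)
  field_simp

lemma trap_ineq {q s t : ℝ} (hq : 2 ≤ q) (ht : 0 ≤ t) (hst : t ≤ s) :
    s ^ q - t ^ q ≤ q * ((s ^ (q - 1) + t ^ (q - 1)) / 2) * (s - t) := by
  have hd : ∀ x ∈ Set.Ioi t, HasDerivAt
      (fun x : ℝ => q * ((x ^ (q - 1) + t ^ (q - 1)) / 2) * (x - t) - x ^ q)
      (q * (((q - 1) * x ^ (q - 1 - 1)) / 2) * (x - t) +
        q * ((x ^ (q - 1) + t ^ (q - 1)) / 2) * 1 - q * x ^ (q - 1)) x := by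
    intro x hx
    have hx0 : x ≠ 0 := (lt_of_le_of_lt ht hx).ne'
    have d1 := Real.hasDerivAt_rpow_const (x := x) (p := q - 1) (Or.inl hx0)
    have d2 := Real.hasDerivAt_rpow_const (x := x) (p := q) (Or.inl hx0)
    exact ((((d1.add_const _).div_const 2).const_mul q).mul ((hasDerivAt_id x).sub_const t)).sub d2
  have hm : MonotoneOn (fun x : ℝ => q * ((x ^ (q - 1) + t ^ (q - 1)) / 2) * (x - t) - x ^ q)
      (Set.Ici t) := by
    apply monotoneOn_of_deriv_nonneg (convex_Ici t)
    · have c1 : Continuous (fun x : ℝ => x ^ (q - 1)) := Real.continuous_rpow_const (by linarith)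
      have c2 : Continuous (fun x : ℝ => x ^ q) := Real.continuous_rpow_const (by linarith)
      fun_prop
    · rw [interior_Ici]
      intro x hx
      exact (hd x hx).differentiableAt.differentiableWithinAt
    · rw [interior_Ici]
      intro x hx
      rw [(hd x hx).deriv]
      have := tang_convex (r := q - 1) (x := x) (y := t) (by linarith) (lt_of_le_of_lt ht hx) ht
      nlinarith
  have := hm (Set.self_mem_Ici) (Set.mem_Ici.2 hst) hst
  simp only [sub_self, mul_zero] at this
  linarith

lemma mid_ineq {q s t : ℝ} (hq : 1 < q) (hq2 : q ≤ 2) (ht : 0 ≤ t) (hst : t ≤ s) :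
    s ^ q - t ^ q ≤ q * ((s + t) / 2) ^ (q - 1) * (s - t) := by
  have hd : ∀ x ∈ Set.Ioi t, HasDerivAt
      (fun x : ℝ => q * ((x + t) / 2) ^ (q - 1) * (x - t) - x ^ q)
      (q * (1 / 2 * (q - 1) * ((x + t) / 2) ^ (q - 1 - 1)) * (x - t) +
        q * ((x + t) / 2) ^ (q - 1) * 1 - q * x ^ (q - 1)) x := by
    intro x hx
    have hx0 : 0 < x := (lt_of_le_of_lt ht hx)
    have d1 := (((hasDerivAt_id x).add_const t).div_const 2).rpow_const (p := q - 1)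
      (Or.inl (by simp only [id]; positivity))
    have d2 := Real.hasDerivAt_rpow_const (x := x) (p := q) (Or.inl hx0.ne')
    exact ((d1.const_mul q).mul ((hasDerivAt_id x).sub_const t)).sub d2
  have hm : MonotoneOn (fun x : ℝ => q * ((x + t) / 2) ^ (q - 1) * (x - t) - x ^ q)
      (Set.Ici t) := by
    apply monotoneOn_of_deriv_nonneg (convex_Ici t)
    · have c1 : Continuous (fun x : ℝ => ((x + t) / 2) ^ (q - 1)) :=
        (Real.continuous_rpow_const (by linarith)).comp (by fun_prop : Continuous fun x : ℝ => (x + t) / 2)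
      have c2 : Continuous (fun x : ℝ => x ^ q) := Real.continuous_rpow_const (by linarith)
      fun_prop
    · rw [interior_Ici]
      intro x hx
      exact (hd x hx).differentiableAt.differentiableWithinAt
    · rw [interior_Ici]
      intro x hx
      rw [(hd x hx).deriv]
      have hx0 : 0 < x := (lt_of_le_of_lt ht hx)
      have := tang_concave (r := q - 1) (x := (x + t) / 2) (y := x) (by linarith) (by linarith)
        (by positivity) hx0.le
      nlinarith
  have := hm (Set.self_mem_Ici) (Set.mem_Ici.2 hst) hst
  simp only [sub_self, mul_zero] at this
  linarith

lemma mid_sum {q s t : ℝ} (hq : 1 < q) (hq2 : q ≤ 2) (ht : 0 ≤ t) (hs : 0 ≤ s) :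
    s ^ q + t ^ q ≤ q * ((s + t) / 2) ^ (q - 1) * (s + t) := by
  have h1 := Real.add_rpow_le_rpow_add hs ht hq.le
  have h2 := rpow_one_add_le_one_add_mul_self (s := 1) (by norm_num) (p := q - 1)
    (by linarith) (by linarith)
  have h3 : (s + t) ^ q = (1 + 1) ^ (q - 1) * ((s + t) / 2) ^ (q - 1) * (s + t) := by
    rw [← Real.mul_rpow (by norm_num) (by positivity)]
    have : (1 + 1) * ((s + t) / 2) = s + t := by ring
    rw [this]
    have := Real.rpow_add_one' (x := s + t) (y := q - 1) (by positivity) (by linarith)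
    rw [← this]; ring_nf
  rw [h3] at h1
  refine h1.trans ?_
  gcongr
  linarith

lemma exists_theta (z w : ℂ) : ∃ θ : ℝ, 0 ≤ θ ∧ θ ≤ 1 ∧ ∀ a b : ℝ,
    ‖(a : ℂ) * (starRingEnd ℂ) z - (b : ℂ) * (starRingEnd ℂ) w‖ ^ 2 =
      (1 - θ) * (a * ‖z‖ - b * ‖w‖) ^ 2 + θ * (a * ‖z‖ + b * ‖w‖) ^ 2 := by
  have habs : |z.re * w.re + z.im * w.im| ≤ ‖z‖ * ‖w‖ := by
    apply abs_le_of_sq_le_sq _ (by positivity)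
    rw [mul_pow, Complex.sq_norm, Complex.sq_norm, Complex.normSq_apply, Complex.normSq_apply]
    nlinarith [sq_nonneg (z.re * w.im - z.im * w.re)]
  obtain ⟨c, hc1, hc2, hc⟩ : ∃ c : ℝ, -1 ≤ c ∧ c ≤ 1 ∧
      z.re * w.re + z.im * w.im = c * (‖z‖ * ‖w‖) := by
    rcases (by positivity : 0 ≤ ‖z‖ * ‖w‖).eq_or_lt with h | h
    · rw [← h] at habs
      exact ⟨0, by norm_num, by norm_num, by rw [zero_mul]; exact abs_nonpos_iff.1 habs⟩
    · rw [abs_le] at habs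
      refine ⟨(z.re * w.re + z.im * w.im) / (‖z‖ * ‖w‖), ?_, ?_, ?_⟩
      · rw [le_div_iff₀ h]; linarith
      · rw [div_le_iff₀ h]; linarith
      · rw [div_mul_cancel₀ _ h.ne']
  refine ⟨(1 - c) / 2, by linarith, by linarith, fun a b => ?_⟩
  have hz : ‖z‖ ^ 2 = z.re * z.re + z.im * z.im := by
    rw [Complex.sq_norm, Complex.normSq_apply]
  have hw : ‖w‖ ^ 2 = w.re * w.re + w.im * w.im := by
    rw [Complex.sq_norm, Complex.normSq_apply]
  rw [Complex.sq_norm, Complex.normSq_apply]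
  simp
  linear_combination (-a^2) * hz - b^2 * hw - 2 * a * b * hc

def phiP (p : ℝ) (z : ℂ) : ℂ := ((‖z‖ ^ (p - 2) : ℝ) : ℂ) * (starRingEnd ℂ) z

lemma pow_mul_self' {p s : ℝ} (hp : 1 < p) (hs : 0 ≤ s) : s ^ (p - 2) * s = s ^ (p - 1) := by
  rw [← Real.rpow_add_one' hs (by linarith)]; ring_nf

lemma phi_theta {p : ℝ} (hp : 1 < p) (z w : ℂ) : ∃ θ : ℝ, 0 ≤ θ ∧ θ ≤ 1 ∧
    ‖z - w‖ ^ 2 = (1 - θ) * (‖z‖ - ‖w‖) ^ 2 + θ * (‖z‖ + ‖w‖) ^ 2 ∧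
    ‖phiP p z - phiP p w‖ ^ 2 = (1 - θ) * (‖z‖ ^ (p - 1) - ‖w‖ ^ (p - 1)) ^ 2
      + θ * (‖z‖ ^ (p - 1) + ‖w‖ ^ (p - 1)) ^ 2 := by
  obtain ⟨θ, h0, h1, h⟩ := exists_theta z w
  refine ⟨θ, h0, h1, ?_, ?_⟩
  · have := h 1 1
    simp only [Complex.ofReal_one, one_mul, ← map_sub, RCLike.norm_conj] at this
    exact this
  · have := h (‖z‖ ^ (p - 2)) (‖w‖ ^ (p - 2))
    rw [pow_mul_self' hp (norm_nonneg z), pow_mul_self' hp (norm_nonneg w)] at this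
    exact this

lemma phi_lip {p K : ℝ} (hp : 1 < p) (z w : ℂ) (hK : 0 ≤ K)
    (h1 : |‖z‖ ^ (p - 1) - ‖w‖ ^ (p - 1)| ≤ K * |‖z‖ - ‖w‖|)
    (h2 : ‖z‖ ^ (p - 1) + ‖w‖ ^ (p - 1) ≤ K * (‖z‖ + ‖w‖)) :
    ‖phiP p z - phiP p w‖ ≤ K * ‖z - w‖ := by
  obtain ⟨θ, h0, h1', ha, hb⟩ := phi_theta hp z w
  apply le_of_sq_le_sq _ (by positivity)
  rw [hb, mul_pow, ha]
  have e1 := pow_le_pow_left₀ (abs_nonneg _) h1 2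
  have e2 := pow_le_pow_left₀ (by positivity) h2 2
  rw [mul_pow, sq_abs, sq_abs] at e1
  rw [mul_pow] at e2
  have : 0 ≤ 1 - θ := by linarith
  nlinarith [mul_le_mul_of_nonneg_left e1 this, mul_le_mul_of_nonneg_left e2 h0]

lemma phi_mid {p : ℝ} (hp : 2 < p) (hp3 : p ≤ 3) (z w : ℂ) :
    ‖phiP p z - phiP p w‖ ≤ (p - 1) * ((‖z‖ + ‖w‖) / 2) ^ (p - 2) * ‖z - w‖ := by
  have e : p - 2 = p - 1 - 1 := by ring
  rw [e]
  have hp0 : 0 ≤ p - 1 := by linarith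
  apply phi_lip (by linarith) _ _ (by positivity)
  · rcases le_total ‖w‖ ‖z‖ with h | h
    · rw [abs_of_nonneg (sub_nonneg.2 h), abs_of_nonneg (sub_nonneg.2
        (Real.rpow_le_rpow (norm_nonneg _) h hp0))]
      exact mid_ineq (by linarith) (by linarith) (norm_nonneg _) h
    · rw [abs_sub_comm, abs_sub_comm ‖z‖, abs_of_nonneg (sub_nonneg.2 h), abs_of_nonneg (sub_nonneg.2
        (Real.rpow_le_rpow (norm_nonneg _) h hp0)), add_comm ‖z‖]
      exact mid_ineq (by linarith) (by linarith) (norm_nonneg _) h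
  · exact mid_sum (by linarith) (by linarith) (norm_nonneg _) (norm_nonneg _)

lemma phi_trap {p : ℝ} (hp3 : 3 ≤ p) (z w : ℂ) :
    ‖phiP p z - phiP p w‖ ≤ (p - 1) * ((‖z‖ ^ (p - 2) + ‖w‖ ^ (p - 2)) / 2) * ‖z - w‖ := by
  have hp0 : 0 ≤ p - 1 := by linarith
  apply phi_lip (by linarith) _ _ (by positivity)
  · have e : p - 2 = p - 1 - 1 := by ring
    rw [e]
    rcases le_total ‖w‖ ‖z‖ with h | h
    · rw [abs_of_nonneg (sub_nonneg.2 h), abs_of_nonneg (sub_nonneg.2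
        (Real.rpow_le_rpow (norm_nonneg _) h hp0))]
      exact trap_ineq (by linarith) (norm_nonneg _) h
    · rw [abs_sub_comm, abs_sub_comm ‖z‖, abs_of_nonneg (sub_nonneg.2 h), abs_of_nonneg (sub_nonneg.2
        (Real.rpow_le_rpow (norm_nonneg _) h hp0)), add_comm (‖z‖ ^ _)]
      exact trap_ineq (by linarith) (norm_nonneg _) h
  · rw [← pow_mul_self' (by linarith) (norm_nonneg z), ← pow_mul_self' (by linarith) (norm_nonneg w)]
    have a1 : 0 ≤ ‖z‖ ^ (p - 2) := by positivity
    have a2 : 0 ≤ ‖w‖ ^ (p - 2) := by positivity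
    have : (‖z‖ ^ (p - 2) + ‖w‖ ^ (p - 2)) * (‖z‖ + ‖w‖) ≤
      (p - 1) * ((‖z‖ ^ (p - 2) + ‖w‖ ^ (p - 2)) / 2) * (‖z‖ + ‖w‖) := by
      gcongr; nlinarith
    refine le_trans ?_ this
    nlinarith [mul_nonneg a1 (norm_nonneg w), mul_nonneg a2 (norm_nonneg z)]

lemma sub_rpow_le {q s t : ℝ} (hq : 0 ≤ q) (hq1 : q ≤ 1) (ht : 0 ≤ t) (hst : t ≤ s) :
    s ^ q - t ^ q ≤ (s - t) ^ q := by
  have := Real.rpow_add_le_add_rpow (sub_nonneg.2 hst) ht hq hq1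
  rw [sub_add_cancel] at this
  linarith

lemma phi_hold {p : ℝ} (hp : 1 < p) (hp2 : p ≤ 2) (z w : ℂ) :
    ‖phiP p z - phiP p w‖ ≤ 2 ^ (2 - p) * ‖z - w‖ ^ (p - 1) := by
  obtain ⟨θ, h0, h1', ha, hb⟩ := phi_theta hp z w
  have hp0 : 0 ≤ p - 1 := by linarith
  apply le_of_sq_le_sq _ (by positivity)
  have sqr : ∀ x : ℝ, 0 ≤ x → (x ^ (p - 1)) ^ 2 = (x ^ 2) ^ (p - 1) := by
    intro x hx
    rw [← Real.rpow_natCast, ← Real.rpow_natCast, ← Real.rpow_mul hx, ← Real.rpow_mul hx, mul_comm]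
  have hK : (1 : ℝ) ≤ 2 ^ (2 - p) := Real.one_le_rpow (by norm_num) (by linarith)
  have e1 : (‖z‖ ^ (p - 1) - ‖w‖ ^ (p - 1)) ^ 2 ≤ ((‖z‖ - ‖w‖) ^ 2) ^ (p - 1) := by
    rw [← sq_abs (‖z‖ - ‖w‖), ← sqr _ (abs_nonneg _)]
    apply sq_le_sq.2
    rw [abs_of_nonneg (by positivity : 0 ≤ |‖z‖ - ‖w‖| ^ (p - 1))]
    rcases le_total ‖w‖ ‖z‖ with h | h
    · rw [abs_of_nonneg (sub_nonneg.2 h), abs_of_nonneg (sub_nonneg.2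
        (Real.rpow_le_rpow (norm_nonneg _) h hp0))]
      exact sub_rpow_le hp0 (by linarith) (norm_nonneg _) h
    · rw [abs_sub_comm, abs_sub_comm ‖z‖, abs_of_nonneg (sub_nonneg.2 h), abs_of_nonneg (sub_nonneg.2
        (Real.rpow_le_rpow (norm_nonneg _) h hp0))]
      exact sub_rpow_le hp0 (by linarith) (norm_nonneg _) h
  have e2 : ‖z‖ ^ (p - 1) + ‖w‖ ^ (p - 1) ≤ 2 ^ (2 - p) * (‖z‖ + ‖w‖) ^ (p - 1) := by
    have := (Real.concaveOn_rpow hp0 (by linarith)).2 (Set.mem_Ici.2 (norm_nonneg z))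
      (Set.mem_Ici.2 (norm_nonneg w)) (by norm_num : (0:ℝ) ≤ 1/2) (by norm_num : (0:ℝ) ≤ 1/2)
      (by norm_num)
    simp only [smul_eq_mul] at this
    have e : 1 / 2 * ‖z‖ + 1 / 2 * ‖w‖ = (‖z‖ + ‖w‖) / 2 := by ring
    rw [e, Real.div_rpow (by positivity) (by norm_num)] at this
    have e3 : (2:ℝ) ^ (2 - p) = 2 / 2 ^ (p - 1) := by
      rw [eq_div_iff (by positivity), ← Real.rpow_add (by norm_num)]; norm_num
    rw [e3, div_mul_eq_mul_div, mul_div_assoc]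
    linarith
  have e2' : (‖z‖ ^ (p - 1) + ‖w‖ ^ (p - 1)) ^ 2 ≤
      (2 ^ (2 - p)) ^ 2 * ((‖z‖ + ‖w‖) ^ 2) ^ (p - 1) := by
    rw [← sqr _ (by positivity), ← mul_pow]
    exact pow_le_pow_left₀ (by positivity) e2 2
  have hc := (Real.concaveOn_rpow hp0 (by linarith)).2 (Set.mem_Ici.2 (sq_nonneg (‖z‖ - ‖w‖)))
      (Set.mem_Ici.2 (sq_nonneg (‖z‖ + ‖w‖))) (by linarith : 0 ≤ 1 - θ) h0 (by ring)
  simp only [smul_eq_mul] at hc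
  rw [hb, mul_pow, sqr _ (norm_nonneg _), ha]
  have k2 : (1:ℝ) ≤ (2 ^ (2 - p)) ^ 2 := one_le_pow₀ hK
  have e1' : (‖z‖ ^ (p - 1) - ‖w‖ ^ (p - 1)) ^ 2 ≤ (2 ^ (2 - p)) ^ 2 * ((‖z‖ - ‖w‖) ^ 2) ^ (p - 1) :=
    e1.trans (le_mul_of_one_le_left (by positivity) k2)
  calc _ ≤ (1 - θ) * ((2 ^ (2 - p)) ^ 2 * ((‖z‖ - ‖w‖) ^ 2) ^ (p - 1)) +
        θ * ((2 ^ (2 - p)) ^ 2 * ((‖z‖ + ‖w‖) ^ 2) ^ (p - 1)) := by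
          have : 0 ≤ 1 - θ := by linarith
          gcongr
    _ = (2 ^ (2 - p)) ^ 2 * ((1 - θ) * ((‖z‖ - ‖w‖) ^ 2) ^ (p - 1) +
        θ * ((‖z‖ + ‖w‖) ^ 2) ^ (p - 1)) := by ring
    _ ≤ _ := by gcongr

lemma lp_eq {X : Type*} [MeasurableSpace X] {μ : Measure X} {p : ℝ} (hp : 0 < p) {h : X → ℂ}
    (hh : MemLp h (ENNReal.ofReal p) μ) :
    eLpNorm h (ENNReal.ofReal p) μ = ENNReal.ofReal (lpNormC μ p h) := by
  rw [hh.eLpNorm_eq_integral_rpow_norm (by simpa using hp) ENNReal.ofReal_ne_top,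
    ENNReal.toReal_ofReal hp.le, lpNormC, one_div]

lemma lpNormC_nonneg {X : Type*} [MeasurableSpace X] (μ : Measure X) (p : ℝ) (h : X → ℂ) :
    0 ≤ lpNormC μ p h :=
  Real.rpow_nonneg (integral_nonneg fun x => by positivity) _

lemma lp_le {X : Type*} [MeasurableSpace X] {μ : Measure X} {p B : ℝ} (hp : 0 < p) {h : X → ℂ}
    (hm : AEStronglyMeasurable h μ) (hB : 0 ≤ B)
    (hh : eLpNorm h (ENNReal.ofReal p) μ ≤ ENNReal.ofReal B) : lpNormC μ p h ≤ B := by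
  rw [lp_eq hp ⟨hm, hh.trans_lt ENNReal.ofReal_lt_top⟩] at hh
  exact (ENNReal.ofReal_le_ofReal_iff hB).1 hh

lemma phi_meas (p : ℝ) : Measurable (phiP p) := by
  unfold phiP
  have : Measurable (starRingEnd ℂ) := Complex.continuous_conj.measurable
  fun_prop

lemma lp_hold {X : Type*} [MeasurableSpace X] {μ : Measure X} {p : ℝ} (hp : 1 < p) (hp2 : p ≤ 2)
    (u v : X → ℂ) :
    eLpNorm (fun x => phiP p (u x) - phiP p (v x)) (ENNReal.ofReal (p / (p - 1))) μ ≤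
      ENNReal.ofReal (2 ^ (2 - p)) *
        eLpNorm (fun x => u x - v x) (ENNReal.ofReal p) μ ^ (p - 1) := by
  have hp0 : 0 < p - 1 := by linarith
  have h := eLpNorm_norm_rpow (μ := μ) (p := ENNReal.ofReal (p / (p - 1)))
    (fun x => u x - v x) hp0
  rw [← ENNReal.ofReal_mul (by positivity), div_mul_cancel₀ _ hp0.ne'] at h
  rw [← h]
  apply eLpNorm_le_mul_eLpNorm_of_ae_le_mul
  filter_upwards with x
  rw [Real.norm_of_nonneg (by positivity)]
  exact phi_hold hp hp2 _ _

lemma lp_lip {X : Type*} [MeasurableSpace X] {μ : Measure X} {p : ℝ} (hp : 2 < p)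
    {u v : X → ℂ} (hu : AEStronglyMeasurable u μ) (hv : AEStronglyMeasurable v μ)
    {k : X → ℝ} (hk : AEStronglyMeasurable k μ)
    (hk1 : eLpNorm k (ENNReal.ofReal (p / (p - 2))) μ ≤ 1)
    (h : ∀ x, ‖phiP p (u x) - phiP p (v x)‖ ≤ (p - 1) * k x * ‖u x - v x‖) :
    eLpNorm (fun x => phiP p (u x) - phiP p (v x)) (ENNReal.ofReal (p / (p - 1))) μ ≤
      ENNReal.ofReal (p - 1) * eLpNorm (fun x => u x - v x) (ENNReal.ofReal p) μ := by
  have hp1 : 0 < p - 1 := by linarith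
  have hp2 : 0 < p - 2 := by linarith
  have hp0 : 0 < p := by linarith
  have ht : Real.HolderTriple (p / (p - 2)) p (p / (p - 1)) :=
    ⟨by field_simp; ring, by positivity, by positivity⟩
  haveI := ht.ennrealOfReal
  have hh := eLpNorm_smul_le_mul_eLpNorm (μ := μ) (hu.sub hv) hk (p := ENNReal.ofReal (p / (p - 2)))
    (q := ENNReal.ofReal p) (r := ENNReal.ofReal (p / (p - 1)))
  have h1 : eLpNorm (fun x => phiP p (u x) - phiP p (v x)) (ENNReal.ofReal (p / (p - 1))) μ ≤
      ENNReal.ofReal (p - 1) * eLpNorm (k • (u - v)) (ENNReal.ofReal (p / (p - 1))) μ := by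
    apply eLpNorm_le_mul_eLpNorm_of_ae_le_mul
    filter_upwards with x
    refine (h x).trans ?_
    simp only [Pi.smul_apply', Pi.sub_apply, norm_smul]
    rw [mul_assoc]
    gcongr
    exact Real.le_norm_self _
  refine h1.trans ?_
  gcongr
  refine hh.trans ?_
  calc _ ≤ 1 * eLpNorm (u - v) (ENNReal.ofReal p) μ := by gcongr
    _ = _ := by rw [one_mul]; rfl

lemma lp_lip_unit {X : Type*} [MeasurableSpace X] {μ : Measure X} {p : ℝ} (hp : 2 < p)
    {u v : X → ℂ} (hu : AEStronglyMeasurable u μ) (hv : AEStronglyMeasurable v μ)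
    (hu1 : eLpNorm u (ENNReal.ofReal p) μ = 1) (hv1 : eLpNorm v (ENNReal.ofReal p) μ = 1) :
    eLpNorm (fun x => phiP p (u x) - phiP p (v x)) (ENNReal.ofReal (p / (p - 1))) μ ≤
      ENNReal.ofReal (p - 1) * eLpNorm (fun x => u x - v x) (ENNReal.ofReal p) μ := by
  have hp2 : 0 < p - 2 := by linarith
  have key : ∀ {F : Type} [NormedAddCommGroup F] (w : X → F),
      eLpNorm (fun x => ‖w x‖ ^ (p - 2)) (ENNReal.ofReal (p / (p - 2))) μ =
        eLpNorm w (ENNReal.ofReal p) μ ^ (p - 2) := by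
    intro F _ w
    rw [eLpNorm_norm_rpow _ hp2, ← ENNReal.ofReal_mul (by positivity), div_mul_cancel₀ _ hp2.ne']
  have two : ‖(1/2 : ℝ)‖ₑ * (1 + 1) = 1 := by
    rw [one_add_one_eq_two, Real.enorm_of_nonneg (by norm_num), 
      show (2 : ENNReal) = ENNReal.ofReal 2 by simp, ← ENNReal.ofReal_mul (by norm_num)]
    norm_num
  have avg : ∀ (r : ENNReal) (a b : X → ℝ), 1 ≤ r → AEStronglyMeasurable a μ →
      AEStronglyMeasurable b μ → eLpNorm a r μ = 1 → eLpNorm b r μ = 1 →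
      eLpNorm (fun x => (a x + b x) / 2) r μ ≤ 1 := by
    intro r a b hr ha hb ha1 hb1
    have : (fun x => (a x + b x) / 2) = (1/2 : ℝ) • (a + b) := by
      ext x; simp; ring
    rw [this, eLpNorm_const_smul]
    calc _ ≤ ‖(1/2 : ℝ)‖ₑ * (eLpNorm a r μ + eLpNorm b r μ) := by
          gcongr; exact eLpNorm_add_le ha hb hr
      _ = 1 := by rw [ha1, hb1, two]
  rcases le_total p 3 with h3 | h3
  · refine lp_lip hp hu hv (k := fun x => ((‖u x‖ + ‖v x‖) / 2) ^ (p - 2)) ?_ ?_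
      (fun x => phi_mid hp h3 _ _)
    · exact (((hu.norm.add hv.norm).aemeasurable.div_const 2).pow_const _).aestronglyMeasurable
    · have := key (fun x => (‖u x‖ + ‖v x‖) / 2)
      have e : ∀ x, ‖(‖u x‖ + ‖v x‖) / 2‖ = (‖u x‖ + ‖v x‖) / 2 := fun x =>
        Real.norm_of_nonneg (by positivity)
      simp only [e] at this
      rw [this]
      apply ENNReal.rpow_le_one _ hp2.le
      apply avg _ (fun x => ‖u x‖) (fun x => ‖v x‖) _ hu.norm hv.norm
      · rw [eLpNorm_norm, hu1]
      · rw [eLpNorm_norm, hv1]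
      · rw [ENNReal.one_le_ofReal]; linarith
  · refine lp_lip hp hu hv (k := fun x => (‖u x‖ ^ (p - 2) + ‖v x‖ ^ (p - 2)) / 2) ?_ ?_
      (fun x => phi_trap h3 _ _)
    · exact (((hu.norm.aemeasurable.pow_const _).add
        (hv.norm.aemeasurable.pow_const _)).div_const 2).aestronglyMeasurable
    · apply avg _ (fun x => ‖u x‖ ^ (p - 2)) (fun x => ‖v x‖ ^ (p - 2)) _
        (hu.norm.aemeasurable.pow_const _).aestronglyMeasurable
        (hv.norm.aemeasurable.pow_const _).aestronglyMeasurable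
      · rw [key, hu1, ENNReal.one_rpow]
      · rw [key, hv1, ENNReal.one_rpow]
      · rw [ENNReal.one_le_ofReal, le_div_iff₀ hp2]; linarith

lemma dual_eq {X : Type*} [MeasurableSpace X] {μ : Measure X} {p : ℝ} {f : X → ℂ}
    (h0 : 0 < lpNormC μ p f) (x : X) :
    dualityMap μ p f x = phiP p (((lpNormC μ p f)⁻¹ • f) x) := by
  unfold dualityMap phiP
  set a := lpNormC μ p f
  have : ‖(a⁻¹ • f) x‖ ^ (p - 2) * a⁻¹ = a ^ (1 - p) * ‖f x‖ ^ (p - 2) := by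
    rw [Pi.smul_apply, norm_smul, Real.norm_of_nonneg (by positivity),
      Real.mul_rpow (by positivity) (by positivity), Real.inv_rpow h0.le,
      ← Real.rpow_neg h0.le, mul_right_comm, ← Real.rpow_neg_one, ← Real.rpow_add h0]
    ring_nf
  rw [← this]
  simp [Pi.smul_apply]
  ring

/-- Dunkl–Williams in `L^p`. -/
lemma dunkl {E : Type*} [NormedAddCommGroup E] [NormedSpace ℝ E] (f g : E) 
    (hf : 0 < ‖f‖) (hg : 0 < ‖g‖) :
    ‖‖f‖⁻¹ • f - ‖g‖⁻¹ • g‖ ≤ 4 * ‖f - g‖ / (‖f‖ + ‖g‖) := by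
  have key : ∀ f g : E, 0 < ‖f‖ → 0 < ‖g‖ → ‖f‖ * ‖‖f‖⁻¹ • f - ‖g‖⁻¹ • g‖ ≤ 2 * ‖f - g‖ := by
    intro f g hf hg
    have e : ‖f‖ • (‖f‖⁻¹ • f - ‖g‖⁻¹ • g) = (f - g) + ((‖g‖ - ‖f‖) * ‖g‖⁻¹) • g := by
      rw [smul_sub, smul_smul, smul_smul, mul_inv_cancel₀ hf.ne', one_smul, sub_mul, sub_smul,
        mul_inv_cancel₀ hg.ne', one_smul]
      abel
    rw [← norm_norm f, ← norm_smul, norm_norm, e]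
    refine (norm_add_le _ _).trans ?_
    rw [norm_smul, norm_mul, norm_inv, norm_norm, mul_assoc, inv_mul_cancel₀ hg.ne', mul_one,
      Real.norm_eq_abs]
    have := abs_norm_sub_norm_le g f
    rw [norm_sub_rev g f] at this
    linarith
  rw [le_div_iff₀ (by positivity)]
  have h1 := key f g hf hg
  have h2 := key g f hg hf
  rw [norm_sub_rev, norm_sub_rev g f] at h2
  linarith

lemma dunkl_lp {X : Type*} [MeasurableSpace X] {μ : Measure X} {p : ℝ} (hp1 : 1 < p) {f g : X → ℂ}
    (hf : MemLp f (ENNReal.ofReal p) μ) (hg : MemLp g (ENNReal.ofReal p) μ)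
    (hf0 : 0 < lpNormC μ p f) (hg0 : 0 < lpNormC μ p g) :
    eLpNorm (fun x => ((lpNormC μ p f)⁻¹ • f) x - ((lpNormC μ p g)⁻¹ • g) x) (ENNReal.ofReal p) μ ≤
      ENNReal.ofReal (4 * lpNormC μ p (fun x => f x - g x) / (lpNormC μ p f + lpNormC μ p g)) := by
  haveI : Fact (1 ≤ ENNReal.ofReal p) := ⟨by rw [ENNReal.one_le_ofReal]; exact hp1.le⟩
  have hp0 : 0 < p := by linarith
  have nrm : ∀ (h : X → ℂ) (hh : MemLp h (ENNReal.ofReal p) μ), ‖hh.toLp h‖ = lpNormC μ p h := by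
    intro h hh
    rw [Lp.norm_toLp, lp_eq hp0 hh, ENNReal.toReal_ofReal (lpNormC_nonneg _ _ _)]
  have hd := dunkl (hf.toLp f) (hg.toLp g) (by rwa [nrm]) (by rwa [nrm])
  rw [← MemLp.toLp_sub, nrm _ hf, nrm _ hg, nrm _ (hf.sub hg), ← MemLp.toLp_const_smul,
    ← MemLp.toLp_const_smul, ← MemLp.toLp_sub, nrm] at hd
  have hm : MemLp (fun x => ((lpNormC μ p f)⁻¹ • f) x - ((lpNormC μ p g)⁻¹ • g) x) 
    (ENNReal.ofReal p) μ := (hf.const_smul _).sub (hg.const_smul _)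
  rw [lp_eq hp0 hm]
  exact ENNReal.ofReal_le_ofReal hd

lemma unit_lp {X : Type*} [MeasurableSpace X] {μ : Measure X} {p : ℝ} (hp : 0 < p) {f : X → ℂ}
    (hf : MemLp f (ENNReal.ofReal p) μ) (hf0 : 0 < lpNormC μ p f) :
    eLpNorm ((lpNormC μ p f)⁻¹ • f) (ENNReal.ofReal p) μ = 1 := by
  rw [eLpNorm_const_smul, lp_eq hp hf, Real.enorm_of_nonneg (by positivity),
    ← ENNReal.ofReal_mul (by positivity), inv_mul_cancel₀ hf0.ne', ENNReal.ofReal_one]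

/-- **Hölder continuity of the duality map** (Carlen–Frank–Lieb).
For nonzero `f, g ∈ L^p(X,μ;ℂ)`, `1 < p < ∞`, with `p' = p/(p−1)`:
(i) if `p ≥ 2`, `‖D_p f − D_p g‖_{p'} ≤ 4(p−1)‖f−g‖_p/(‖f‖_p+‖g‖_p)`;
(ii) if `1 < p ≤ 2`, `‖D_p f − D_p g‖_{p'} ≤ 2 (p' ‖f−g‖_p/(‖f‖_p+‖g‖_p))^{p−1}`. -/
theorem duality_map_holder_continuity {X : Type*} [MeasurableSpace X] (μ : Measure X)
    (p : ℝ) (hp1 : 1 < p) (f g : X → ℂ)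
    (hf : MemLp f (ENNReal.ofReal p) μ) (hg : MemLp g (ENNReal.ofReal p) μ)
    (hf0 : 0 < lpNormC μ p f) (hg0 : 0 < lpNormC μ p g) :
    (2 ≤ p →
      lpNormC μ (p / (p - 1)) (fun x => dualityMap μ p f x - dualityMap μ p g x) ≤
        4 * (p - 1) * lpNormC μ p (fun x => f x - g x) /
          (lpNormC μ p f + lpNormC μ p g)) ∧
    (p ≤ 2 →
      lpNormC μ (p / (p - 1)) (fun x => dualityMap μ p f x - dualityMap μ p g x) ≤
        2 * ((p / (p - 1)) * lpNormC μ p (fun x => f x - g x) /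
          (lpNormC μ p f + lpNormC μ p g)) ^ (p - 1)) := by
  have hp0 : 0 < p := by linarith
  have hpm : 0 < p - 1 := by linarith
  have hd := dunkl_lp hp1 hf hg hf0 hg0
  have hu1 := unit_lp hp0 hf hf0
  have hv1 := unit_lp hp0 hg hg0
  have hum : AEStronglyMeasurable ((lpNormC μ p f)⁻¹ • f) μ := hf.1.const_smul _
  have hvm : AEStronglyMeasurable ((lpNormC μ p g)⁻¹ • g) μ := hg.1.const_smul _
  have hN := lpNormC_nonneg μ p (fun x => f x - g x)
  simp only [dual_eq hf0, dual_eq hg0]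
  generalize (lpNormC μ p f)⁻¹ • f = u at *
  generalize (lpNormC μ p g)⁻¹ • g = v at *
  generalize lpNormC μ p (fun x => f x - g x) = N at *
  generalize lpNormC μ p f = a at *
  generalize lpNormC μ p g = b at *
  have hm : AEStronglyMeasurable (fun x => phiP p (u x) - phiP p (v x)) μ :=
    (((phi_meas p).comp_aemeasurable hum.aemeasurable).sub
      ((phi_meas p).comp_aemeasurable hvm.aemeasurable)).aestronglyMeasurable
  have part2 : p ≤ 2 → lpNormC μ (p / (p - 1)) (fun x => phiP p (u x) - phiP p (v x)) ≤
      2 * ((p / (p - 1)) * N / (a + b)) ^ (p - 1) := by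
    intro hp2
    have h1 : lpNormC μ (p / (p - 1)) (fun x => phiP p (u x) - phiP p (v x)) ≤
        2 ^ (2 - p) * (4 * N / (a + b)) ^ (p - 1) := by
      apply lp_le (by positivity) hm (by positivity)
      refine (lp_hold hp1 hp2 u v).trans ?_
      rw [ENNReal.ofReal_mul (by positivity), ← ENNReal.ofReal_rpow_of_nonneg (by positivity) hpm.le]
      gcongr
    refine h1.trans ?_
    have e : (2:ℝ) ^ (2 - p) * (4 * N / (a + b)) ^ (p - 1) = 2 * (2 * N / (a + b)) ^ (p - 1) := by
      have : 4 * N / (a + b) = 2 * (2 * N / (a + b)) := by ring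
      rw [this, Real.mul_rpow (by norm_num) (by positivity), ← mul_assoc,
        ← Real.rpow_add (by norm_num)]
      norm_num
    rw [e]
    have : 2 ≤ p / (p - 1) := by rw [le_div_iff₀ hpm]; linarith
    gcongr
  refine ⟨fun hp2 => ?_, part2⟩
  rcases hp2.eq_or_lt with rfl | hp2
  · refine (part2 le_rfl).trans (le_of_eq ?_)
    norm_num
    ring
  · apply lp_le (by positivity) hm (by positivity)
    refine (lp_lip_unit hp2 hum hvm hu1 hv1).trans ?_
    calc _ ≤ ENNReal.ofReal (p - 1) * ENNReal.ofReal (4 * N / (a + b)) := by gcongr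
      _ = _ := by rw [← ENNReal.ofReal_mul hpm.le]; congr 1; ring
end
end
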